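/- arXiv:math/0506066 — 2 statements merged into one kernel-verified Lean document; each statement's English description precedes it below -/
import Mathlib

section
/- Let K be a field of characteristic zero and let B be a finitely generated regular commutative K-algebra which is a domain of finite Krull dimension. Then K.dim D(B) = GK(D(B))/2 = K.dim(B), where K.dim denotes the left Krull dimension in the sense of Rentschler and Gabriel. -/
/- Common definitions: degree of a function, standard finite-dimensional filtrations,
Gelfand-Kirillov dimension, return functions and filter dimensions (V. Bavula,
"Filter dimension"), and the Rentschler–Gabriel (left) Krull dimension via deviation. -/

open Filter

noncomputable section

/-- The degree `γ(f)` (as an extended real) of a function `f : ℕ → ℕ∞`: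
`inf { r : ℝ | f i ≤ i ^ r for all sufficiently large i }` (`⊤` if no such `r` exists). -/
def gammaDeg (f : ℕ → ℕ∞) : EReal :=
  sInf { x : EReal | ∃ r : ℝ, x = (r : EReal) ∧
    ∀ᶠ i in atTop, f i ≤ (⌊(i : ℝ) ^ r⌋₊ : ℕ∞) }

/-- `V` is the degree-one piece of a standard finite-dimensional filtration `{A_i = V ^ i}`
of the `K`-algebra `A`: it is finite-dimensional, contains `1` and generates `A`
(this is the filtration associated with a finite set of algebra generators). -/
structure IsStdFilt (K A : Type) [Field K] [Ring A] [Algebra K A] (V : Submodule K A) :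
    Prop where
  one_mem : (1 : A) ∈ V
  fin : FiniteDimensional K V
  gen : Algebra.adjoin K (V : Set A) = ⊤

/-- The Gelfand-Kirillov dimension `GK(A) = γ(i ↦ dim A_i)` of the algebra `A` w.r.t. the
standard filtration `{A_i = V ^ i}`. -/
def gkAlg (K A : Type) [Field K] [Ring A] [Algebra K A] (V : Submodule K A) : EReal :=
  gammaDeg fun i => (Module.finrank K (V ^ i : Submodule K A) : ℕ∞)

/-- The `K`-subspace `p • W` of the module `M` spanned by products `a • w`, `a ∈ p`, `w ∈ W`. -/
def smulSub (K : Type) [Field K] {A M : Type} [Ring A] [Algebra K A] [AddCommGroup M]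
    [Module K M] [Module A M] [IsScalarTower K A M] (p : Submodule K A) (W : Submodule K M) :
    Submodule K M :=
  Submodule.span K {x : M | ∃ a ∈ p, ∃ w ∈ W, x = a • w}

/-- `W` is a finite-dimensional generating subspace of the `A`-module `M`. -/
def IsGenSub (K A : Type) {M : Type} [Field K] [Ring A] [Algebra K A] [AddCommGroup M]
    [Module K M] [Module A M] [IsScalarTower K A M] (W : Submodule K M) : Prop :=
  FiniteDimensional K W ∧ Submodule.span A (W : Set M) = ⊤

/-- The Gelfand-Kirillov dimension `GK(M) = γ(i ↦ dim M_i)` of the module `M` w.r.t. the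
standard filtration `{M_i = V ^ i • W}`. -/
def gkModW (K : Type) [Field K] {A M : Type} [Ring A] [Algebra K A] [AddCommGroup M]
    [Module K M] [Module A M] [IsScalarTower K A M] (V : Submodule K A) (W : Submodule K M) :
    EReal :=
  gammaDeg fun i => (Module.finrank K (smulSub K (V ^ i) W) : ℕ∞)

/-- The Gelfand-Kirillov dimension of a module, as the infimum over all finite-dimensional
generating subspaces (it agrees with `gkModW` for each of them). -/
def gkMod (K A M : Type) [Field K] [Ring A] [Algebra K A] [AddCommGroup M] [Module K M]
    [Module A M] [IsScalarTower K A M] (V : Submodule K A) : EReal :=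
  ⨅ W : {W : Submodule K M // IsGenSub K A W}, gkModW K V W.1

/-- The return function `ν_{F,W}` of the `A`-module `M` associated with the standard
filtration `F = {V ^ i}` of `A` and the generating subspace `W` of `M`:
`ν(i) = min { j | V ^ j • N ⊇ W for every generating subspace N ⊆ V ^ i • W }`. -/
def retMod (K : Type) [Field K] {A M : Type} [Ring A] [Algebra K A] [AddCommGroup M]
    [Module K M] [Module A M] [IsScalarTower K A M] (V : Submodule K A) (W : Submodule K M)
    (i : ℕ) : ℕ∞ :=
  sInf { j : ℕ∞ | ∃ n : ℕ, j = (n : ℕ∞) ∧ ∀ N : Submodule K M,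
      Submodule.span A (N : Set M) = ⊤ → N ≤ smulSub K (V ^ i) W →
      W ≤ smulSub K (V ^ n) N }

/-- The filter dimension `fd(M) = γ(ν_{F,W})` of the `A`-module `M`. -/
def fdModW (K : Type) [Field K] {A M : Type} [Ring A] [Algebra K A] [AddCommGroup M]
    [Module K M] [Module A M] [IsScalarTower K A M] (V : Submodule K A) (W : Submodule K M) :
    EReal :=
  gammaDeg (retMod K V W)

/-- The return function `ν_F` of a (simple) algebra `A` w.r.t. the standard filtration
`F = {A_i = V ^ i}`: `ν_F(i) = min { j | 1 ∈ A_j a A_j for all 0 ≠ a ∈ A_i }`, where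
`A_j a A_j` is the `K`-span of `{ x * a * y | x, y ∈ A_j }`. -/
def nuFn (K : Type) [Field K] {A : Type} [Ring A] [Algebra K A] (V : Submodule K A)
    (i : ℕ) : ℕ∞ :=
  sInf { j : ℕ∞ | ∃ n : ℕ, j = (n : ℕ∞) ∧ ∀ a ∈ (V ^ i : Submodule K A), a ≠ 0 →
    (1 : A) ∈ Submodule.span K
      {x : A | ∃ u ∈ (V ^ n : Submodule K A), ∃ w ∈ (V ^ n : Submodule K A), x = u * a * w} }

/-- The left return function `λ_F` of a (simple) algebra `A`:
`λ_F(i) = min { j | 1 ∈ A a A_j for all 0 ≠ a ∈ A_i }`, where `A a A_j` is the left ideal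
of `A` generated by the set `a A_j`. -/
def lamFn (K : Type) [Field K] {A : Type} [Ring A] [Algebra K A] (V : Submodule K A)
    (i : ℕ) : ℕ∞ :=
  sInf { j : ℕ∞ | ∃ n : ℕ, j = (n : ℕ∞) ∧ ∀ a ∈ (V ^ i : Submodule K A), a ≠ 0 →
    (1 : A) ∈ Submodule.span A {x : A | ∃ w ∈ (V ^ n : Submodule K A), x = a * w} }

/-- The filter dimension `fd(A) = γ(ν_F)` of a simple finitely generated algebra `A`. -/
def fdAlg (K : Type) [Field K] {A : Type} [Ring A] [Algebra K A] (V : Submodule K A) : EReal :=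
  gammaDeg (nuFn K V)

/-- The left filter dimension `lfd(A) = γ(λ_F)` of a simple finitely generated algebra `A`. -/
def lfdAlg (K : Type) [Field K] {A : Type} [Ring A] [Algebra K A] (V : Submodule K A) : EReal :=
  gammaDeg (lamFn K V)

/-- `DevLE n α` : the deviation of the poset `α` is at most `n`. -/
def DevLE : ℕ → (α : Type) → [inst : Preorder α] → Prop
  | 0, α, _ => ∀ f : ℕ → α, Antitone f → ∀ᶠ i in atTop, ¬ f (i + 1) < f i
  | n + 1, α, _ => ∀ f : ℕ → α, Antitone f →
      ∀ᶠ i in atTop, DevLE n (Set.Icc (f (i + 1)) (f i))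

open Classical in
/-- The left Krull dimension in the sense of Rentschler–Gabriel of the `A`-module `M`:
the deviation of the poset of submodules of `M`, as an extended real (`⊥` for the zero
module, `⊤` if the deviation is not a natural number). For `M = A` this is the left Krull
dimension `K.dim A` of the ring `A`. -/
def kdimE (A M : Type) [Ring A] [AddCommGroup M] [Module A M] : EReal :=
  if Subsingleton M then ⊥
  else sInf { x : EReal | ∃ n : ℕ, x = (n : EReal) ∧ DevLE n (Submodule A M) }

/-- The order filtration `{D_i(B)}` on differential operators: `D_0(B) = End_B(B) ≅ B`
(multiplication operators) and `D_{i+1}(B) = { u ∈ End_K(B) | [u, r] ∈ D_i(B) ∀ r ∈ B }`. -/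
def diffOpsLE (K B : Type) [Field K] [CommRing B] [Algebra K B] :
    ℕ → Submodule K (Module.End K B)
  | 0 => LinearMap.range (Algebra.lmul K B).toLinearMap
  | n + 1 => ⨅ r : B, Submodule.comap
      (LinearMap.mulRight K ((Algebra.lmul K B) r) - LinearMap.mulLeft K ((Algebra.lmul K B) r))
      (diffOpsLE K B n)

/-- The ring `D(B) = ⋃_i D_i(B)` of `K`-linear differential operators on `B` (the union
is closed under the operations, so it coincides with the subalgebra it generates). -/
def diffOps (K B : Type) [Field K] [CommRing B] [Algebra K B] :
    Subalgebra K (Module.End K B) :=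
  Algebra.adjoin K (⋃ i, (diffOpsLE K B i : Set (Module.End K B)))

namespace KD

/-- orthant translate -/
def orth {s : ℕ} (p : Fin s → ℕ) (T : Finset (Fin s)) : Set (Fin s → ℕ) :=
  {a | p ≤ a ∧ ∀ i, i ∉ T → a i = p i}

def NoOrth {s : ℕ} (d : ℕ) (S : Set (Fin s → ℕ)) : Prop :=
  ∀ p T, Finset.card T = d → ¬ orth p T ⊆ S

lemma orth_mono {s : ℕ} (p : Fin s → ℕ) {T T' : Finset (Fin s)} (h : T' ⊆ T) :
    orth p T' ⊆ orth p T := fun _ ha => ⟨ha.1, fun i hi => ha.2 i (fun h' => hi (h h'))⟩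

lemma upper_acc {s : ℕ} (f : ℕ → Set (Fin s → ℕ)) (hf : Monotone f)
    (hu : ∀ c, IsUpperSet (f c)) : ∃ c0, ∀ c, c0 ≤ c → f c = f c0 := by
  by_contra hcon
  push Not at hcon
  have h1 : ∀ c0, ∃ c, c0 ≤ c ∧ ∃ a, a ∈ f c ∧ a ∉ f c0 := by
    intro c0
    obtain ⟨c, hc, hne⟩ := hcon c0
    refine ⟨c, hc, ?_⟩
    by_contra h
    push Not at h
    exact hne (Set.Subset.antisymm h (hf hc))
  choose g hg a ha hna using h1
  let t : ℕ → ℕ := fun n => Nat.rec 0 (fun _ c => g c) n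
  have ht : ∀ n, t (n+1) = g (t n) := fun n => rfl
  have htm : Monotone t := monotone_nat_of_le_succ (fun n => by rw [ht]; exact hg _)
  obtain ⟨m, n, hmn, hle⟩ := wellQuasiOrdered_le (α := Fin s → ℕ) (fun n => a (t n))
  have h2 : a (t m) ∈ f (t n) := hf (htm (Nat.succ_le_of_lt hmn)) (by rw [ht]; exact ha _)
  exact hna (t n) (hu _ hle h2)

lemma structure_lemma : ∀ (s : ℕ) (E E' : Set (Fin s → ℕ)), IsUpperSet E → IsUpperSet E' →
    ∃ F : Finset ((Fin s → ℕ) × Finset (Fin s)), E \ E' = ⋃ q ∈ F, orth q.1 q.2 := by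
  intro s
  induction s with
  | zero =>
    intro E E' _ _
    by_cases h : (0 : Fin 0 → ℕ) ∈ E \ E'
    · refine ⟨{(0, ∅)}, ?_⟩
      ext a
      have : a = 0 := Subsingleton.elim _ _
      subst this
      simp only [h, true_iff]
      simp [orth]
    · refine ⟨∅, ?_⟩
      ext a
      have : a = 0 := Subsingleton.elim _ _
      subst this
      simp only [h, false_iff]
      simp
  | succ s ih =>
    intro E E' hE hE'
    let S : Set (Fin (s+1) → ℕ) → ℕ → Set (Fin s → ℕ) := fun E c => {a | Fin.cons c a ∈ E}
    have hSm : ∀ E, IsUpperSet E → Monotone (S E) := by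
      intro E hE c c' hcc a ha
      refine hE ?_ ha
      intro i
      refine Fin.cases ?_ (fun j => ?_) i
      · simpa using hcc
      · simp
    have hSu : ∀ E, IsUpperSet E → ∀ c, IsUpperSet (S E c) := by
      intro E hE c a b hab ha
      refine hE ?_ ha
      intro i
      refine Fin.cases ?_ (fun j => ?_) i
      · simp
      · simpa using hab j
    obtain ⟨c1, hc1⟩ := upper_acc (S E) (hSm E hE) (hSu E hE)
    obtain ⟨c2, hc2⟩ := upper_acc (S E') (hSm E' hE') (hSu E' hE')
    set c0 := max c1 c2 with hc0
    have key : ∀ c, ∃ F : Finset ((Fin s → ℕ) × Finset (Fin s)),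
      S E c \ S E' c = ⋃ q ∈ F, orth q.1 q.2 := fun c => ih _ _ (hSu E hE c) (hSu E' hE' c)
    choose F hF using key
    classical
    let up : ℕ → Bool → ((Fin s → ℕ) × Finset (Fin s)) → ((Fin (s+1) → ℕ) × Finset (Fin (s+1))) :=
      fun c b q => (Fin.cons c q.1, if b then insert 0 (q.2.map (Fin.succEmb s)) else
        q.2.map (Fin.succEmb s))
    refine ⟨(Finset.range c0).biUnion (fun c => (F c).image (up c false)) ∪
      (F c0).image (up c0 true), ?_⟩
    have horF : ∀ c q x (a : Fin s → ℕ), (Fin.cons x a : Fin (s+1) → ℕ) ∈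
        orth (up c false q).1 (up c false q).2 ↔ x = c ∧ a ∈ orth q.1 q.2 := by
      intro c q x a
      simp only [orth, up, Set.mem_ofPred_eq, Pi.le_def, Fin.forall_fin_succ]
      simp
      constructor
      · rintro ⟨⟨h1, h2⟩, h3, h4⟩; exact ⟨h3, h2, h4⟩
      · rintro ⟨h3, h2, h4⟩; exact ⟨⟨h3.ge, h2⟩, h3, h4⟩
    have horT : ∀ c q x (a : Fin s → ℕ), (Fin.cons x a : Fin (s+1) → ℕ) ∈
        orth (up c true q).1 (up c true q).2 ↔ c ≤ x ∧ a ∈ orth q.1 q.2 := by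
      intro c q x a
      simp only [orth, up, Set.mem_ofPred_eq, Pi.le_def, Fin.forall_fin_succ]
      simp
      tauto
    ext a
    obtain ⟨x, b, rfl⟩ : ∃ x b, a = Fin.cons x b := ⟨a 0, Fin.tail a, by simp⟩
    have hmem : (Fin.cons x b : Fin (s+1) → ℕ) ∈ E \ E' ↔ b ∈ S E x \ S E' x := Iff.rfl
    rw [hmem]
    simp only [Set.mem_iUnion, Finset.mem_union, Finset.mem_biUnion, Finset.mem_image,
      Finset.mem_range]
    constructor
    · intro hb
      by_cases hx : x < c0
      · rw [hF] at hb
        simp only [Set.mem_iUnion] at hb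
        obtain ⟨q, hq, hb⟩ := hb
        exact ⟨_, Or.inl ⟨x, hx, q, hq, rfl⟩, (horF _ _ _ _).2 ⟨rfl, hb⟩⟩
      · push Not at hx
        rw [hc1 x (le_trans (le_max_left _ _) hx), hc2 x (le_trans (le_max_right _ _) hx),
          ← hc1 c0 (le_max_left _ _), ← hc2 c0 (le_max_right _ _), hF] at hb
        simp only [Set.mem_iUnion] at hb
        obtain ⟨q, hq, hb⟩ := hb
        exact ⟨_, Or.inr ⟨q, hq, rfl⟩, (horT _ _ _ _).2 ⟨hx, hb⟩⟩
    · rintro ⟨q', hq' | hq', hb⟩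
      · obtain ⟨c, hc, q, hq, rfl⟩ := hq'
        rw [horF] at hb
        obtain ⟨rfl, hb⟩ := hb
        rw [hF]
        simp only [Set.mem_iUnion]
        exact ⟨q, hq, hb⟩
      · obtain ⟨q, hq, rfl⟩ := hq'
        rw [horT] at hb
        obtain ⟨hx, hb⟩ := hb
        rw [hc1 x (le_trans (le_max_left _ _) hx), hc2 x (le_trans (le_max_right _ _) hx),
          ← hc1 c0 (le_max_left _ _), ← hc2 c0 (le_max_right _ _), hF]
        simp only [Set.mem_iUnion]
        exact ⟨q, hq, hb⟩

/-- the box -/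
def box (s k : ℕ) : Finset (Fin s → ℕ) := Fintype.piFinset (fun _ => Finset.range (k+1))

lemma mem_box {s k : ℕ} {a : Fin s → ℕ} : a ∈ box s k ↔ ∀ i, a i ≤ k := by
  simp [box, Nat.lt_succ_iff]

open Classical in
lemma orth_count {s : ℕ} (p : Fin s → ℕ) (T : Finset (Fin s)) (k : ℕ) :
    ((box s k).filter (fun a => a ∈ orth p T)).card ≤ (k+1)^T.card := by
  have : (Fintype.piFinset (fun _ : T => Finset.range (k+1))).card = (k+1)^T.card := by
    simp
  rw [← this]
  refine Finset.card_le_card_of_injOn (fun a i => a i) ?_ ?_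
  · intro a ha
    simp only [Finset.coe_filter, Set.mem_ofPred_eq, mem_box] at ha
    simp only [Finset.mem_coe, Fintype.mem_piFinset, Finset.mem_range]
    intro i
    exact Nat.lt_succ_of_le (ha.1 i)
  · intro a ha b hb hab
    simp only [Finset.coe_filter, Set.mem_ofPred_eq] at ha hb
    funext i
    by_cases hi : i ∈ T
    · exact congrFun hab ⟨i, hi⟩
    · rw [ha.2.2 i hi, hb.2.2 i hi]

open Classical in
lemma count_bound {s : ℕ} {E E' : Set (Fin s → ℕ)} (hE : IsUpperSet E) (hE' : IsUpperSet E')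
    {n : ℕ} (h : NoOrth n (E \ E')) :
    ∃ C, ∀ k, (k+1) * ((box s k).filter (fun a => a ∈ E \ E')).card ≤ C * (k+1)^n := by
  obtain ⟨F, hF⟩ := structure_lemma s E E' hE hE'
  refine ⟨F.card, fun k => ?_⟩
  have h1 : ((box s k).filter (fun a => a ∈ E \ E')) ⊆
      F.biUnion (fun q => (box s k).filter (fun a => a ∈ orth q.1 q.2)) := by
    intro a ha
    rw [Finset.mem_filter, hF] at ha
    simp only [Set.mem_iUnion] at ha
    obtain ⟨hb, q, hq, ha⟩ := ha
    simp only [Finset.mem_biUnion, Finset.mem_filter]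
    exact ⟨q, hq, hb, ha⟩
  have h2 : ∀ q ∈ F, (k+1) * ((box s k).filter (fun a => a ∈ orth q.1 q.2)).card ≤ (k+1)^n := by
    intro q hq
    have hlt : q.2.card < n := by
      by_contra hlt
      push Not at hlt
      obtain ⟨T', hT', hc⟩ := Finset.exists_subset_card_eq hlt
      refine h q.1 T' hc ((orth_mono q.1 hT').trans ?_)
      rw [hF]
      exact Set.subset_biUnion_of_mem (u := fun q : (Fin s → ℕ) × Finset (Fin s) => orth q.1 q.2) hq
    calc _ ≤ (k+1) * (k+1)^q.2.card := Nat.mul_le_mul_left _ (orth_count _ _ _)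
      _ = (k+1)^(q.2.card+1) := by ring
      _ ≤ _ := Nat.pow_le_pow_right (by omega) hlt
  calc _ ≤ (k+1) * ∑ q ∈ F, ((box s k).filter (fun a => a ∈ orth q.1 q.2)).card :=
        Nat.mul_le_mul_left _ ((Finset.card_le_card h1).trans Finset.card_biUnion_le)
    _ = ∑ q ∈ F, (k+1) * ((box s k).filter (fun a => a ∈ orth q.1 q.2)).card := by
        rw [Finset.mul_sum]
    _ ≤ F.card • (k+1)^n := Finset.sum_le_card_nsmul _ _ _ h2
    _ = _ := by simp

/-- saturation -/
def sat {s : ℕ} (T : Finset (Fin s)) (E : Set (Fin s → ℕ)) : Set (Fin s → ℕ) :=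
  {p | ∃ q : Fin s → ℕ, (∀ i, i ∉ T → q i = 0) ∧ p + q ∈ E}

lemma sat_upper {s : ℕ} (T : Finset (Fin s)) {E : Set (Fin s → ℕ)} (hE : IsUpperSet E) :
    IsUpperSet (sat T E) := by
  rintro a b hab ⟨q, hq, h⟩
  exact ⟨q, hq, hE (add_le_add_left hab q) h⟩

lemma sat_mono {s : ℕ} (T : Finset (Fin s)) {E E' : Set (Fin s → ℕ)} (h : E ⊆ E') :
    sat T E ⊆ sat T E' := fun _ ⟨q, hq, hh⟩ => ⟨q, hq, h hh⟩

lemma sat_inv {s : ℕ} {T U : Finset (Fin s)} {E : Set (Fin s → ℕ)} (hE : IsUpperSet E)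
    (hU : U ⊆ T) {p z : Fin s → ℕ} (hz : z ∈ orth p U) : z ∈ sat T E ↔ p ∈ sat T E := by
  constructor
  · rintro ⟨q, hq, h⟩
    refine ⟨q + (z - p), ?_, ?_⟩
    · intro i hi
      have := hz.2 i (fun h => hi (hU h))
      simp [hq i hi, this]
    · convert h using 1
      funext i
      have : p i ≤ z i := hz.1 i
      simp only [Pi.add_apply, Pi.sub_apply]
      omega
  · exact fun h => sat_upper T hE hz.1 h

lemma chain_lemma {s : ℕ} (E : ℕ → Set (Fin s → ℕ)) (Ea : Set (Fin s → ℕ))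
    (hE : ∀ i, IsUpperSet (E i)) (hEa : IsUpperSet Ea) (hanti : Antitone E)
    (hsub : ∀ i, Ea ⊆ E i) {d : ℕ} (h : NoOrth (d+1) (E 0 \ Ea)) :
    ∀ᶠ i in atTop, NoOrth d (E i \ E (i+1)) := by
  classical
  have key : ∀ T : Finset (Fin s), T.card = d →
      ∀ᶠ i in atTop, ∀ a, a ∈ sat T (E i) → a ∈ sat T (E (i+1)) := by
    intro T hT
    obtain ⟨F, hF⟩ := structure_lemma s (sat T (E 0)) (sat T Ea) (sat_upper T (hE 0))
      (sat_upper T hEa)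
    have hU : ∀ q ∈ F, q.2 ⊆ T := by
      intro q hq t ht
      by_contra htT
      have hqs : orth q.1 q.2 ⊆ sat T (E 0) \ sat T Ea := by
        rw [hF]
        exact Set.subset_biUnion_of_mem
          (u := fun q : (Fin s → ℕ) × Finset (Fin s) => orth q.1 q.2) hq
      obtain ⟨r, hr, hr0⟩ := (hqs (show q.1 ∈ orth q.1 q.2 from ⟨le_rfl, fun _ _ => rfl⟩)).1
      refine h (q.1 + r) (insert t T) (by rw [Finset.card_insert_of_notMem htT, hT]) ?_
      intro z hz
      refine ⟨hE 0 hz.1 hr0, fun hza => ?_⟩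
      have hz1 : Function.update q.1 t (z t) ∈ orth q.1 q.2 := by
        constructor
        · intro i
          by_cases hi : i = t
          · subst hi
            have := hz.1 i
            simp only [Pi.add_apply] at this
            simp
            omega
          · simp [hi]
        · intro i hi
          have : i ≠ t := fun h => hi (h ▸ ht)
          simp [this]
      refine (hqs hz1).2 ⟨fun i => if i ∈ T then z i else 0, ?_, ?_⟩
      · intro i hi; simp [hi]
      · refine hEa ?_ hza
        intro i
        simp only [Pi.add_apply]
        by_cases hi : i = t
        · subst hi; simp
        · by_cases hiT : i ∈ T
          · simp [hiT]
          · have := hz.2 i (by simp [hi, hiT])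
            simp only [Pi.add_apply] at this
            simp [hi, hiT, this, hr i hiT]
    have hev : ∀ q ∈ F, ∀ᶠ i in atTop, q.1 ∈ sat T (E i) → q.1 ∈ sat T (E (i+1)) := by
      intro q _
      by_cases hall : ∀ i, q.1 ∈ sat T (E i)
      · exact Eventually.of_forall (fun i _ => hall _)
      · push Not at hall
        obtain ⟨i0, hi0⟩ := hall
        filter_upwards [eventually_ge_atTop i0] with i hi hmem
        exact absurd (sat_mono T (hanti hi) hmem) hi0
    have hev' := (Filter.eventually_all_finset F).2 hev
    filter_upwards [hev'] with i hi a ha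
    by_cases haa : a ∈ sat T Ea
    · exact sat_mono T (hsub _) haa
    · have : a ∈ sat T (E 0) \ sat T Ea := ⟨sat_mono T (hanti (Nat.zero_le i)) ha, haa⟩
      rw [hF] at this
      simp only [Set.mem_iUnion] at this
      obtain ⟨q, hq, haq⟩ := this
      rw [sat_inv (hE _) (hU q hq) haq] at ha ⊢
      exact hi q hq ha
  have hfin : ∀ᶠ i in atTop, ∀ T : Finset (Fin s), T.card = d →
      ∀ a, a ∈ sat T (E i) → a ∈ sat T (E (i+1)) := by
    rw [Filter.eventually_all]
    intro T
    by_cases hT : T.card = d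
    · filter_upwards [key T hT] with i hi _ using hi
    · exact Eventually.of_forall (fun i h => absurd h hT)
  filter_upwards [hfin] with i hi p T hT hsubs
  have hp : p ∈ sat T (E i) := ⟨0, by simp, by simpa using (hsubs ⟨le_rfl, fun _ _ => rfl⟩).1⟩
  obtain ⟨q, hq, hq'⟩ := hi T hT p hp
  exact (hsubs (show p + q ∈ orth p T from ⟨by intro j; simp, fun j hj => by simp [hq j hj]⟩)).2 hq'

end KD

namespace KD

section Groebner
variable {K A : Type} [Field K] [Ring A] [Algebra K A] {s : ℕ} (u : Fin s → A) (w : Fin s → ℕ)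

def wtL (L : List (Fin s)) : ℕ := (L.map w).sum
def pr (L : List (Fin s)) : A := (L.map u).prod
variable (K) in
def G (k : ℕ) : Submodule K A := Submodule.span K {x | ∃ L, wtL w L < k ∧ x = pr u L}

def wt (a : Fin s → ℕ) : ℕ := ∑ i, a i * w i
def lst (a : Fin s → ℕ) : List (Fin s) := (∑ i, Multiset.replicate (a i) i).toList
def mon (a : Fin s → ℕ) : A := pr u (lst a)

lemma count_lst (a : Fin s → ℕ) (i : Fin s) : (lst a).count i = a i := by
  rw [lst, ← Multiset.coe_count, Multiset.coe_toList, Multiset.count_sum']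
  simp [Multiset.count_replicate]

@[simp] lemma wtL_cons (i : Fin s) (L) : wtL w (i :: L) = w i + wtL w L := by simp [wtL]
@[simp] lemma wtL_nil : wtL w [] = 0 := by simp [wtL]
@[simp] lemma wtL_append (L L') : wtL w (L ++ L') = wtL w L + wtL w L' := by simp [wtL]
@[simp] lemma pr_cons (i : Fin s) (L) : pr u (i :: L) = u i * pr u L := by simp [pr]
@[simp] lemma pr_nil : pr u [] = 1 := by simp [pr]
@[simp] lemma pr_append (L L') : pr u (L ++ L') = pr u L * pr u L' := by simp [pr]

lemma wt_add (a b : Fin s → ℕ) : wt w (a + b) = wt w a + wt w b := by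
  simp [wt, add_mul, Finset.sum_add_distrib]

lemma wt_single (i : Fin s) : wt w (Pi.single i 1) = w i := by
  classical
  simp only [wt]
  rw [Finset.sum_eq_single i] <;> simp +contextual [Pi.single_apply]

def cnt (L : List (Fin s)) : Fin s → ℕ := fun i => L.count i

lemma cnt_cons (i : Fin s) (L) : cnt (i :: L) = cnt L + Pi.single i 1 := by
  funext j
  simp only [cnt, List.count_cons, Pi.add_apply, Pi.single_apply, beq_iff_eq]
  congr 1
  simp [eq_comm]

lemma wt_cnt (L : List (Fin s)) : wt w (cnt L) = wtL w L := by
  induction L with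
  | nil => simp [wt, cnt]
  | cons i L ih => rw [cnt_cons, wt_add, ih, wt_single, wtL_cons, add_comm]

lemma cnt_lst (a : Fin s → ℕ) : cnt (lst a) = a := funext (count_lst a)

lemma wtL_lst (a : Fin s → ℕ) : wtL w (lst a) = wt w a := by
  rw [← wt_cnt, cnt_lst]

lemma G_mono {k l : ℕ} (h : k ≤ l) : G K u w k ≤ G K u w l :=
  Submodule.span_mono (fun _ ⟨L, h1, h2⟩ => ⟨L, h1.trans_le h, h2⟩)

lemma pr_mem_G (L) {k} (h : wtL w L < k) : pr u L ∈ G K u w k :=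
  Submodule.subset_span ⟨L, h, rfl⟩

lemma G_pr_mul (L) {k} {x : A} (hx : x ∈ G K u w k) : pr u L * x ∈ G K u w (wtL w L + k) := by
  have : G K u w k ≤ (G K u w (wtL w L + k)).comap (LinearMap.mulLeft K (pr u L)) := by
    rw [G, Submodule.span_le]
    rintro _ ⟨L', h, rfl⟩
    simp only [Submodule.comap_coe, Set.mem_preimage, LinearMap.mulLeft_apply, SetLike.mem_coe]
    rw [← pr_append]
    exact pr_mem_G u w _ (by simpa using h)
  exact this hx

lemma G_mul_pr (L) {k} {x : A} (hx : x ∈ G K u w k) : x * pr u L ∈ G K u w (k + wtL w L) := by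
  have : G K u w k ≤ (G K u w (k + wtL w L)).comap (LinearMap.mulRight K (pr u L)) := by
    rw [G, Submodule.span_le]
    rintro _ ⟨L', h, rfl⟩
    simp only [Submodule.comap_coe, Set.mem_preimage, LinearMap.mulRight_apply, SetLike.mem_coe]
    rw [← pr_append]
    exact pr_mem_G u w _ (by simpa using h)
  exact this hx

lemma G_mul {k l} {x y : A} (hx : x ∈ G K u w (k+1)) (hy : y ∈ G K u w l) :
    x * y ∈ G K u w (k + l) := by
  have : G K u w (k+1) ≤ (G K u w (k + l)).comap (LinearMap.mulRight K y) := by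
    rw [G, Submodule.span_le]
    rintro _ ⟨L', h, rfl⟩
    simp only [Submodule.comap_coe, Set.mem_preimage, LinearMap.mulRight_apply, SetLike.mem_coe]
    exact G_mono u w (by omega) (G_pr_mul u w L' hy)
  exact this hx

lemma one_mem_G {k} (h : 0 < k) : (1 : A) ∈ G K u w k := by
  simpa using pr_mem_G (K := K) u w [] (by simpa using h)

lemma gen_mem_G (i) {k} (h : w i < k) : u i ∈ G K u w k := by
  simpa using pr_mem_G (K := K) u w [i] (by simpa using h)

lemma G_gen (hgen : Algebra.adjoin K (Set.range u) = ⊤) (x : A) : ∃ k, x ∈ G K u w (k+1) := by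
  have hx : x ∈ Algebra.adjoin K (Set.range u) := by rw [hgen]; trivial
  induction hx using Algebra.adjoin_induction with
  | mem x hx => obtain ⟨i, rfl⟩ := hx; exact ⟨w i, gen_mem_G u w i (by omega)⟩
  | algebraMap r => exact ⟨0, by
      rw [Algebra.algebraMap_eq_smul_one]; exact Submodule.smul_mem _ _ (one_mem_G u w (by omega))⟩
  | add x y _ _ hx hy =>
    obtain ⟨k, hk⟩ := hx; obtain ⟨l, hl⟩ := hy
    exact ⟨k + l, Submodule.add_mem _ (G_mono u w (by omega) hk) (G_mono u w (by omega) hl)⟩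
  | mul x y _ _ hx hy =>
    obtain ⟨k, hk⟩ := hx; obtain ⟨l, hl⟩ := hy
    exact ⟨k + l, G_mono u w (by omega) (G_mul u w hk hl)⟩

/-- almost commutativity -/
def AC (K : Type) {A : Type} [Field K] [Ring A] [Algebra K A] {s : ℕ} (u : Fin s → A)
    (w : Fin s → ℕ) : Prop := ∀ i j, u i * u j - u j * u i ∈ G K u w (w i + w j)

variable {u w}

lemma wtL_perm {L L' : List (Fin s)} (h : L.Perm L') : wtL w L = wtL w L' :=
  (h.map w).sum_eq

lemma pr_perm (hc : AC K u w) {L L' : List (Fin s)} (h : L.Perm L') :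
    pr u L - pr u L' ∈ G K u w (wtL w L) := by
  induction h with
  | nil => simp
  | cons i h ih =>
    rw [pr_cons, pr_cons, ← mul_sub]
    have := G_pr_mul u w [i] ih
    simpa using this
  | swap i j L =>
    have := G_mul_pr u w L (hc j i)
    simp only [pr_cons, wtL_cons]
    rw [← mul_assoc, ← mul_assoc, ← sub_mul, ← add_assoc]
    exact this
  | trans h1 h2 ih1 ih2 =>
    rw [← wtL_perm h1] at ih2
    have := Submodule.add_mem _ ih1 ih2
    simpa using this

lemma pr_sub_mon (hc : AC K u w) (L : List (Fin s)) :
    pr u L - mon u (cnt L) ∈ G K u w (wtL w L) := by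
  refine pr_perm hc ?_
  rw [List.perm_iff_count]
  intro i
  rw [count_lst]; rfl

lemma mon_mem_G (a) {k} (h : wt w a < k) : mon u a ∈ G K u w k :=
  pr_mem_G u w _ (by rwa [wtL_lst])

lemma G_eq (hc : AC K u w) (k : ℕ) :
    G K u w k = Submodule.span K {x | ∃ b, wt w b < k ∧ x = mon u b} := by
  apply le_antisymm
  · induction k using Nat.strong_induction_on with
    | _ k ih =>
      rw [G, Submodule.span_le]
      rintro _ ⟨L, h, rfl⟩
      have h1 := ih _ h (pr_sub_mon hc L)
      have h2 : Submodule.span K {x | ∃ b, wt w b < wtL w L ∧ x = mon u b} ≤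
        Submodule.span K {x | ∃ b, wt w b < k ∧ x = mon u b} :=
        Submodule.span_mono (fun _ ⟨b, h1, h2⟩ => ⟨b, h1.trans h, h2⟩)
      have h3 := Submodule.add_mem _ (h2 h1) (Submodule.subset_span ⟨cnt L, by rwa [wt_cnt], rfl⟩)
      simpa using h3
  · rw [Submodule.span_le]
    rintro _ ⟨b, h, rfl⟩
    exact mon_mem_G b h

variable (w) in
def key (a : Fin s → ℕ) : ℕ ×ₗ Lex (Fin s → ℕ) := toLex (wt w a, toLex a)

lemma key_inj {a b : Fin s → ℕ} (h : key w a = key w b) : a = b := by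
  have := congrArg (fun x => ofLex ((ofLex x).2)) h
  simpa [key] using this

lemma key_lt_of_wt {a b : Fin s → ℕ} (h : wt w a < wt w b) : key w a < key w b := by
  rw [key, key, Prod.Lex.toLex_lt_toLex]
  exact Or.inl h

lemma key_add {a b : Fin s → ℕ} (c : Fin s → ℕ) (h : key w a < key w b) :
    key w (a + c) < key w (b + c) := by
  rw [key, key, Prod.Lex.toLex_lt_toLex] at h ⊢
  simp only [wt_add] at h ⊢
  rcases h with h | ⟨h1, h2⟩
  · left; omega
  · right
    refine ⟨by omega, ?_⟩
    rw [toLex_add, toLex_add]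
    exact add_lt_add_left h2 _

variable (K u w) in
def Alt (a : Fin s → ℕ) : Submodule K A :=
  Submodule.span K {x | ∃ b, key w b < key w a ∧ x = mon u b}

lemma G_le_Alt (hc : AC K u w) {k a} (h : k ≤ wt w a) : G K u w k ≤ Alt K u w a := by
  rw [G_eq hc, Alt]
  exact Submodule.span_mono (fun _ ⟨b, h1, h2⟩ => ⟨b, key_lt_of_wt (h1.trans_le h), h2⟩)

lemma u_mul_mon (hc : AC K u w) (i a) :
    u i * mon u a - mon u (a + Pi.single i 1) ∈ G K u w (wt w a + w i) := by
  have := pr_sub_mon hc (i :: lst a)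
  rw [pr_cons, cnt_cons, cnt_lst, wtL_cons, wtL_lst, add_comm] at this
  exact this

lemma u_mul_Alt (hc : AC K u w) (i a) {x : A} (hx : x ∈ Alt K u w a) :
    u i * x ∈ Alt K u w (a + Pi.single i 1) := by
  have : Alt K u w a ≤ (Alt K u w (a + Pi.single i 1)).comap (LinearMap.mulLeft K (u i)) := by
    rw [Alt, Submodule.span_le]
    rintro _ ⟨b, h, rfl⟩
    simp only [Submodule.comap_coe, Set.mem_preimage, LinearMap.mulLeft_apply, SetLike.mem_coe]
    have h1 := u_mul_mon hc i b
    have h2 := key_add (Pi.single i 1) h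
    have h3 : G K u w (wt w b + w i) ≤ Alt K u w (a + Pi.single i 1) := by
      refine G_le_Alt hc ?_
      rw [wt_add, wt_single]
      have : wt w b ≤ wt w a := by
        by_contra hh
        push Not at hh
        exact absurd h (key_lt_of_wt hh).not_gt
      omega
    have h4 := Submodule.add_mem _ (h3 h1) (Submodule.subset_span ⟨_, h2, rfl⟩)
    simpa using h4
  exact this hx

variable (K u w) in
/-- leading exponents of a left ideal -/
def E (N : Submodule A A) : Set (Fin s → ℕ) := {a | ∃ n ∈ N, n - mon u a ∈ Alt K u w a}

lemma E_upper (hc : AC K u w) (N : Submodule A A) : IsUpperSet (E K u w N) := by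
  have h1 : ∀ i a, a ∈ E K u w N → a + Pi.single i 1 ∈ E K u w N := by
    rintro i a ⟨n, hn, h⟩
    refine ⟨u i * n, N.smul_mem (u i) hn, ?_⟩
    have h2 := u_mul_Alt hc i a h
    have h3 := G_le_Alt (k := wt w a + w i) (a := a + Pi.single i 1) hc
      (by rw [wt_add, wt_single]) (u_mul_mon hc i a)
    have := Submodule.add_mem _ h2 h3
    rw [mul_sub] at this
    simpa using this
  have h2 : ∀ k, ∀ a b : Fin s → ℕ, a ≤ b → ∑ i, (b i - a i) = k → a ∈ E K u w N →
      b ∈ E K u w N := by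
    intro k
    induction k with
    | zero =>
      intro a b hab hs ha
      have : a = b := by
        funext i
        have := (Finset.sum_eq_zero_iff.1 hs) i (Finset.mem_univ i)
        have h' : a i ≤ b i := hab i
        omega
      rwa [← this]
    | succ k ih =>
      intro a b hab hs ha
      obtain ⟨i, hi⟩ : ∃ i, a i < b i := by
        by_contra hcon
        push Not at hcon
        have : ∑ i, (b i - a i) = 0 := Finset.sum_eq_zero (fun i _ => by have := hcon i; omega)
        omega
      refine ih (a + Pi.single i 1) b ?_ ?_ (h1 i a ha)
      · intro j
        have h' : a j ≤ b j := hab j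
        by_cases hj : j = i
        · subst hj; simp; omega
        · simp [hj, h']
      · rw [← Finset.add_sum_erase _ _ (Finset.mem_univ i)] at hs ⊢
        have : ∑ x ∈ Finset.univ.erase i, (b x - (a + Pi.single i 1 : Fin s → ℕ) x) =
            ∑ x ∈ Finset.univ.erase i, (b x - a x) := by
          refine Finset.sum_congr rfl (fun x hx => ?_)
          have := Finset.ne_of_mem_erase hx
          simp [this]
        rw [this]
        simp only [Pi.add_apply, Pi.single_eq_same]
        omega
  intro a b hab ha
  exact h2 _ a b hab rfl ha

lemma E_mono {N N' : Submodule A A} (h : N' ≤ N) : E K u w N' ⊆ E K u w N :=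
  fun _ ⟨n, hn, hh⟩ => ⟨n, h hn, hh⟩

lemma Alt_split {a : Fin s → ℕ} {x : A} (hx : x ∈ Alt K u w a) :
    x = 0 ∨ ∃ b, key w b < key w a ∧ ∃ c : K, x - c • mon u b ∈ Alt K u w b := by
  rw [Alt] at hx
  induction hx using Submodule.span_induction with
  | mem x hx =>
    obtain ⟨b, hb, rfl⟩ := hx
    exact Or.inr ⟨b, hb, 1, by simp⟩
  | zero => exact Or.inl rfl
  | add x y _ _ hx hy =>
    have hsub : ∀ b b', key w b < key w b' → ∀ c : K, ∀ x : A, x - c • mon u b ∈ Alt K u w b →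
        x ∈ Alt K u w b' := by
      intro b b' hbb c x hx
      have h1 : Alt K u w b ≤ Alt K u w b' :=
        Submodule.span_mono (fun _ ⟨d, h1, h2⟩ => ⟨d, h1.trans hbb, h2⟩)
      have := Submodule.add_mem _ (h1 hx)
        (Submodule.smul_mem _ c (Submodule.subset_span ⟨b, hbb, rfl⟩))
      simpa using this
    rcases hx with rfl | ⟨b, hb, c, hx⟩
    · simpa using hy
    rcases hy with rfl | ⟨b', hb', c', hy⟩
    · right; exact ⟨b, hb, c, by simpa using hx⟩
    right
    rcases lt_trichotomy (key w b) (key w b') with h | h | h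
    · refine ⟨b', hb', c', ?_⟩
      rw [add_sub_assoc]
      exact Submodule.add_mem _ (hsub b b' h c x hx) hy
    · have := key_inj h
      subst this
      refine ⟨b, hb, c + c', ?_⟩
      rw [add_smul, add_sub_add_comm]
      exact Submodule.add_mem _ hx hy
    · refine ⟨b, hb, c, ?_⟩
      rw [add_comm, add_sub_assoc]
      exact Submodule.add_mem _ (hsub b' b h c' y hy) hx
  | smul r x _ hx =>
    rcases hx with rfl | ⟨b, hb, c, hx⟩
    · left; simp
    · right
      refine ⟨b, hb, r * c, ?_⟩
      rw [mul_smul, ← smul_sub]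
      exact Submodule.smul_mem _ _ hx

lemma Alt_le {a b : Fin s → ℕ} (h : key w a ≤ key w b) : Alt K u w a ≤ Alt K u w b :=
  Submodule.span_mono (fun _ ⟨d, h1, h2⟩ => ⟨d, h1.trans_le h, h2⟩)

/-- reduction lemma -/
lemma reduction (N' N : Submodule A A) (hN : N' ≤ N) (nn : (Fin s → ℕ) → A)
    (hnn : ∀ a, a ∈ E K u w N → nn a ∈ N ∧ nn a - mon u a ∈ Alt K u w a) :
    ∀ a, ∀ v ∈ N, v ∈ Alt K u w a → v ∈ N'.restrictScalars K ⊔ Submodule.span K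
      {x | ∃ b, key w b < key w a ∧ b ∈ E K u w N \ E K u w N' ∧ x = nn b} := by
  have wf : WellFounded (fun a b : Fin s → ℕ => key w a < key w b) :=
    InvImage.wf (key w) wellFounded_lt
  intro a
  induction a using wf.induction with
  | _ a ih =>
    intro v hv hva
    have hmono : ∀ b, key w b < key w a → N'.restrictScalars K ⊔ Submodule.span K
      {x | ∃ d, key w d < key w b ∧ d ∈ E K u w N \ E K u w N' ∧ x = nn d} ≤
      N'.restrictScalars K ⊔ Submodule.span K
      {x | ∃ b, key w b < key w a ∧ b ∈ E K u w N \ E K u w N' ∧ x = nn b} := by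
      intro b hb
      refine sup_le_sup_left (Submodule.span_mono ?_) _
      rintro _ ⟨d, h1, h2, h3⟩
      exact ⟨d, h1.trans hb, h2, h3⟩
    rcases Alt_split hva with rfl | ⟨b, hb, c, hx⟩
    · exact Submodule.zero_mem _
    by_cases hc0 : c = 0
    · subst hc0
      exact hmono b hb (ih b hb v hv (by simpa using hx))
    have hbE : b ∈ E K u w N := by
      refine ⟨c⁻¹ • v, ?_, ?_⟩
      · rw [← algebraMap_smul A c⁻¹ v]; exact N.smul_mem _ hv
      · have := Submodule.smul_mem _ c⁻¹ hx
        rwa [smul_sub, smul_smul, inv_mul_cancel₀ hc0, one_smul] at this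
    have hKN : ∀ (P : Submodule A A) (c : K) x, x ∈ P → c • x ∈ P := by
      intro P c x hx
      rw [← algebraMap_smul A c x]; exact P.smul_mem _ hx
    have step : ∀ y ∈ N, y - mon u b ∈ Alt K u w b → v - c • y ∈ N ∧ v - c • y ∈ Alt K u w b := by
      intro y hy hyb
      refine ⟨N.sub_mem hv (hKN _ _ _ hy), ?_⟩
      have := Submodule.sub_mem _ hx (Submodule.smul_mem _ c hyb)
      rw [smul_sub] at this
      simpa using this
    by_cases hbE' : b ∈ E K u w N'
    · obtain ⟨y, hy, hyb⟩ := hbE'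
      obtain ⟨h1, h2⟩ := step y (hN hy) hyb
      have h3 := hmono b hb (ih b hb _ h1 h2)
      have h4 : c • y ∈ N'.restrictScalars K ⊔ Submodule.span K
        {x | ∃ b, key w b < key w a ∧ b ∈ E K u w N \ E K u w N' ∧ x = nn b} :=
        Submodule.mem_sup_left (hKN _ _ _ hy)
      simpa using Submodule.add_mem _ h3 h4
    · obtain ⟨hy, hyb⟩ := hnn b hbE
      obtain ⟨h1, h2⟩ := step _ hy hyb
      have h3 := hmono b hb (ih b hb _ h1 h2)
      have h4 : c • nn b ∈ N'.restrictScalars K ⊔ Submodule.span K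
        {x | ∃ b, key w b < key w a ∧ b ∈ E K u w N \ E K u w N' ∧ x = nn b} :=
        Submodule.mem_sup_right (Submodule.smul_mem _ _
          (Submodule.subset_span ⟨b, hb, ⟨hbE, hbE'⟩, rfl⟩))
      simpa using Submodule.add_mem _ h3 h4

lemma le_wt (hw : ∀ i, 1 ≤ w i) (a : Fin s → ℕ) (i) : a i ≤ wt w a := by
  calc a i ≤ a i * w i := Nat.le_mul_of_pos_right _ (hw i)
    _ ≤ _ := Finset.single_le_sum (f := fun i => a i * w i) (fun _ _ => Nat.zero_le _)
        (Finset.mem_univ i)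

lemma G_finite (hc : AC K u w) (hw : ∀ i, 1 ≤ w i) (k : ℕ) : FiniteDimensional K (G K u w k) := by
  rw [G_eq hc]
  apply FiniteDimensional.span_of_finite
  refine ((box s k).finite_toSet.image (mon u)).subset ?_
  rintro _ ⟨b, h, rfl⟩
  refine ⟨b, ?_, rfl⟩
  rw [Finset.mem_coe, mem_box]
  exact fun i => (le_wt hw b i).trans h.le

open Classical in
lemma image_finrank (hc : AC K u w) (hw : ∀ i, 1 ≤ w i) {N' N : Submodule A A} (hN : N' ≤ N)
    {k : ℕ} {X : Submodule K A} (hXN : X ≤ N.restrictScalars K) (hXG : X ≤ G K u w k) :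
    Module.finrank K (X.map (N'.mkQ.restrictScalars K)) ≤
      ((box s k).filter (fun a => a ∈ E K u w N \ E K u w N')).card := by
  have hex : ∀ a, ∃ n, a ∈ E K u w N → n ∈ N ∧ n - mon u a ∈ Alt K u w a := by
    intro a
    by_cases h : a ∈ E K u w N
    · obtain ⟨n, hn⟩ := h; exact ⟨n, fun _ => hn⟩
    · exact ⟨0, fun h' => absurd h' h⟩
  choose nn hnn using hex
  set S := (box s k).filter (fun a => a ∈ E K u w N \ E K u w N') with hS
  have hle : X.map (N'.mkQ.restrictScalars K) ≤
      Submodule.span K ((S.image (fun a => N'.mkQ (nn a)) : Finset (A ⧸ N')) : Set (A ⧸ N')) := by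
    rw [Submodule.map_le_iff_le_comap]
    intro v hv
    -- v is in N, and in G k
    have hvG := hXG hv
    rw [G_eq hc] at hvG
    -- use a big bound
    have : v ∈ N'.restrictScalars K ⊔ Submodule.span K
        {x | ∃ b, wt w b < k ∧ b ∈ E K u w N \ E K u w N' ∧ x = nn b} := by
      -- the set of b with weight < k is closed downwards; split
      by_cases hv0 : v = 0
      · subst hv0; exact Submodule.zero_mem _
      · have hfin : ({b | wt w b < k} : Set (Fin s → ℕ)).Finite := by
          refine (box s k).finite_toSet.subset ?_
          intro b hb
          rw [Finset.mem_coe, mem_box]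
          exact fun i => (le_wt hw b i).trans (le_of_lt hb)
        have hne : ({b | wt w b < k} : Set (Fin s → ℕ)).Nonempty := by
          by_contra hemp
          rw [Set.not_nonempty_iff_eq_empty] at hemp
          have : {x : A | ∃ b, wt w b < k ∧ x = mon u b} = ∅ := by
            ext x
            simp only [Set.mem_ofPred_eq, Set.mem_empty_iff_false, iff_false]
            rintro ⟨b, hb, _⟩
            have : b ∈ ({b | wt w b < k} : Set (Fin s → ℕ)) := hb
            rw [hemp] at this
            exact this
          rw [this] at hvG
          simp at hvG
          exact hv0 hvG
        obtain ⟨b, hb, hmax⟩ := hfin.exists_maximalFor (key w) _ hne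
        -- v ∈ span of mon b' for key b' ≤ key b
        have hmax' : ∀ b', wt w b' < k → key w b' ≤ key w b := by
          intro b' hb'
          rcases le_total (key w b') (key w b) with h | h
          · exact h
          · exact hmax hb' h
        have hvs : ∃ c : K, v - c • mon u b ∈ Alt K u w b := by
          have hle : Submodule.span K {x | ∃ b, wt w b < k ∧ x = mon u b} ≤
              Submodule.span K {mon u b} ⊔ Alt K u w b := by
            rw [Submodule.span_le]
            rintro _ ⟨b', hb', rfl⟩
            rcases (hmax' b' hb').lt_or_eq with h | h
            · exact Submodule.mem_sup_right (Submodule.subset_span ⟨b', h, rfl⟩)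
            · rw [key_inj h]
              exact Submodule.mem_sup_left (Submodule.mem_span_singleton_self _)
          obtain ⟨y, hy, z, hz, rfl⟩ := Submodule.mem_sup.1 (hle hvG)
          obtain ⟨c, rfl⟩ := Submodule.mem_span_singleton.1 hy
          exact ⟨c, by simpa using hz⟩
        obtain ⟨c, hcv⟩ := hvs
        have hKN : ∀ (P : Submodule A A) (c : K) x, x ∈ P → c • x ∈ P := by
          intro P c x hx
          rw [← algebraMap_smul A c x]; exact P.smul_mem _ hx
        have hmono : ∀ v, v ∈ N → v ∈ Alt K u w b → v ∈ N'.restrictScalars K ⊔ Submodule.span K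
          {x | ∃ b, wt w b < k ∧ b ∈ E K u w N \ E K u w N' ∧ x = nn b} := by
          intro v h1 h2
          have hle2 : N'.restrictScalars K ⊔ Submodule.span K
              {x | ∃ d, key w d < key w b ∧ d ∈ E K u w N \ E K u w N' ∧ x = nn d} ≤
              N'.restrictScalars K ⊔ Submodule.span K
              {x | ∃ b, wt w b < k ∧ b ∈ E K u w N \ E K u w N' ∧ x = nn b} := by
            refine sup_le_sup_left (Submodule.span_mono ?_) _
            rintro _ ⟨d, h1, h2, h3⟩
            refine ⟨d, ?_, h2, h3⟩
            refine lt_of_le_of_lt ?_ hb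
            by_contra hh
            push Not at hh
            exact absurd h1 (key_lt_of_wt hh).not_gt
          exact hle2 (reduction N' N hN nn hnn b v h1 h2)
        by_cases hc0 : c = 0
        · subst hc0
          exact hmono v (hXN hv) (by simpa using hcv)
        have hbE : b ∈ E K u w N := by
          refine ⟨c⁻¹ • v, hKN _ _ _ (hXN hv), ?_⟩
          have := Submodule.smul_mem _ c⁻¹ hcv
          rwa [smul_sub, smul_smul, inv_mul_cancel₀ hc0, one_smul] at this
        by_cases hbE' : b ∈ E K u w N'
        · obtain ⟨y, hy, hyb⟩ := hbE'
          have h1 := hmono (v - c • y) (N.sub_mem (hXN hv) (hKN _ _ _ (hN hy))) (by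
            have := Submodule.sub_mem _ hcv (Submodule.smul_mem _ c hyb)
            rw [smul_sub] at this
            simpa using this)
          have h2 : c • y ∈ N'.restrictScalars K ⊔ Submodule.span K
            {x | ∃ b, wt w b < k ∧ b ∈ E K u w N \ E K u w N' ∧ x = nn b} :=
            Submodule.mem_sup_left (hKN _ _ _ hy)
          simpa using Submodule.add_mem _ h1 h2
        · obtain ⟨hy, hyb⟩ := hnn b hbE
          have h1 := hmono (v - c • nn b) (N.sub_mem (hXN hv) (hKN _ _ _ hy)) (by
            have := Submodule.sub_mem _ hcv (Submodule.smul_mem _ c hyb)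
            rw [smul_sub] at this
            simpa using this)
          have h2 : c • nn b ∈ N'.restrictScalars K ⊔ Submodule.span K
            {x | ∃ b, wt w b < k ∧ b ∈ E K u w N \ E K u w N' ∧ x = nn b} :=
            Submodule.mem_sup_right (Submodule.smul_mem _ _
              (Submodule.subset_span ⟨b, hb, ⟨hbE, hbE'⟩, rfl⟩))
          simpa using Submodule.add_mem _ h1 h2
    obtain ⟨y, hy, z, hz, rfl⟩ := Submodule.mem_sup.1 this
    have hy0 : (N'.mkQ.restrictScalars K) y = 0 := by simpa using hy
    rw [Submodule.mem_comap, map_add, hy0, zero_add]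
    have hz2 : Submodule.span K {x | ∃ b, wt w b < k ∧ b ∈ E K u w N \ E K u w N' ∧ x = nn b} ≤
        (Submodule.span K ((S.image (fun a => N'.mkQ (nn a)) : Finset (A ⧸ N')) :
          Set (A ⧸ N'))).comap (N'.mkQ.restrictScalars K) := by
      rw [Submodule.span_le]
      rintro _ ⟨b, hb, hbE, rfl⟩
      refine Submodule.subset_span ?_
      rw [Finset.coe_image]
      refine ⟨b, ?_, rfl⟩
      rw [hS, Finset.coe_filter]
      refine ⟨?_, hbE⟩
      rw [mem_box]
      exact fun i => (le_wt hw b i).trans hb.le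
    exact hz2 hz
  refine (Submodule.finrank_mono hle).trans ?_
  exact (finrank_span_finset_le_card _).trans Finset.card_image_le

lemma card_le_finrank (hc : AC K u w) (hw : ∀ i, 1 ≤ w i) (S : Finset (Fin s → ℕ)) {k : ℕ}
    (hS : ∀ a ∈ S, a ∉ E K u w ⊥ ∧ wt w a < k) : S.card ≤ Module.finrank K (G K u w k) := by
  have hli : LinearIndependent K (fun a : S => mon u a.1) := by
    rw [Fintype.linearIndependent_iff]
    intro c hsum
    by_contra hcon
    push Not at hcon
    let T : Set S := {i | c i ≠ 0}
    obtain ⟨i, hi, hmax⟩ := (Set.toFinite T).exists_maximalFor (fun i => key w i.1) _ hcon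
    refine (hS i.1 i.2).1 ⟨0, Submodule.zero_mem _, ?_⟩
    have h1 : mon u i.1 = - (c i)⁻¹ • ∑ j ∈ Finset.univ.erase i, c j • mon u j.1 := by
      rw [← Finset.add_sum_erase _ _ (Finset.mem_univ i)] at hsum
      have : ∑ j ∈ Finset.univ.erase i, c j • mon u j.1 = - (c i • mon u i.1) :=
        eq_neg_of_add_eq_zero_right hsum
      rw [this, neg_smul, smul_neg, neg_neg, smul_smul, inv_mul_cancel₀ hi, one_smul]
    rw [zero_sub, h1]
    refine Submodule.neg_mem _ (Submodule.smul_mem _ _ (Submodule.sum_mem _ ?_))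
    intro j hj
    by_cases hcj : c j = 0
    · rw [hcj, zero_smul]; exact Submodule.zero_mem _
    · refine Submodule.smul_mem _ _ (Submodule.subset_span ⟨j.1, ?_, rfl⟩)
      rcases lt_trichotomy (key w j.1) (key w i.1) with h | h | h
      · exact h
      · exact absurd (Subtype.ext (key_inj h)) (Finset.ne_of_mem_erase hj)
      · exact absurd (hmax hcj h.le) h.not_ge
  have := G_finite hc hw k
  have hli2 : LinearIndependent K (fun a : S =>
      (⟨mon u a.1, mon_mem_G a.1 (hS a.1 a.2).2⟩ : G K u w k)) := by
    apply LinearIndependent.of_comp (G K u w k).subtype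
    exact hli
  have := hli2.fintype_card_le_finrank
  simpa using this

lemma E_top : E K u w (⊤ : Submodule A A) = Set.univ := by
  ext a
  simp only [Set.mem_univ, iff_true]
  exact ⟨mon u a, trivial, by simp⟩

lemma noOrth_top (hc : AC K u w) (hw : ∀ i, 1 ≤ w i) {d C : ℕ}
    (hG : ∀ k, Module.finrank K (G K u w k) ≤ C * (k+1)^d) :
    NoOrth (d+1) (E K u w (⊤ : Submodule A A) \ E K u w ⊥) := by
  classical
  intro p T hT hsub
  have key : ∀ k, (k+1)^(d+1) ≤ C * (wt w p + (∑ i, w i) * k + 2)^d := by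
    intro k
    let S : Finset (Fin s → ℕ) :=
      Fintype.piFinset (fun i => if i ∈ T then Finset.Icc (p i) (p i + k) else {p i})
    have hcard : S.card = (k+1)^(d+1) := by
      have : ∀ i, (if i ∈ T then Finset.Icc (p i) (p i + k) else {p i}).card =
        if i ∈ T then k + 1 else 1 := by
        intro i; split_ifs <;> simp; omega
      simp only [S, Fintype.card_piFinset, this]
      rw [Finset.prod_ite]
      simp [hT]
    have hS : ∀ a ∈ S, (∀ i, p i ≤ a i ∧ a i ≤ p i + k) ∧ ∀ i, i ∉ T → a i = p i := by
      intro a ha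
      have h0 : ∀ i, a i ∈ (if i ∈ T then Finset.Icc (p i) (p i + k) else {p i}) := by
        simpa [S] using ha
      constructor
      · intro i
        have := h0 i
        split_ifs at this
        · simpa using this
        · simp at this; omega
      · intro i hi
        have := h0 i
        simpa [hi] using this
    have h1 := card_le_finrank hc hw S (k := wt w p + (∑ i, w i) * k + 1) (by
      intro a ha
      refine ⟨(hsub ⟨fun i => ((hS a ha).1 i).1, (hS a ha).2⟩).2, ?_⟩
      have : wt w a ≤ wt w p + (∑ i, w i) * k := by
        rw [wt, wt, Finset.sum_mul, ← Finset.sum_add_distrib]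
        refine Finset.sum_le_sum (fun i _ => ?_)
        calc a i * w i ≤ (p i + k) * w i := Nat.mul_le_mul_right _ ((hS a ha).1 i).2
          _ = _ := by ring
      omega)
    rw [hcard] at h1
    exact h1.trans (hG _)
  set M := wt w p + (∑ i, w i) + 2 with hM
  have h2 : ∀ k, (k+1) ≤ C * M^d := by
    intro k
    have h3 : wt w p + (∑ i, w i) * k + 2 ≤ M * (k+1) := by
      rw [hM]; nlinarith [Nat.zero_le (wt w p), Nat.zero_le (∑ i, w i), Nat.zero_le k,
        Nat.zero_le (wt w p * k)]
    have h4 : (k+1)^d * (k+1) ≤ (k+1)^d * (C * M^d) := by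
      calc (k+1)^d * (k+1) = (k+1)^(d+1) := by ring
        _ ≤ _ := key k
        _ ≤ C * (M * (k+1))^d := Nat.mul_le_mul_left _ (Nat.pow_le_pow_left h3 d)
        _ = _ := by rw [mul_pow]; ring
    exact Nat.le_of_mul_le_mul_left h4 (by positivity)
  have := h2 (C * M^d)
  omega

lemma devLE_aux (hc : AC K u w) {n : ℕ}
    (hB : ∀ N' N : Submodule A A, N' ≤ N → NoOrth n (E K u w N \ E K u w N') → N' = N) :
    ∀ (m : ℕ) (α : Type) [Preorder α] (φ : α → Submodule A A), Monotone φ → StrictMono φ →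
      ∀ N' N : Submodule A A, (∀ x, N' ≤ φ x ∧ φ x ≤ N) →
      NoOrth (n+1+m) (E K u w N \ E K u w N') → DevLE m α := by
  have hmono : ∀ (α : Type) [Preorder α] (φ : α → Submodule A A), Monotone φ →
    ∀ (f : ℕ → α), Antitone f → ∀ N' N : Submodule A A, (∀ x, N' ≤ φ x ∧ φ x ≤ N) → ∀ d,
      NoOrth (d+1) (E K u w N \ E K u w N') →
      ∀ᶠ i in atTop, NoOrth d (E K u w (φ (f i)) \ E K u w (φ (f (i+1)))) := by
    intro α _ φ hφ f hf N' N hb d hd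
    have hanti' : Antitone (fun i => E K u w (φ (f i))) :=
      antitone_nat_of_succ_le (fun i => E_mono (hφ (hf (Nat.le_succ i))))
    refine chain_lemma (fun i => E K u w (φ (f i))) (E K u w N') (fun i => E_upper hc _)
      (E_upper hc _) hanti' (fun i => E_mono (hb _).1) ?_
    intro p T hT hsub
    exact hd p T hT (hsub.trans (Set.sdiff_subset_sdiff_left (E_mono (hb _).2)))
  intro m
  induction m with
  | zero =>
    intro α _ φ hφ hs N' N hb h f hf
    filter_upwards [hmono α φ hφ f hf N' N hb n h] with i hi hlt
    exact (hs hlt).ne (hB _ _ (hs hlt).le hi)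
  | succ m ih =>
    intro α _ φ hφ hs N' N hb h f hf
    filter_upwards [hmono α φ hφ f hf N' N hb (n+1+m) h] with i hi
    exact ih (Set.Icc (f (i+1)) (f i)) (fun x => φ x.1) (fun x y h => hφ h)
      (fun x y h => hs h) (φ (f (i+1))) (φ (f i)) (fun x => ⟨hφ x.2.1, hφ x.2.2⟩) hi

end Groebner
end KD

namespace KD

section Abs

/-- An abstract ring of differential operators. -/
structure Ctx (K B A : Type) [Field K] [CommRing B] [Algebra K B] [Ring A] [Algebra K A] where
  ι : B →ₐ[K] A
  ρ : A →ₐ[K] Module.End K B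
  inj : Function.Injective ρ
  hρ : ∀ b c, ρ (ι b) c = b * c
  F : ℕ → Submodule K A
  F_zero : F 0 = ⊥
  F_succ : ∀ k u, u ∈ F (k+1) ↔ ∀ b, u * ι b - ι b * u ∈ F k
  ex : ∀ u, ∃ k, u ∈ F k
  der : Derivation K B B → A
  hder : ∀ δ b, ρ (der δ) b = δ b

structure Chart (K B : Type) [Field K] [CommRing B] [Algebra K B] (n : ℕ) where
  g : B
  hg : g ≠ 0
  x : Fin n → B
  δ : Fin n → Derivation K B B
  hδ : ∀ j k, δ j (x k) = if j = k then g else 0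
  star : ∀ b, g • KaehlerDifferential.D K B b =
    ∑ j, δ j b • KaehlerDifferential.D K B (x j)

variable {K B A : Type} [Field K] [CommRing B] [Algebra K B] [Ring A] [Algebra K A]

lemma Chart.star' {n : ℕ} (c : Chart K B n) {M : Type} [AddCommGroup M] [Module K M] [Module B M]
    [IsScalarTower K B M] (d : Derivation K B M) (b : B) :
    c.g • d b = ∑ j, c.δ j b • d (c.x j) := by
  have := congrArg d.liftKaehlerDifferential (c.star b)
  simpa using this

namespace Ctx
variable (X : Ctx K B A)

lemma F_le_succ (k : ℕ) : X.F k ≤ X.F (k+1) := by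
  induction k with
  | zero => rw [X.F_zero]; exact bot_le
  | succ k ih =>
    intro u hu
    rw [X.F_succ] at hu ⊢
    exact fun b => ih (hu b)

lemma F_mono : Monotone X.F := monotone_nat_of_le_succ X.F_le_succ

lemma ι_comm (b c : B) : X.ι b * X.ι c = X.ι c * X.ι b := by
  rw [← map_mul, mul_comm, map_mul]

lemma ι_mul_mem {k : ℕ} (b : B) {u : A} (hu : u ∈ X.F k) : X.ι b * u ∈ X.F k := by
  induction k generalizing u with
  | zero => rw [X.F_zero] at hu ⊢; rw [Submodule.mem_bot] at hu ⊢; rw [hu, mul_zero]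
  | succ k ih =>
    rw [X.F_succ] at hu ⊢
    intro c
    have := ih (hu c)
    have h2 : X.ι b * u * X.ι c - X.ι c * (X.ι b * u) =
      X.ι b * (u * X.ι c - X.ι c * u) := by
      rw [mul_sub, ← mul_assoc, ← mul_assoc, ← mul_assoc, X.ι_comm c b]
    rwa [h2]

lemma mul_ι_mem {k : ℕ} (b : B) {u : A} (hu : u ∈ X.F k) : u * X.ι b ∈ X.F k := by
  induction k generalizing u with
  | zero => rw [X.F_zero] at hu ⊢; rw [Submodule.mem_bot] at hu ⊢; rw [hu, zero_mul]
  | succ k ih =>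
    rw [X.F_succ] at hu ⊢
    intro c
    have := ih (hu c)
    have h2 : u * X.ι b * X.ι c - X.ι c * (u * X.ι b) =
      (u * X.ι c - X.ι c * u) * X.ι b := by
      rw [sub_mul, mul_assoc, X.ι_comm b c, ← mul_assoc, ← mul_assoc]
    rwa [h2]

lemma ι_mem (b : B) : X.ι b ∈ X.F 1 := by
  rw [X.F_succ]
  intro c
  rw [X.ι_comm, sub_self]; exact Submodule.zero_mem _

lemma eq_ι {u : A} (hu : u ∈ X.F 1) : u = X.ι (X.ρ u 1) := by
  apply X.inj
  ext c
  rw [X.hρ]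
  rw [X.F_succ] at hu
  have h := hu c
  rw [X.F_zero, Submodule.mem_bot] at h
  have h2 := congrArg (fun v => X.ρ v 1) (sub_eq_zero.1 h)
  simp only [map_mul, Module.End.mul_apply, X.hρ, mul_one] at h2
  rw [h2, mul_comm]

lemma ρ_one (b : B) : X.ρ (X.ι b) 1 = b := by rw [X.hρ, mul_one]

lemma ι_inj : Function.Injective X.ι := fun a b h => by
  rw [← X.ρ_one a, h, X.ρ_one]

lemma tors [IsDomain B] {g : B} (hg : g ≠ 0) {k : ℕ} {u : A} (hu : X.ι g * u ∈ X.F k) :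
    u ∈ X.F k := by
  induction k generalizing u with
  | zero =>
    rw [X.F_zero, Submodule.mem_bot] at hu ⊢
    apply X.inj
    ext c
    have h2 := congrArg (fun v => X.ρ v c) hu
    simp only [map_mul, Module.End.mul_apply, X.hρ, map_zero, LinearMap.zero_apply] at h2
    rw [map_zero, LinearMap.zero_apply]
    exact (mul_eq_zero.1 h2).resolve_left hg
  | succ k ih =>
    rw [X.F_succ] at hu ⊢
    intro b
    refine ih ?_
    have h2 := hu b
    have h3 : X.ι g * u * X.ι b - X.ι b * (X.ι g * u) =
      X.ι g * (u * X.ι b - X.ι b * u) := by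
      rw [mul_sub, ← mul_assoc, ← mul_assoc, ← mul_assoc, X.ι_comm g b]
    rwa [h3] at h2

lemma der_br (δ : Derivation K B B) (b : B) :
    X.der δ * X.ι b - X.ι b * X.der δ = X.ι (δ b) := by
  apply X.inj
  ext c
  simp only [map_sub, map_mul, LinearMap.sub_apply, Module.End.mul_apply, X.hρ, X.hder,
    Derivation.leibniz, smul_eq_mul]
  ring

lemma der_one (δ : Derivation K B B) : X.ρ (X.der δ) 1 = 0 := by
  rw [X.hder]; simp

lemma der_lie (δ δ' : Derivation K B B) :
    X.der δ * X.der δ' - X.der δ' * X.der δ = X.der ⁅δ, δ'⁆ := by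
  apply X.inj
  ext c
  simp only [map_sub, map_mul, LinearMap.sub_apply, Module.End.mul_apply, X.hder]
  rw [Derivation.commutator_apply]

section modstuff

lemma star_F {n : ℕ} (c : Chart K B n) {k : ℕ} {u : A} (hu : u ∈ X.F (k+2)) (b : B) :
    X.ι c.g * (u * X.ι b - X.ι b * u) -
      ∑ j, X.ι (c.δ j b) * (u * X.ι (c.x j) - X.ι (c.x j) * u) ∈ X.F k := by
  let _ : Module B A := Module.compHom A X.ι.toRingHom
  have hsm : ∀ (b : B) (a : A), b • a = X.ι b * a := fun _ _ => rfl
  have : IsScalarTower K B A := ⟨fun r b a => by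
    rw [hsm, hsm, map_smul, smul_mul_assoc]⟩
  let P : Submodule B A :=
    { carrier := X.F k
      add_mem' := fun h1 h2 => (X.F k).add_mem h1 h2
      zero_mem' := (X.F k).zero_mem
      smul_mem' := fun b a h => X.ι_mul_mem b h }
  let d0 : B →ₗ[K] A :=
    { toFun := fun b => u * X.ι b - X.ι b * u
      map_add' := fun a b => by rw [map_add, mul_add, add_mul]; abel
      map_smul' := fun r b => by
        rw [map_smul, mul_smul_comm, smul_mul_assoc, ← smul_sub]; rfl }
  let d : Derivation K B (A ⧸ P) := Derivation.mk' ((P.mkQ.restrictScalars K).comp d0) (by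
    intro a b
    change P.mkQ (d0 (a*b)) = a • P.mkQ (d0 b) + b • P.mkQ (d0 a)
    rw [← P.mkQ.map_smul, ← P.mkQ.map_smul, ← map_add, ← sub_eq_zero, ← map_sub, Submodule.mkQ_apply,
      Submodule.Quotient.mk_eq_zero]
    change u * X.ι (a*b) - X.ι (a*b) * u - (X.ι a * (u * X.ι b - X.ι b * u) +
      X.ι b * (u * X.ι a - X.ι a * u)) ∈ X.F k
    rw [X.F_succ] at hu
    have h1 := hu a
    rw [X.F_succ] at h1
    have h2 := h1 b
    convert h2 using 1
    rw [map_mul]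
    have := X.ι_comm a b
    simp only [mul_sub, sub_mul, mul_assoc]
    simp only [← mul_assoc, this]
    abel)
  have h := c.star' d b
  have h2 : ∀ b, d b = P.mkQ (u * X.ι b - X.ι b * u) := fun _ => rfl
  simp only [h2, ← map_smul, ← map_sum] at h
  rw [← sub_eq_zero, ← map_sub, Submodule.mkQ_apply, Submodule.Quotient.mk_eq_zero] at h
  exact h

end modstuff

/-- the Euler-type lemma -/
lemma euler {n : ℕ} (c : Chart K B n) (k : ℕ) {u : A} (hu : u ∈ X.F (k+1)) :
    (k : K) • (X.ι c.g * u) -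
      ∑ j, X.der (c.δ j) * (u * X.ι (c.x j) - X.ι (c.x j) * u) ∈ X.F k := by
  induction k generalizing u with
  | zero =>
    rw [X.F_succ, X.F_zero] at hu
    simp only [Submodule.mem_bot] at hu
    simp only [hu, mul_zero, Finset.sum_const_zero, sub_zero, Nat.cast_zero, zero_smul]
    exact Submodule.zero_mem _
  | succ k ih =>
    rw [X.F_succ]
    intro b
    have h1 := ih ((X.F_succ _ _).1 hu b)
    have h2 := X.star_F c hu b
    have h3 := Submodule.add_mem _ h1 h2
    convert h3 using 1
    have e1 : ∀ j, X.der (c.δ j) * (u * X.ι (c.x j) - X.ι (c.x j) * u) * X.ι b -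
        X.ι b * (X.der (c.δ j) * (u * X.ι (c.x j) - X.ι (c.x j) * u)) =
        X.der (c.δ j) * ((u * X.ι b - X.ι b * u) * X.ι (c.x j) -
          X.ι (c.x j) * (u * X.ι b - X.ι b * u)) +
        X.ι (c.δ j b) * (u * X.ι (c.x j) - X.ι (c.x j) * u) := by
      intro j
      rw [← X.der_br]
      have := X.ι_comm b (c.x j)
      simp only [mul_sub, sub_mul, mul_assoc, this]
      simp only [← mul_assoc]
      rw [mul_assoc _ (X.ι b) (X.ι (c.x j)), this, ← mul_assoc]
      abel
    have e2 : X.ι c.g * u * X.ι b - X.ι b * (X.ι c.g * u) =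
        X.ι c.g * (u * X.ι b - X.ι b * u) := by
      rw [mul_sub, ← mul_assoc, ← mul_assoc, ← mul_assoc, X.ι_comm b]
    rw [sub_mul, mul_sub, Finset.sum_mul, Finset.mul_sum, smul_mul_assoc, mul_smul_comm,
      sub_sub_sub_comm, ← smul_sub, e2, ← Finset.sum_sub_distrib, Finset.sum_congr rfl
      (fun j _ => e1 j), Finset.sum_add_distrib, Nat.cast_succ, add_smul, one_smul]
    abel

lemma commutant [CharZero K] [IsDomain B] {n : ℕ} (c : Chart K B n) {u : A}
    (hu : ∀ j, u * X.ι (c.x j) = X.ι (c.x j) * u) : u ∈ X.F 1 := by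
  obtain ⟨k, hk⟩ := X.ex u
  have : ∀ k, u ∈ X.F (k+1) → u ∈ X.F 1 := by
    intro k
    induction k with
    | zero => exact id
    | succ k ih =>
      intro h
      have h1 := X.euler c (k+1) h
      simp only [hu, sub_self, mul_zero, Finset.sum_const_zero, sub_zero] at h1
      have hk : ((k+1 : ℕ) : K) ≠ 0 := by exact_mod_cast Nat.succ_ne_zero k
      exact ih (X.tors c.hg ((Submodule.smul_mem_iff _ hk).1 h1))
  exact this k (X.F_le_succ _ hk)

lemma cover {r : ℕ} {n : ℕ} {c : Fin r → Chart K B n}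
    (hc : Ideal.span (Set.range fun l => (c l).g) = ⊤) :
    ∃ a : Fin r → B, ∑ l, a l * (c l).g = 1 := by
  have h1 : (1 : B) ∈ Ideal.span (Set.range fun l => (c l).g) := by rw [hc]; trivial
  exact (Ideal.mem_span_range_iff_exists_fun).1 h1

lemma of_cover {r : ℕ} {n : ℕ} {c : Fin r → Chart K B n}
    (hc : Ideal.span (Set.range fun l => (c l).g) = ⊤) (P : Submodule K A)
    (hP : ∀ b u, u ∈ P → X.ι b * u ∈ P) {u : A} (hu : ∀ l, X.ι (c l).g * u ∈ P) : u ∈ P := by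
  have h1 : (1 : B) ∈ Ideal.span (Set.range fun l => (c l).g) := by rw [hc]; trivial
  obtain ⟨a, ha⟩ := (Ideal.mem_span_range_iff_exists_fun).1 h1
  have : u = ∑ l, X.ι (a l) * (X.ι (c l).g * u) := by
    simp only [← mul_assoc, ← map_mul]
    rw [← Finset.sum_mul, ← map_sum, ha, map_one, one_mul]
  rw [this]
  exact Submodule.sum_mem _ (fun l _ => hP _ _ (hu l))

lemma gen [CharZero K] {r : ℕ} {n : ℕ} {c : Fin r → Chart K B n}
    (hc : Ideal.span (Set.range fun l => (c l).g) = ⊤) (Δ : Subalgebra K A)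
    (h1 : ∀ b, X.ι b ∈ Δ) (h2 : ∀ l j, X.der ((c l).δ j) ∈ Δ) : Δ = ⊤ := by
  have key : ∀ k, ∀ u ∈ X.F (k+1), u ∈ Δ := by
    intro k
    induction k with
    | zero => intro u hu; rw [X.eq_ι hu]; exact h1 _
    | succ k ih =>
      intro u hu
      refine X.of_cover hc (Subalgebra.toSubmodule Δ) (fun b u h => Δ.mul_mem (h1 b) h)
        (fun l => ?_)
      have h3 := ih _ (X.euler (c l) (k+1) hu)
      have h4 : ∑ j, X.der ((c l).δ j) * (u * X.ι ((c l).x j) - X.ι ((c l).x j) * u) ∈ Δ :=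
        Subalgebra.sum_mem _ (fun j _ => Δ.mul_mem (h2 l j) (ih _ ((X.F_succ _ _).1 hu _)))
      have h5 := Δ.add_mem h3 h4
      rw [sub_add_cancel] at h5
      have hk : ((k+1 : ℕ) : K) ≠ 0 := by exact_mod_cast Nat.succ_ne_zero k
      exact (Submodule.smul_mem_iff (Subalgebra.toSubmodule Δ) hk).1 h5
  rw [eq_top_iff]
  intro u _
  obtain ⟨k, hk⟩ := X.ex u
  exact key k u (X.F_le_succ _ hk)

/-- every derivation is a combination of the chart derivations -/
lemma der_eq {r : ℕ} {n : ℕ} {c : Fin r → Chart K B n}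
    (hc : Ideal.span (Set.range fun l => (c l).g) = ⊤) (d : Derivation K B B) :
    ∃ e : Fin r → Fin n → B, X.der d = ∑ l, ∑ j, X.ι (e l j) * X.der ((c l).δ j) := by
  obtain ⟨a, ha⟩ := cover hc
  refine ⟨fun l j => a l * d ((c l).x j), ?_⟩
  apply X.inj
  ext b
  simp only [map_sum, LinearMap.sum_apply, map_mul, Module.End.mul_apply, X.hρ, X.hder]
  have h : ∀ l, (c l).g * d b = ∑ j, (c l).δ j b * d ((c l).x j) := fun l => by
    simpa using (c l).star' d b
  calc d b = (∑ l, a l * (c l).g) * d b := by rw [ha, one_mul]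
    _ = ∑ l, a l * ((c l).g * d b) := by rw [Finset.sum_mul]; simp only [mul_assoc]
    _ = _ := by
      refine Finset.sum_congr rfl (fun l _ => ?_)
      rw [h, Finset.mul_sum]
      refine Finset.sum_congr rfl (fun j _ => ?_)
      ring

def FI (I : Ideal B) (k : ℕ) : Submodule K A :=
  Submodule.span K {v | ∃ u ∈ X.F k, ∃ a ∈ I, v = u * X.ι a}

def DI (I : Ideal B) : Submodule A A := Submodule.span A (X.ι '' I)

lemma FI_mono (I : Ideal B) {k l} (h : k ≤ l) : X.FI I k ≤ X.FI I l :=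
  Submodule.span_mono (fun _ ⟨u, h1, h2⟩ => ⟨u, X.F_mono h h1, h2⟩)

lemma FI_ι (I : Ideal B) (k) (b : B) (u : A) (hu : u ∈ X.FI I k) : X.ι b * u ∈ X.FI I k := by
  have : X.FI I k ≤ (X.FI I k).comap (LinearMap.mulLeft K (X.ι b)) := by
    rw [FI, Submodule.span_le]
    rintro _ ⟨u, h1, a, ha, rfl⟩
    refine Submodule.subset_span ⟨X.ι b * u, X.ι_mul_mem b h1, a, ha, ?_⟩
    simp [mul_assoc]
  exact this hu

lemma FI_euler {n : ℕ} (c : Chart K B n) (I : Ideal B) (k : ℕ) {v : A} (hv : v ∈ X.FI I (k+1)) :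
    (k : K) • (X.ι c.g * v) -
      ∑ j, X.der (c.δ j) * (v * X.ι (c.x j) - X.ι (c.x j) * v) ∈ X.FI I k := by
  rw [FI] at hv
  induction hv using Submodule.span_induction with
  | mem v hv =>
    obtain ⟨u, hu, a, ha, rfl⟩ := hv
    refine Submodule.subset_span ⟨_, X.euler c k hu, a, ha, ?_⟩
    rw [sub_mul, Finset.sum_mul, smul_mul_assoc, mul_assoc]
    congr 1
    refine Finset.sum_congr rfl (fun j _ => ?_)
    simp only [mul_sub, sub_mul, mul_assoc, X.ι_comm a (c.x j)]
  | zero => simp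
  | add v v' _ _ h1 h2 =>
    convert Submodule.add_mem _ h1 h2 using 1
    simp only [mul_add, add_mul, smul_add, mul_sub, Finset.sum_add_distrib,
      Finset.sum_sub_distrib]
    abel
  | smul r v _ h1 =>
    convert Submodule.smul_mem _ r h1 using 1
    simp only [mul_smul_comm, smul_mul_assoc, ← smul_sub, ← Finset.smul_sum]
    rw [smul_comm, ← smul_sub]

lemma DI_inter [CharZero K] {r : ℕ} {n : ℕ} {c : Fin r → Chart K B n}
    (hc : Ideal.span (Set.range fun l => (c l).g) = ⊤) (I : Ideal B) (b : B)
    (hb : X.ι b ∈ X.DI I) : b ∈ I := by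
  have h1 : ∀ v ∈ X.DI I, ∃ k, v ∈ X.FI I (k+1) := by
    intro v hv
    rw [DI, Submodule.mem_span_set'] at hv
    obtain ⟨N, f, y, rfl⟩ := hv
    have h0 : ∀ i, ∃ k, f i • (y i : A) ∈ X.FI I (k+1) := by
      intro i
      obtain ⟨a, ha, h⟩ := (y i).2
      obtain ⟨k, hk⟩ := X.ex (f i)
      exact ⟨k, Submodule.subset_span ⟨f i, X.F_le_succ _ hk, a, ha, by rw [h]; rfl⟩⟩
    choose kk hkk using h0
    exact ⟨∑ i, kk i, Submodule.sum_mem _ (fun i _ => X.FI_mono I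
      (Nat.succ_le_succ (Finset.single_le_sum (fun _ _ => Nat.zero_le _) (Finset.mem_univ i)))
      (hkk i))⟩
  obtain ⟨k, hk⟩ := h1 _ hb
  have h2 : ∀ k, X.ι b ∈ X.FI I (k+1) → X.ι b ∈ X.FI I 1 := by
    intro k
    induction k with
    | zero => exact id
    | succ k ih =>
      intro h
      refine ih (X.of_cover hc _ (X.FI_ι I (k+1)) (fun l => ?_))
      have h3 := X.FI_euler (c l) I (k+1) h
      simp only [X.ι_comm b, sub_self, mul_zero, Finset.sum_const_zero, sub_zero] at h3
      have hk : ((k+1 : ℕ) : K) ≠ 0 := by exact_mod_cast Nat.succ_ne_zero k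
      exact (Submodule.smul_mem_iff _ hk).1 h3
  have h3 : X.FI I 1 ≤ (I.restrictScalars K).map X.ι.toLinearMap := by
    rw [FI, Submodule.span_le]
    rintro _ ⟨u, hu, a, ha, rfl⟩
    refine ⟨X.ρ u 1 * a, I.mul_mem_left _ ha, ?_⟩
    rw [X.eq_ι hu]
    simp [X.ρ_one]
  obtain ⟨b', hb', h⟩ := h3 (h2 k hk)
  rwa [← X.ι_inj h]

lemma DI_strictMono [CharZero K] {r : ℕ} {n : ℕ} {c : Fin r → Chart K B n}
    (hc : Ideal.span (Set.range fun l => (c l).g) = ⊤) : StrictMono X.DI := by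
  have hm : Monotone X.DI := fun I J h => Submodule.span_mono (Set.image_mono h)
  intro I J h
  refine lt_of_le_of_ne (hm h.le) (fun he => h.not_ge (fun b hb => ?_))
  refine X.DI_inter hc I b ?_
  rw [he]
  exact Submodule.subset_span ⟨b, hb, rfl⟩

lemma DI_mono : Monotone X.DI := fun I J h => Submodule.span_mono (Set.image_mono h)

end Ctx
end Abs
end KD

namespace KD

section Concrete
variable (K B : Type) [Field K] [CommRing B] [Algebra K B]

lemma D_succ (k : ℕ) (u : Module.End K B) : u ∈ diffOpsLE K B (k+1) ↔
    ∀ b, u * Algebra.lmul K B b - Algebra.lmul K B b * u ∈ diffOpsLE K B k := by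
  rw [diffOpsLE, Submodule.mem_iInf]
  rfl

lemma D_zero (u : Module.End K B) : u ∈ diffOpsLE K B 0 ↔
    ∀ b, u * Algebra.lmul K B b - Algebra.lmul K B b * u = 0 := by
  rw [diffOpsLE]
  constructor
  · rintro ⟨a, rfl⟩ b
    ext c
    simp [mul_left_comm]
  · intro h
    refine ⟨u 1, ?_⟩
    ext c
    have := congrArg (fun v => v 1) (h c)
    simp only [LinearMap.sub_apply, Module.End.mul_apply, Algebra.coe_lmul_eq_mul,
      LinearMap.mul_apply', mul_one, LinearMap.zero_apply, sub_eq_zero] at this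
    rw [this]
    simp [mul_comm]

lemma D_le_succ (k : ℕ) : diffOpsLE K B k ≤ diffOpsLE K B (k+1) := by
  induction k with
  | zero =>
    intro u hu
    rw [D_zero] at hu
    rw [D_succ]
    intro b; rw [hu b]; exact Submodule.zero_mem _
  | succ k ih =>
    intro u hu
    rw [D_succ] at hu ⊢
    exact fun b => ih (hu b)

lemma D_mono : Monotone (diffOpsLE K B) := monotone_nat_of_le_succ (D_le_succ K B)

lemma D_mul (n : ℕ) : ∀ i j, i + j = n → ∀ u ∈ diffOpsLE K B i, ∀ v ∈ diffOpsLE K B j,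
    u * v ∈ diffOpsLE K B n := by
  induction n with
  | zero =>
    intro i j h u hu v hv
    obtain rfl : i = 0 := by omega
    obtain rfl : j = 0 := by omega
    rw [D_zero] at hu hv ⊢
    intro b
    have h1 := sub_eq_zero.1 (hu b)
    have h2 := sub_eq_zero.1 (hv b)
    rw [mul_assoc, h2, ← mul_assoc, h1, mul_assoc, sub_self]
  | succ n ih =>
    intro i j h u hu v hv
    rw [D_succ]
    intro b
    have e : u * v * Algebra.lmul K B b - Algebra.lmul K B b * (u * v) =
      u * (v * Algebra.lmul K B b - Algebra.lmul K B b * v) +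
      (u * Algebra.lmul K B b - Algebra.lmul K B b * u) * v := by
      simp only [mul_sub, sub_mul, mul_assoc]; abel
    rw [e]
    refine Submodule.add_mem _ ?_ ?_
    · cases j with
      | zero => rw [D_zero] at hv; rw [hv b, mul_zero]; exact Submodule.zero_mem _
      | succ j => rw [D_succ] at hv; exact ih i j (by omega) u hu _ (hv b)
    · cases i with
      | zero => rw [D_zero] at hu; rw [hu b, zero_mul]; exact Submodule.zero_mem _
      | succ i => rw [D_succ] at hu; exact ih i j (by omega) _ (hu b) v hv

lemma D_ex (u : Module.End K B) (hu : u ∈ diffOps K B) : ∃ k, u ∈ diffOpsLE K B k := by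
  rw [diffOps] at hu
  induction hu using Algebra.adjoin_induction with
  | mem x hx => simpa using hx
  | algebraMap r =>
    refine ⟨0, algebraMap K B r, ?_⟩
    ext c
    simp [Algebra.smul_def, Module.algebraMap_end_apply]
  | add x y _ _ hx hy =>
    obtain ⟨k, hk⟩ := hx; obtain ⟨l, hl⟩ := hy
    exact ⟨k + l, Submodule.add_mem _ (D_mono K B (by omega) hk) (D_mono K B (by omega) hl)⟩
  | mul x y _ _ hx hy =>
    obtain ⟨k, hk⟩ := hx; obtain ⟨l, hl⟩ := hy
    exact ⟨k + l, D_mul K B _ k l rfl x hk y hl⟩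

lemma D_sub {k : ℕ} {u : Module.End K B} (h : u ∈ diffOpsLE K B k) : u ∈ diffOps K B :=
  Algebra.subset_adjoin (Set.mem_iUnion.2 ⟨k, h⟩)

lemma D_lmul (b : B) : Algebra.lmul K B b ∈ diffOpsLE K B 0 := ⟨b, rfl⟩

lemma D_der (δ : Derivation K B B) : (δ : B →ₗ[K] B) ∈ diffOpsLE K B 1 := by
  rw [D_succ]
  intro b
  refine ⟨δ b, ?_⟩
  ext c
  simp [mul_comm]

def ctx : Ctx K B ↥(diffOps K B) where
  ι := (Algebra.lmul K B).codRestrict (diffOps K B) (fun b => D_sub K B (D_lmul K B b))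
  ρ := (diffOps K B).val
  inj := Subtype.val_injective
  hρ b c := rfl
  F k := match k with
    | 0 => ⊥
    | k+1 => (diffOpsLE K B k).comap (diffOps K B).val.toLinearMap
  F_zero := rfl
  F_succ k u := by
    cases k with
    | zero =>
      refine (D_zero K B u.1).trans ?_
      refine forall_congr' (fun b => ?_)
      rw [Submodule.mem_bot, ← Subtype.coe_inj]
      rfl
    | succ k => exact D_succ K B k u.1
  ex u := by
    obtain ⟨k, hk⟩ := D_ex K B u.1 u.2
    exact ⟨k+1, hk⟩
  der δ := ⟨(δ : B →ₗ[K] B), D_sub K B (D_der K B δ)⟩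
  hder δ b := rfl

end Concrete
end KD

namespace KD

section ChartEx
variable {K B : Type} [Field K] [CommRing B] [Algebra K B] [IsDomain B]

lemma exists_chart [Algebra.Smooth K B] (p : Ideal B) [p.IsPrime] :
    ∃ n, ∃ c : Chart K B n, c.g ∉ p := by
  obtain ⟨κ, a, b, hb⟩ := Module.exists_basis_of_span_of_flat _
    (KaehlerDifferential.span_range_map_derivation_of_isLocalization K B
      (Localization.AtPrime p) p.primeCompl)
  have : Finite κ := Module.Finite.finite_basis b
  let n := Nat.card κ
  let e : κ ≃ Fin n := Finite.equivFin κ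
  let b' := b.reindex e
  let x : Fin n → B := fun j => a (e.symm j)
  let l₁ : (Fin n →₀ B) →ₗ[B] (Fin n →₀ Localization.AtPrime p) :=
    Finsupp.mapRange.linearMap (Algebra.linearMap B (Localization.AtPrime p))
  let l₂ : Ω[B⁄K] →ₗ[B] Ω[Localization.AtPrime p⁄K] :=
    KaehlerDifferential.map K K B (Localization.AtPrime p)
  have hb' : ∀ j, l₂ (KaehlerDifferential.D K B (x j)) = b' j := by
    intro j
    simp [l₂, b', x, hb]
  obtain ⟨h, s, hs⟩ := Module.FinitePresentation.exists_lift_of_isLocalizedModule p.primeCompl l₁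
    ((b'.repr.toLinearMap.restrictScalars B).comp l₂)
  have hs' : ∀ ω j, algebraMap B (Localization.AtPrime p) (h ω j) =
      algebraMap B (Localization.AtPrime p) s.1 * b'.repr (l₂ ω) j := by
    intro ω j
    have := congrArg (fun f => f ω j) hs
    simpa [l₁, Submonoid.smul_def, Algebra.smul_def] using this
  have hinj : Function.Injective (algebraMap B (Localization.AtPrime p)) :=
    IsLocalization.injective _ p.primeCompl_le_nonZeroDivisors
  have hl₂ : Function.Injective l₂ := by
    intro y z hyz
    obtain ⟨c, hc⟩ := (IsLocalizedModule.eq_iff_exists p.primeCompl l₂).1 hyz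
    have hc0 : c.1 ≠ 0 := fun h0 => c.2 (by rw [h0]; exact p.zero_mem)
    exact smul_right_injective _ hc0 hc
  refine ⟨n, ⟨s.1, fun h0 => s.2 (by rw [h0]; exact p.zero_mem), x,
    fun j => ((Finsupp.lapply j).comp h).compDer (KaehlerDifferential.D K B), ?_, ?_⟩, s.2⟩
  · intro j k
    apply hinj
    have := hs' (KaehlerDifferential.D K B (x k)) j
    rw [hb', Module.Basis.repr_self] at this
    refine this.trans ?_
    rw [Finsupp.single_apply]
    by_cases hjk : j = k
    · simp [hjk]
    · simp [hjk, Ne.symm hjk]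
  · intro d
    apply hl₂
    rw [map_smul, map_sum]
    have h1 : l₂ (KaehlerDifferential.D K B d) =
      ∑ j, b'.repr (l₂ (KaehlerDifferential.D K B d)) j • b' j := (b'.sum_repr _).symm
    rw [h1, Finset.smul_sum]
    refine Finset.sum_congr rfl (fun j _ => ?_)
    rw [map_smul, hb']
    change _ = (h (KaehlerDifferential.D K B d) j) • b' j
    rw [← algebraMap_smul (Localization.AtPrime p) (h (KaehlerDifferential.D K B d) j), hs',
      mul_smul, algebraMap_smul]

end ChartEx
end KD

namespace KD

section Trdeg
open MvPolynomial
variable {K B : Type} [Field K] [CommRing B] [Algebra K B]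

lemma pd_step [CharZero K] {n : ℕ} (p : MvPolynomial (Fin n) K) (N : ℕ)
    (hN : ∀ m, coeff m p ≠ 0 → m.degree < N + 1) :
    (∃ c, p = C c) ∨ ∃ i, pderiv i p ≠ 0 ∧ ∃ M, N = M + 1 ∧
      ∀ m, coeff m (pderiv i p) ≠ 0 → m.degree < M + 1 := by
  by_cases h : ∀ m, coeff m p ≠ 0 → m = 0
  · left
    refine ⟨coeff 0 p, ?_⟩
    ext m
    rw [coeff_C]
    by_cases hm : 0 = m
    · simp [← hm]
    · rw [if_neg hm]
      by_contra h0
      exact hm (h m h0).symm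
  · right
    push Not at h
    obtain ⟨m, hm, hm0⟩ := h
    obtain ⟨i, hi⟩ : ∃ i, m i ≠ 0 := by
      by_contra hcon
      push Not at hcon
      exact hm0 (Finsupp.ext hcon)
    have hmi : m - Finsupp.single i 1 + Finsupp.single i 1 = m := by
      apply tsub_add_cancel_of_le
      rw [Finsupp.single_le_iff]; omega
    refine ⟨i, ?_, ?_⟩
    · intro h0
      have h1 := coeff_pderiv (i := i) p (m - Finsupp.single i 1)
      rw [h0, coeff_zero, hmi] at h1
      have := Nat.cast_add_one_ne_zero (R := K) ((m - Finsupp.single i 1 : Fin n →₀ ℕ) i)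
      rcases mul_eq_zero.1 h1.symm with h2 | h2
      · first | exact hm h2 | exact this h2
      · first | exact hm h2 | exact this h2
    · have hN1 := hN m hm
      have : m.degree ≠ 0 := by
        rw [Ne, Finsupp.degree_eq_zero_iff]; exact hm0
      refine ⟨N - 1, by omega, ?_⟩
      intro m' hm'
      rw [coeff_pderiv] at hm'
      have h3 : coeff (m' + Finsupp.single i 1) p ≠ 0 := by
        intro h0; rw [h0] at hm'; simp at hm'
      have h4 := hN _ h3
      rw [map_add, Finsupp.degree_single] at h4
      omega

lemma der_aeval {n : ℕ} (x : Fin n → B) (δ : Derivation K B B) (p : MvPolynomial (Fin n) K) :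
    δ (aeval x p) = ∑ k, aeval x (pderiv k p) * δ (x k) := by
  induction p using MvPolynomial.induction_on with
  | C a => simp
  | add p q hp hq => simp [hp, hq, add_mul, Finset.sum_add_distrib]
  | mul_X p i hp =>
    simp only [map_mul, aeval_X, Derivation.leibniz, smul_eq_mul, hp, pderiv_X, map_add]
    simp only [add_mul, Finset.sum_add_distrib]
    rw [add_comm, Finset.mul_sum, add_comm]
    congr 1
    · rw [Finset.sum_eq_single i]
      · simp
      · intro k _ hk; simp [Ne.symm hk]
      · simp
    · refine Finset.sum_congr rfl (fun k _ => ?_)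
      ring

lemma Chart.der_aeval {n : ℕ} (c : Chart K B n) (j : Fin n) (p : MvPolynomial (Fin n) K) :
    c.δ j (aeval c.x p) = aeval c.x (pderiv j p) * c.g := by
  rw [KD.der_aeval, Finset.sum_eq_single j]
  · rw [c.hδ, if_pos rfl]
  · intro k _ hk; rw [c.hδ, if_neg (Ne.symm hk), mul_zero]
  · simp

lemma Chart.algInd [CharZero K] [IsDomain B] {n : ℕ} (c : Chart K B n) :
    AlgebraicIndependent K c.x := by
  rw [algebraicIndependent_iff]
  have key : ∀ N, ∀ p : MvPolynomial (Fin n) K, (∀ m, coeff m p ≠ 0 → m.degree < N + 1) →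
      aeval c.x p = 0 → p = 0 := by
    intro N
    induction N with
    | zero =>
      intro p hp h0
      rcases pd_step p 0 hp with ⟨a, rfl⟩ | ⟨i, _, M, hM, _⟩
      · rw [aeval_C] at h0
        rw [(FaithfulSMul.algebraMap_injective K B) (h0.trans (map_zero _).symm), C_0]
      · omega
    | succ N ih =>
      intro p hp h0
      rcases pd_step p _ hp with ⟨a, rfl⟩ | ⟨i, hi, M, hM, hM2⟩
      · rw [aeval_C] at h0
        rw [(FaithfulSMul.algebraMap_injective K B) (h0.trans (map_zero _).symm), C_0]
      · obtain rfl : N = M := by omega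
        have h1 := c.der_aeval i p
        rw [h0, map_zero] at h1
        exact absurd (ih _ hM2 ((mul_eq_zero.1 h1.symm).resolve_right c.hg)) hi
  intro p
  refine key p.totalDegree p (fun m hm => ?_)
  have := le_totalDegree (mem_support_iff.2 hm)
  rw [Finsupp.degree_eq_sum]
  rw [Finsupp.sum_fintype _ _ (by simp)] at this
  omega

open scoped IntermediateField.algebraAdjoinAdjoin in
lemma Chart.trBasis [CharZero K] [IsDomain B] [Algebra.FiniteType K B] {n : ℕ} (c : Chart K B n) :
    IsTranscendenceBasis K (algebraMap B (FractionRing B) ∘ c.x) := by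
  set F := FractionRing B
  have hind : AlgebraicIndependent K (algebraMap B F ∘ c.x) :=
    c.algInd.map' (f := IsScalarTower.toAlgHom K B F) (FaithfulSMul.algebraMap_injective B F)
  rw [hind.isTranscendenceBasis_iff_isAlgebraic]
  set S := Set.range (algebraMap B F ∘ c.x)
  let L := IntermediateField.adjoin K S
  have hD : ∀ b : B, KaehlerDifferential.D L F (algebraMap B F b) = 0 := by
    intro b
    let d : Derivation K B (Ω[F⁄L]) :=
      ((KaehlerDifferential.D L F).restrictScalars K).compAlgebraMap B
    have h1 := c.star' d b
    have h2 : ∀ b, d b = KaehlerDifferential.D L F (algebraMap B F b) := fun _ => rfl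
    have h3 : ∀ j, d (c.x j) = 0 := by
      intro j
      rw [h2]
      have hm : algebraMap B F (c.x j) ∈ L := IntermediateField.subset_adjoin K S ⟨j, rfl⟩
      exact (KaehlerDifferential.D L F).map_algebraMap ⟨_, hm⟩
    simp only [h3, smul_zero, Finset.sum_const_zero] at h1
    rw [← h2]
    rw [← algebraMap_smul F c.g (d b)] at h1
    refine (smul_eq_zero.1 h1).resolve_left (fun h0 => c.hg ?_)
    exact (FaithfulSMul.algebraMap_eq_zero_iff B F).1 h0
  have hD2 : ∀ f : F, KaehlerDifferential.D L F f = 0 := by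
    intro f
    obtain ⟨a, b, hb, rfl⟩ := IsFractionRing.div_surjective (A := B) f
    have hb0 : algebraMap B F b ≠ 0 := by
      rw [Ne, FaithfulSMul.algebraMap_eq_zero_iff]
      exact nonZeroDivisors.ne_zero hb
    have h1 := (KaehlerDifferential.D L F).leibniz (algebraMap B F b)
      (algebraMap B F a / algebraMap B F b)
    rw [mul_div_cancel₀ _ hb0, hD, hD, smul_zero, add_zero] at h1
    exact (smul_eq_zero.1 h1.symm).resolve_left hb0
  have hsub : Subsingleton (Ω[F⁄L]) := by
    have : (⊤ : Submodule F (Ω[F⁄L])) = ⊥ := by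
      rw [← KaehlerDifferential.span_range_derivation, Submodule.span_eq_bot]
      rintro _ ⟨f, rfl⟩
      exact hD2 f
    exact (Submodule.subsingleton_iff F).1 (subsingleton_of_bot_eq_top this.symm)
  have : Algebra.FormallyUnramified L F := ⟨hsub⟩
  have : Algebra.EssFiniteType B F := Algebra.EssFiniteType.of_isLocalization F (nonZeroDivisors B)
  have : Algebra.EssFiniteType K F := Algebra.EssFiniteType.comp K B F
  have : Algebra.EssFiniteType L F := Algebra.EssFiniteType.of_comp K L F
  have hsep := Algebra.FormallyUnramified.isSeparable L F
  have halg : Algebra.IsAlgebraic L F := inferInstance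
  exact (IsFractionRing.comap_isAlgebraic_iff (A := Algebra.adjoin K S) (K := L) (C := F)).2 halg

lemma exists_charts (K B : Type) [Field K] [CommRing B] [Algebra K B] [CharZero K] [IsDomain B]
    [Algebra.Smooth K B] :
    ∃ n, (∃ φ : MvPolynomial (Fin n) K →ₐ[K] B, Function.Injective φ ∧ φ.Finite) ∧
      ∃ r, ∃ c : Fin r → Chart K B n, Ideal.span (Set.range fun l => (c l).g) = ⊤ := by
  have hft : Algebra.FiniteType K B := inferInstance
  obtain ⟨n, φ, hφ, hfin⟩ := exists_finite_inj_algHom_of_fg K B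
  refine ⟨n, ⟨φ, hφ, hfin⟩, ?_⟩
  have hn : ∀ m, Chart K B m → m = n := by
    intro m c
    have h1 := c.trBasis
    let _ : Algebra (MvPolynomial (Fin n) K) B := φ.toRingHom.toAlgebra
    have : IsScalarTower K (MvPolynomial (Fin n) K) B :=
      IsScalarTower.of_algebraMap_eq (fun r => (φ.commutes r).symm)
    have : Module.Finite (MvPolynomial (Fin n) K) B := hfin
    have : FaithfulSMul (MvPolynomial (Fin n) K) B :=
      (faithfulSMul_iff_algebraMap_injective _ _).2 hφ
    have h2 := (IsTranscendenceBasis.mvPolynomial (Fin n) K).algebraMap_comp (A := B)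
    have : Algebra.IsAlgebraic B (FractionRing B) :=
      IsLocalization.isAlgebraic _ (nonZeroDivisors B)
    have h3 := h2.algebraMap_comp (A := FractionRing B)
    have := h1.cardinalMk_eq h3
    simpa using this
  have hp : ∀ p : PrimeSpectrum B, ∃ c : Chart K B n, c.g ∉ p.asIdeal := by
    intro p
    obtain ⟨m, c, hc⟩ := exists_chart (K := K) p.asIdeal
    obtain rfl := hn m c
    exact ⟨c, hc⟩
  choose c hc using hp
  have htop : Ideal.span (Set.range fun p => (c p).g) = ⊤ := by
    by_contra hne
    obtain ⟨M, hM, hle⟩ := Ideal.exists_le_maximal _ hne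
    exact hc ⟨M, hM.isPrime⟩ (hle (Ideal.subset_span ⟨_, rfl⟩))
  have h1 : (1 : B) ∈ Ideal.span (Set.range fun p => (c p).g) := by rw [htop]; trivial
  obtain ⟨t, ht, h1t⟩ := Submodule.mem_span_finite_of_mem_span h1
  have hex : ∀ l : Fin t.card, ∃ p, (c p).g = (t.equivFin.symm l : B) := by
    intro l
    exact ht (t.equivFin.symm l).2
  choose q hq using hex
  refine ⟨t.card, fun l => c (q l), ?_⟩
  rw [Ideal.eq_top_iff_one]
  refine Submodule.span_mono ?_ h1t
  intro y hy
  exact ⟨t.equivFin ⟨y, hy⟩, by simp [hq]⟩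

end Trdeg
end KD

namespace KD

section Dev

lemma DevLE.pull (m : ℕ) : ∀ (α β : Type) [Preorder α] [Preorder β] (φ : α → β),
    Monotone φ → StrictMono φ → DevLE m β → DevLE m α := by
  induction m with
  | zero =>
    intro α β _ _ φ h1 h2 h f hf
    filter_upwards [h (φ ∘ f) (h1.comp_antitone hf)] with i hi hlt
    exact hi (h2 hlt)
  | succ m ih =>
    intro α β _ _ φ h1 h2 h f hf
    have h3 := h (φ ∘ f) (h1.comp_antitone hf)
    filter_upwards [h3] with i hi
    refine ih _ _ (fun x : Set.Icc (f (i+1)) (f i) =>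
      (⟨φ x, h1 x.2.1, h1 x.2.2⟩ : Set.Icc ((φ ∘ f) (i+1)) ((φ ∘ f) i))) ?_ ?_ hi
    · exact fun x y hxy => h1 hxy
    · exact fun x y hxy => h2 hxy

variable {B : Type} [CommRing B]

lemma step_mem {P J : Ideal B} [hP : P.IsPrime] (hPJ : P ≤ J) {a : B} (ha : a ∉ P) (i : ℕ) {j : B}
    (h : a ^ i * j ∈ P ⊔ Ideal.span {a ^ i} * J) : j ∈ J := by
  rw [Submodule.mem_sup] at h
  obtain ⟨p, hp, y, hy, e⟩ := h
  rw [Ideal.mem_span_singleton_mul] at hy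
  obtain ⟨z, hz, rfl⟩ := hy
  have : a ^ i * (j - z) ∈ P := by
    rw [mul_sub, ← e, add_sub_cancel_right]; exact hp
  rcases hP.mem_or_mem this with h | h
  · exact absurd (hP.mem_of_pow_mem _ h) ha
  · have := J.add_mem (hPJ h) hz
    rwa [sub_add_cancel] at this

def pch (P : Ideal B) (a : B) (i : ℕ) : Set.Icc P ⊤ :=
  ⟨P ⊔ Ideal.span {a ^ i}, le_sup_left, le_top⟩

lemma pch_anti (P : Ideal B) (a : B) : Antitone (pch P a) := by
  apply antitone_nat_of_succ_le
  intro i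
  refine Subtype.mk_le_mk.2 (sup_le_sup_left ?_ _)
  rw [Ideal.span_singleton_le_span_singleton]
  exact pow_dvd_pow _ (by omega)

lemma not_dev_chain (m : ℕ) : ∀ p : Fin (m + 2) → PrimeSpectrum B, StrictMono p →
    ¬ DevLE m (Set.Icc (p 0).asIdeal ⊤) := by
  induction m with
  | zero =>
    intro p hp h
    have hlt : (p 0).asIdeal < (p 1).asIdeal := hp (by decide)
    obtain ⟨a, haQ, haP⟩ := SetLike.exists_of_lt hlt
    have h2 := h (pch _ a) (pch_anti _ a)
    obtain ⟨i, hi⟩ := h2.exists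
    apply hi
    refine lt_of_le_not_ge ?_ ?_
    · exact pch_anti _ a (Nat.le_succ i)
    · intro hle
      replace hle : (p 0).asIdeal ⊔ Ideal.span {a ^ i} ≤ (p 0).asIdeal ⊔ Ideal.span {a ^ (i+1)} :=
        hle
      have h1 : a ^ i * 1 ∈ (p 0).asIdeal ⊔ Ideal.span {a ^ (i+1)} := by
        rw [mul_one]
        exact hle (le_sup_right (a := (p 0).asIdeal) (Ideal.mem_span_singleton_self _))
      have h3 : (p 0).asIdeal ⊔ Ideal.span {a ^ (i+1)} ≤
          (p 0).asIdeal ⊔ Ideal.span {a ^ i} * (p 1).asIdeal := by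
        refine sup_le_sup_left ?_ _
        rw [Ideal.span_singleton_le_iff_mem, pow_succ]
        exact Ideal.mul_mem_mul (Ideal.mem_span_singleton_self _) haQ
      exact (p 1).isPrime.ne_top ((Ideal.eq_top_iff_one _).2 (step_mem hlt.le haP i (h3 h1)))
  | succ m ih =>
    intro p hp h
    have hlt : (p 0).asIdeal < (p 1).asIdeal := hp (by simp)
    obtain ⟨a, haQ, haP⟩ := SetLike.exists_of_lt hlt
    have h2 := h (pch _ a) (pch_anti _ a)
    obtain ⟨i, hi⟩ := h2.exists
    refine ih (fun j => p j.succ) (fun _ _ h => hp (by simpa using h)) ?_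
    have hmono : Monotone (fun J : Ideal B => (p 0).asIdeal ⊔ Ideal.span {a ^ i} * J) :=
      fun J J' hJ => sup_le_sup_left (Ideal.mul_mono_right hJ) _
    have hm1 : ∀ J : Set.Icc (p (Fin.succ 0)).asIdeal ⊤,
        (p 0).asIdeal ⊔ Ideal.span {a ^ (i+1)} ≤ (p 0).asIdeal ⊔ Ideal.span {a ^ i} * J.1 := by
      intro J
      refine sup_le_sup_left ?_ _
      rw [Ideal.span_singleton_le_iff_mem, pow_succ]
      exact Ideal.mul_mem_mul (Ideal.mem_span_singleton_self _) (J.2.1 haQ)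
    have hm2 : ∀ J : Set.Icc (p (Fin.succ 0)).asIdeal ⊤,
        (p 0).asIdeal ⊔ Ideal.span {a ^ i} * J.1 ≤ (p 0).asIdeal ⊔ Ideal.span {a ^ i} :=
      fun J => sup_le_sup_left Ideal.mul_le_left _
    let ψ : Set.Icc (p (Fin.succ 0)).asIdeal ⊤ →
        Set.Icc (pch (p 0).asIdeal a (i+1)) (pch (p 0).asIdeal a i) :=
      fun J => ⟨⟨(p 0).asIdeal ⊔ Ideal.span {a ^ i} * J.1, le_sup_left, le_top⟩, hm1 J, hm2 J⟩
    refine DevLE.pull m _ _ ψ ?_ ?_ hi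
    · exact fun J J' hJ => hmono hJ
    · intro J J' hJ
      refine lt_of_le_not_ge (hmono hJ.le) ?_
      intro hle
      refine hJ.not_ge ?_
      intro j hj
      refine step_mem (hlt.le.trans J.2.1) haP i (hle ?_)
      exact le_sup_right (a := (p 0).asIdeal)
        (Ideal.mul_mem_mul (Ideal.mem_span_singleton_self _) hj)

lemma le_of_dev [IsDomain B] {K : Type} [Field K] [Algebra K B] {n : ℕ} (φ : MvPolynomial (Fin n) K →ₐ[K] B)
    (hφ : Function.Injective φ) (hf : φ.Finite) {m : ℕ} (h : DevLE m (Ideal B)) : n ≤ m := by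
  by_contra hlt
  push Not at hlt
  let _ : Algebra (MvPolynomial (Fin n) K) B := φ.toRingHom.toAlgebra
  have : Module.Finite (MvPolynomial (Fin n) K) B := hf
  have : Algebra.IsIntegral (MvPolynomial (Fin n) K) B := inferInstance
  have : FaithfulSMul (MvPolynomial (Fin n) K) B :=
    (faithfulSMul_iff_algebraMap_injective _ _).2 hφ
  have h1 : ringKrullDim (MvPolynomial (Fin n) K) = n := by
    rw [MvPolynomial.ringKrullDim_of_isNoetherianRing, ringKrullDim_eq_zero_of_field]
    simp
  have h2 : ((m+1 : ℕ) : WithBot ℕ∞) ≤ Order.krullDim (PrimeSpectrum (MvPolynomial (Fin n) K)) := by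
    change _ ≤ ringKrullDim (MvPolynomial (Fin n) K)
    rw [h1]
    exact_mod_cast hlt
  rw [Order.le_krullDim_iff] at h2
  obtain ⟨l0, hl0⟩ := h2
  obtain ⟨Q, hQ, hQ2⟩ := Ideal.exists_ideal_over_prime_of_isIntegral_of_isDomain (S := B)
    (RelSeries.head l0).asIdeal (by
      rw [(RingHom.injective_iff_ker_eq_bot (algebraMap (MvPolynomial (Fin n) K) B)).1 hφ]
      exact bot_le)
  have : Q.LiesOver (RelSeries.head l0).asIdeal := ⟨hQ2.symm⟩
  obtain ⟨l, hl, -⟩ := Ideal.exists_ltSeries_of_hasGoingUp l0 Q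
  rw [hl0] at hl
  obtain ⟨len, f, st⟩ := l
  dsimp at hl
  subst hl
  refine not_dev_chain m f (Fin.strictMono_iff_lt_succ.2 st) ?_
  exact DevLE.pull m _ _ (fun J => J.1) (fun _ _ h => h) (fun _ _ h => h) h

end Dev
end KD

namespace KD

section LinGrowth

lemma finrank_le_mul_ker {K A : Type} [Field K] [AddCommGroup A] [Module K A] (T : A →ₗ[K] A) :
    ∀ (k : ℕ) (V : Submodule K A), FiniteDimensional K V → V.map T ≤ V →
      V.map (T ^ k) = ⊥ → Module.finrank K V ≤ k * Module.finrank K ↥(V ⊓ LinearMap.ker T) := by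
  intro k
  induction k with
  | zero =>
    intro V _ _ h
    have : V = ⊥ := by simpa [Module.End.one_eq_id] using h
    subst this
    simp
  | succ k ih =>
    intro V hV h1 h2
    have h3 := ih (V.map T) inferInstance (Submodule.map_mono h1) (by
      rw [← Submodule.map_comp, ← Module.End.mul_eq_comp, ← pow_succ]; exact h2)
    have h4 := LinearMap.finrank_range_add_finrank_ker (T.domRestrict V)
    rw [LinearMap.range_domRestrict] at h4
    have h5 : Module.finrank K (LinearMap.ker (T.domRestrict V)) =
        Module.finrank K ↥(V ⊓ LinearMap.ker T) := by
      rw [LinearMap.ker_domRestrict]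
      have : Submodule.comap V.subtype (LinearMap.ker T) = Submodule.comap V.subtype (V ⊓ LinearMap.ker T) := by
        ext x; simp
      rw [this]
      exact (Submodule.comapSubtypeEquivOfLe inf_le_left).finrank_eq
    have h6 : Module.finrank K ↥(V.map T ⊓ LinearMap.ker T) ≤
        Module.finrank K ↥(V ⊓ LinearMap.ker T) :=
      Submodule.finrank_mono (inf_le_inf_right _ h1)
    rw [h5] at h4
    have h7 := Nat.mul_le_mul_left k h6
    rw [← h4, add_mul, one_mul]
    omega

variable {K B : Type} [Field K] [CommRing B] [Algebra K B]

lemma growth_B {n : ℕ} (φ : MvPolynomial (Fin n) K →ₐ[K] B) (hf : φ.Finite)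
    (Y : Submodule K B) [FiniteDimensional K Y] :
    ∃ C, ∀ k, FiniteDimensional K ↥(Y ^ k) ∧ Module.finrank K ↥(Y ^ k) ≤ C * (k+1) ^ n := by
  classical
  let _ : Algebra (MvPolynomial (Fin n) K) B := φ.toRingHom.toAlgebra
  have hfin : Module.Finite (MvPolynomial (Fin n) K) B := hf
  obtain ⟨S, hS⟩ := hfin
  let mo : (Fin n → ℕ) → B := fun a => φ (MvPolynomial.monomial (Finsupp.equivFunOnFinite.symm a) 1)
  have mo_add : ∀ a b, mo (a + b) = mo a * mo b := by
    intro a b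
    simp only [mo]
    rw [← map_mul, MvPolynomial.monomial_mul, one_mul]
    have : (Finsupp.equivFunOnFinite.symm (a + b)) =
        Finsupp.equivFunOnFinite.symm a + Finsupp.equivFunOnFinite.symm b := by ext; simp
    rw [this]
  let T : ℕ → Finset B := fun k => (box n k ×ˢ S).image (fun p => mo p.1 * p.2)
  let M : ℕ → Submodule K B := fun k => Submodule.span K (T k)
  have M_mono : ∀ k l, k ≤ l → M k ≤ M l := by
    intro k l h
    apply Submodule.span_mono
    intro x hx
    simp only [T, Finset.coe_image, Set.mem_image, Finset.mem_coe, Finset.mem_product, mem_box] at hx ⊢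
    obtain ⟨p, ⟨h1, h2⟩, h3⟩ := hx
    exact ⟨p, ⟨fun i => (h1 i).trans h, h2⟩, h3⟩
  have M_mo : ∀ k l a, a ∈ box n k → ∀ b ∈ M l, mo a * b ∈ M (k + l) := by
    intro k l a ha
    have : M l ≤ (M (k+l)).comap (LinearMap.mulLeft K (mo a)) := by
      rw [Submodule.span_le]
      intro x hx
      simp only [T, Finset.coe_image, Set.mem_image, Finset.mem_coe, Finset.mem_product, mem_box] at hx
      obtain ⟨p, ⟨h1, h2⟩, rfl⟩ := hx
      apply Submodule.subset_span
      simp only [T, Finset.coe_image, Set.mem_image, Finset.mem_coe, Finset.mem_product, mem_box]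
      refine ⟨(a + p.1, p.2), ⟨fun i => ?_, h2⟩, ?_⟩
      · rw [mem_box] at ha
        exact add_le_add (ha i) (h1 i)
      · simp [mo_add, mul_assoc]
    exact this
  have M_ex : ∀ b, ∃ k, b ∈ M k := by
    intro b
    have hb : b ∈ Submodule.span (MvPolynomial (Fin n) K) (S : Set B) := by rw [hS]; trivial
    induction hb using Submodule.span_induction with
    | mem x hx =>
      refine ⟨0, Submodule.subset_span ?_⟩
      simp only [T, Finset.coe_image, Set.mem_image, Finset.mem_coe, Finset.mem_product, mem_box]
      refine ⟨(0, x), ⟨fun i => le_rfl, hx⟩, ?_⟩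
      have : mo 0 = 1 := by
        simp only [mo]
        have : (Finsupp.equivFunOnFinite.symm (0 : Fin n → ℕ)) = 0 := by ext; simp
        rw [this]
        exact map_one φ
      simp [this]
    | zero => exact ⟨0, zero_mem _⟩
    | add x y _ _ hx hy =>
      obtain ⟨k, hk⟩ := hx
      obtain ⟨l, hl⟩ := hy
      exact ⟨k + l, add_mem (M_mono _ _ (by omega) hk) (M_mono _ _ (by omega) hl)⟩
    | smul p x _ hx =>
      obtain ⟨k, hk⟩ := hx
      have : p • x = φ p * x := rfl
      rw [this]
      clear this
      induction p using MvPolynomial.induction_on' with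
      | monomial a r =>
        refine ⟨(∑ i, a i) + k, ?_⟩
        have h1 : φ (MvPolynomial.monomial a r) = r • mo a := by
          simp only [mo]
          rw [← map_smul, MvPolynomial.smul_monomial]
          simp
        rw [h1, smul_mul_assoc]
        refine Submodule.smul_mem _ _ (M_mo _ _ _ ?_ _ hk)
        rw [mem_box]
        intro i
        exact Finset.single_le_sum (f := fun i => a i) (fun _ _ => Nat.zero_le _) (Finset.mem_univ i)
      | add p q hp hq =>
        obtain ⟨k, hk⟩ := hp
        obtain ⟨l, hl⟩ := hq
        refine ⟨k + l, ?_⟩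
        rw [map_add, add_mul]
        exact add_mem (M_mono _ _ (by omega) hk) (M_mono _ _ (by omega) hl)
  have M_fin : ∀ (Z : Submodule K B), Z.FG → ∃ k, Z ≤ M k := by
    rintro Z ⟨F, rfl⟩
    choose f hf using M_ex
    refine ⟨F.sup f, ?_⟩
    rw [Submodule.span_le]
    intro x hx
    exact M_mono _ _ (Finset.le_sup hx) (hf x)
  have hYfg : Y.FG := (Submodule.fg_iff_finiteDimensional _).2 inferInstance
  obtain ⟨d1, hd1⟩ := M_ex 1
  obtain ⟨d2, hd2⟩ := M_fin (Y * Submodule.span K (S : Set B))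
    (hYfg.mul ⟨S, rfl⟩)
  have hYM : ∀ k, Y * M k ≤ M (k + d2) := by
    intro k
    rw [Submodule.mul_le]
    intro y hy b hb
    have : M k ≤ (M (k+d2)).comap (LinearMap.mulLeft K y) := by
      rw [Submodule.span_le]
      intro x hx
      simp only [T, Finset.coe_image, Set.mem_image, Finset.mem_coe, Finset.mem_product] at hx
      obtain ⟨p, ⟨h1, h2⟩, rfl⟩ := hx
      simp only [Submodule.comap_coe, Set.mem_preimage, LinearMap.mulLeft_apply, SetLike.mem_coe]
      rw [mul_left_comm]
      exact M_mo _ _ _ h1 _ (hd2 (Submodule.mul_mem_mul hy (Submodule.subset_span h2)))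
    exact this hb
  have hYk : ∀ k, Y ^ k ≤ M (d1 + k * d2) := by
    intro k
    induction k with
    | zero => simpa using Submodule.one_le.2 hd1
    | succ k ih =>
      rw [pow_succ']
      refine (mul_le_mul_right ih Y).trans ((hYM _).trans (M_mono _ _ ?_))
      rw [add_mul]; omega
  refine ⟨(d1 + d2 + 1) ^ n * S.card, fun k => ?_⟩
  have hfd : FiniteDimensional K (M (d1 + k * d2)) := FiniteDimensional.span_finset K _
  refine ⟨Submodule.finiteDimensional_of_le (hYk k), ?_⟩
  refine (Submodule.finrank_mono (hYk k)).trans ?_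
  refine (finrank_span_finset_le_card _).trans ?_
  refine Finset.card_image_le.trans ?_
  rw [Finset.card_product]
  have hb : (box n (d1 + k * d2)).card = (d1 + k * d2 + 1) ^ n := by
    simp [box]
  rw [hb, mul_right_comm, ← mul_pow]
  refine Nat.mul_le_mul_right _ (Nat.pow_le_pow_left ?_ n)
  nlinarith [Nat.zero_le (d1 * k)]

end LinGrowth
end KD

namespace KD

section GensSec
variable {K B A : Type} [Field K] [CommRing B] [Algebra K B] [Ring A] [Algebra K A]

structure Gens (X : Ctx K B A) {r n : ℕ} (c : Fin r → Chart K B n) where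
  s : ℕ
  u : Fin s → A
  w : Fin s → ℕ
  W : ℕ
  Y : Submodule K B
  ac : AC K u w
  hw : ∀ i, 1 ≤ w i
  hgen : Algebra.adjoin K (Set.range u) = ⊤
  fin : FiniteDimensional K Y
  ix : Fin r → Fin n → Fin s
  hix : ∀ l j, u (ix l j) = X.ι ((c l).x j)
  wix : ∀ l j, w (ix l j) = 1
  id : Fin r → Fin n → Fin s
  hid : ∀ l j, u (id l j) = X.der ((c l).δ j)
  wid : ∀ l j, w (id l j) = W
  tx : ∀ l j i, u i * X.ι ((c l).x j) - X.ι ((c l).x j) * u i ∈ G K u w (w i)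
  ρY : ∀ k, ∀ a ∈ G K u w k, X.ρ a 1 ∈ Y ^ k

lemma exists_gens [CharZero K] [hft : Algebra.FiniteType K B] (X : Ctx K B A) {r n : ℕ}
    (c : Fin r → Chart K B n)
    (hc : Ideal.span (Set.range fun l => (c l).g) = ⊤) : Nonempty (Gens X c) := by
  classical
  obtain ⟨S, hS⟩ := hft.out
  let J := S ⊕ (Fin r × Fin n)
  let y : J → B := Sum.elim (fun b => b) (fun p => (c p.1).x p.2)
  let Y : Submodule K B := Submodule.span K (insert 1 (Set.range y))
  have one_Y : (1 : B) ∈ Y := Submodule.subset_span (Set.mem_insert _ _)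
  have y_Y : ∀ j, y j ∈ Y := fun j => Submodule.subset_span (Set.mem_insert_of_mem _ ⟨j, rfl⟩)
  have Y_mono : ∀ k l, k ≤ l → Y ^ k ≤ Y ^ l := by
    intro k l h
    exact pow_le_pow_right₀ (Submodule.one_le.2 one_Y) h
  have Y_mul : ∀ k l a b, a ∈ Y ^ k → b ∈ Y ^ l → a * b ∈ Y ^ (k + l) := by
    intro k l a b ha hb
    rw [pow_add]; exact Submodule.mul_mem_mul ha hb
  have Y_ex : ∀ b, ∃ k, b ∈ Y ^ k := by
    intro b
    have hb : b ∈ Algebra.adjoin K (S : Set B) := by rw [hS]; trivial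
    induction hb using Algebra.adjoin_induction with
    | mem x hx => exact ⟨1, by rw [pow_one]; exact y_Y (Sum.inl ⟨x, hx⟩)⟩
    | algebraMap r => exact ⟨0, by rw [pow_zero]; exact Submodule.algebraMap_mem r⟩
    | add a b _ _ ha hb =>
      obtain ⟨k, hk⟩ := ha
      obtain ⟨l, hl⟩ := hb
      exact ⟨k + l, add_mem (Y_mono _ _ (by omega) hk) (Y_mono _ _ (by omega) hl)⟩
    | mul a b _ _ ha hb =>
      obtain ⟨k, hk⟩ := ha
      obtain ⟨l, hl⟩ := hb
      exact ⟨k + l, Y_mul _ _ _ _ hk hl⟩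
  have Y_fam : ∀ (F : Type) [Fintype F] (f : F → B), ∃ k, ∀ i, f i ∈ Y ^ k := by
    intro F _ f
    choose g hg using fun i => Y_ex (f i)
    exact ⟨Finset.univ.sup g, fun i => Y_mono _ _ (Finset.le_sup (Finset.mem_univ i)) (hg i)⟩
  choose e he using fun d => X.der_eq hc d
  obtain ⟨k1, hk1⟩ := Y_fam ((Fin r × Fin n) × J) (fun p => (c p.1.1).δ p.1.2 (y p.2))
  obtain ⟨k2, hk2⟩ := Y_fam ((Fin r × Fin n) × (Fin r × Fin n) × (Fin r × Fin n))
    (fun p => e ⁅(c p.1.1).δ p.1.2, (c p.2.1.1).δ p.2.1.2⁆ p.2.2.1 p.2.2.2)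
  let V := k1 + k2
  let I := J ⊕ (Fin r × Fin n)
  let u0 : I → A := Sum.elim (fun j => X.ι (y j)) (fun p => X.der ((c p.1).δ p.2))
  let w0 : I → ℕ := Sum.elim (fun _ => 1) (fun _ => V + 1)
  let eq := Fintype.equivFin I
  let s := Fintype.card I
  let u : Fin s → A := fun i => u0 (eq.symm i)
  let w : Fin s → ℕ := fun i => w0 (eq.symm i)
  have hu : ∀ i, u (eq i) = u0 i := fun i => by simp [u]
  have hw : ∀ i, w (eq i) = w0 i := fun i => by simp [w]
  have gY : ∀ b ∈ Y, X.ι b ∈ G K u w 2 := by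
    have : Y ≤ (G K u w 2).comap X.ι.toLinearMap := by
      rw [Submodule.span_le]
      rintro b (rfl | ⟨j, rfl⟩)
      · simpa using one_mem_G u w (by omega)
      · have := gen_mem_G (K := K) u w (eq (Sum.inl j)) (k := 2) (by rw [hw]; simp [w0])
        rw [hu] at this
        exact this
    exact this
  have gYk : ∀ k, ∀ b ∈ Y ^ k, X.ι b ∈ G K u w (k + 1) := by
    intro k
    induction k with
    | zero =>
      intro b hb
      rw [pow_zero, Submodule.mem_one] at hb
      obtain ⟨t, rfl⟩ := hb
      rw [AlgHom.commutes, Algebra.algebraMap_eq_smul_one]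
      exact Submodule.smul_mem _ _ (one_mem_G u w (by omega))
    | succ k ih =>
      have : Y ^ (k+1) ≤ (G K u w (k+1+1)).comap X.ι.toLinearMap := by
        rw [pow_succ, Submodule.mul_le]
        intro a ha b hb
        simp only [Submodule.mem_comap, AlgHom.toLinearMap_apply, map_mul]
        exact G_mul (k := k) (l := 2) u w (ih a ha) (gY b hb)
      exact this
  have gδ : ∀ l j i, X.ι ((c l).δ j (y i)) ∈ G K u w (V + 1) := by
    intro l j i
    exact G_mono u w (by omega) (gYk _ _ (hk1 ((l, j), i)))
  have δY : ∀ l j b, b ∈ Y → (c l).δ j b ∈ Y ^ (V + 1) := by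
    intro l j
    have : Y ≤ (Y ^ (V+1)).comap ((c l).δ j : B →ₗ[K] B) := by
      rw [Submodule.span_le]
      rintro b (rfl | ⟨i, rfl⟩)
      · simp
      · exact Y_mono k1 (V+1) (by omega) (hk1 ((l, j), i))
    exact this
  have δYk : ∀ l j k b, b ∈ Y ^ k → (c l).δ j b ∈ Y ^ (V + 1 + k) := by
    intro l j k
    induction k with
    | zero =>
      intro b hb
      rw [pow_zero, Submodule.mem_one] at hb
      obtain ⟨t, rfl⟩ := hb
      simp
    | succ k ih =>
      have : Y ^ (k+1) ≤ (Y ^ (V + 1 + (k+1))).comap ((c l).δ j : B →ₗ[K] B) := by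
        rw [pow_succ, Submodule.mul_le]
        intro a ha b hb
        simp only [Submodule.mem_comap, Derivation.coeFn_coe, Derivation.leibniz, smul_eq_mul]
        refine add_mem ?_ ?_
        · exact Y_mono _ _ (by omega) (Y_mul _ _ _ _ ha (δY l j b hb))
        · have h1 : b ∈ Y ^ 1 := by rwa [pow_one]
          exact Y_mono _ _ (by omega) (Y_mul _ _ _ _ h1 (ih a ha))
      exact this
  have hac : ∀ i j, u0 i * u0 j - u0 j * u0 i ∈ G K u w (w0 i + w0 j) := by
    rintro (i | i) (j | j)
    · simp only [u0, Sum.elim_inl]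
      rw [X.ι_comm, sub_self]; exact zero_mem _
    · simp only [u0, Sum.elim_inl, Sum.elim_inr]
      rw [← neg_sub, X.der_br]
      exact neg_mem (G_mono u w (by simp [w0]) (gδ j.1 j.2 i))
    · simp only [u0, Sum.elim_inl, Sum.elim_inr]
      rw [X.der_br]
      exact G_mono u w (by simp [w0]) (gδ i.1 i.2 j)
    · simp only [u0, Sum.elim_inr]
      rw [X.der_lie, he]
      refine Submodule.sum_mem _ (fun l _ => Submodule.sum_mem _ (fun m _ => ?_))
      have h1 := gYk _ _ (hk2 (i, j, (l, m)))
      have h2 := gen_mem_G (K := K) u w (eq (Sum.inr (l, m))) (k := V + 2) (by rw [hw]; simp [w0])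
      rw [hu] at h2
      refine G_mono u w ?_ (G_mul u w h1 h2)
      simp only [w0, Sum.elim_inr]
      omega
  have hix' : ∀ (l : Fin r) (j : Fin n), u (eq (Sum.inl (Sum.inr (l, j)))) = X.ι ((c l).x j) :=
    fun l j => by rw [hu]; rfl
  have hid' : ∀ (l : Fin r) (j : Fin n), u (eq (Sum.inr (l, j))) = X.der ((c l).δ j) :=
    fun l j => by rw [hu]; rfl
  have wix' : ∀ (l : Fin r) (j : Fin n), w (eq (Sum.inl (Sum.inr (l, j)))) = 1 :=
    fun l j => by rw [hw]; rfl
  have wid' : ∀ (l : Fin r) (j : Fin n), w (eq (Sum.inr (l, j))) = V + 1 :=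
    fun l j => by rw [hw]; rfl
  refine ⟨⟨s, u, w, V + 1, Y, fun i j => hac _ _, ?_, ?_, ?_,
    fun l j => eq (Sum.inl (Sum.inr (l, j))), hix', wix',
    fun l j => eq (Sum.inr (l, j)), hid', wid', ?_, ?_⟩⟩
  · intro i
    simp only [w]
    rcases eq.symm i with j | j <;> simp [w0]
  · refine X.gen hc _ ?_ ?_
    · intro b
      obtain ⟨k, hk⟩ := Y_ex b
      have : G K u w (k+1) ≤ Subalgebra.toSubmodule (Algebra.adjoin K (Set.range u)) := by
        rw [G, Submodule.span_le]
        rintro _ ⟨L, -, rfl⟩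
        refine Subalgebra.list_prod_mem _ ?_
        intro x hx
        rw [List.mem_map] at hx
        obtain ⟨i, -, rfl⟩ := hx
        exact Algebra.subset_adjoin ⟨i, rfl⟩
      exact this (gYk k b hk)
    · intro l j
      refine Algebra.subset_adjoin ⟨eq (Sum.inr (l, j)), ?_⟩
      rw [hu]; rfl
  · exact FiniteDimensional.span_of_finite K ((Set.finite_range y).insert 1)
  · intro l j i
    simp only [u, w]
    rcases eq.symm i with i | i
    · simp only [u0, Sum.elim_inl]
      rw [X.ι_comm, sub_self]; exact zero_mem _
    · simp only [u0, Sum.elim_inr]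
      rw [X.der_br]
      exact gδ i.1 i.2 (Sum.inr (l, j))
  · have h1 : ∀ i m b, b ∈ Y ^ m → X.ρ (u i) b ∈ Y ^ (w i + m) := by
      intro i m b hb
      simp only [u, w]
      rcases eq.symm i with i | i
      · simp only [u0, w0, Sum.elim_inl]
        rw [X.hρ]
        exact Y_mul _ _ _ _ (by rw [pow_one]; exact y_Y i) hb
      · simp only [u0, w0, Sum.elim_inr]
        rw [X.hder]
        exact δYk _ _ _ _ hb
    have h2 : ∀ L, X.ρ (pr u L) 1 ∈ Y ^ (wtL w L) := by
      intro L
      induction L with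
      | nil => rw [pr_nil, wtL_nil, map_one X.ρ, pow_zero]; exact Submodule.one_le.1 le_rfl
      | cons i L ih =>
        rw [pr_cons, map_mul, Module.End.mul_apply, wtL_cons]
        exact h1 _ _ _ ih
    intro k a ha
    rw [G] at ha
    induction ha using Submodule.span_induction with
    | mem a ha =>
      obtain ⟨L, hL, rfl⟩ := ha
      exact Y_mono _ _ hL.le (h2 L)
    | zero => simp
    | add a b _ _ ha hb => rw [map_add, LinearMap.add_apply]; exact add_mem ha hb
    | smul t a _ ha => rw [map_smul, LinearMap.smul_apply]; exact Submodule.smul_mem _ _ ha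

end GensSec
end KD

namespace KD

section GrowthA
variable {K B A : Type} [Field K] [CommRing B] [Algebra K B] [Ring A] [Algebra K A]

def adm (K : Type) {A : Type} [Field K] [Ring A] [Algebra K A] (x : A) : A →ₗ[K] A :=
  LinearMap.mulRight K x - LinearMap.mulLeft K x

@[simp] lemma adm_apply (x a : A) : adm K x a = a * x - x * a := rfl

lemma adm_mul (x a b : A) : adm K x (a * b) = adm K x a * b + a * adm K x b := by
  simp only [adm_apply]; noncomm_ring

lemma adm_comm {x y : A} (h : x * y = y * x) (a : A) :
    adm K x (adm K y a) = adm K y (adm K x a) := by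
  simp only [adm_apply]
  simp only [sub_mul, mul_sub, mul_assoc, h]
  simp only [← mul_assoc, h]
  abel

lemma G_zero {s : ℕ} (u : Fin s → A) (w : Fin s → ℕ) : G K u w 0 = ⊥ := by
  rw [G, Submodule.span_eq_bot]
  rintro x ⟨L, h, -⟩
  omega

variable {X : Ctx K B A} {r n : ℕ} {c : Fin r → Chart K B n}

lemma Gens.T_pr (Γ : Gens X c) (l : Fin r) (j : Fin n) (L) :
    adm K (X.ι ((c l).x j)) (pr Γ.u L) ∈ G K Γ.u Γ.w (wtL Γ.w L) := by
  induction L with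
  | nil => simp
  | cons i L ih =>
    rw [pr_cons, adm_mul, wtL_cons]
    refine add_mem ?_ ?_
    · exact G_mul_pr _ _ L (Γ.tx l j i)
    · have := G_pr_mul Γ.u Γ.w [i] ih
      simpa using this

lemma Gens.T_mem (Γ : Gens X c) (l : Fin r) (j : Fin n) {k : ℕ} {a : A}
    (ha : a ∈ G K Γ.u Γ.w (k+1)) : adm K (X.ι ((c l).x j)) a ∈ G K Γ.u Γ.w k := by
  have : G K Γ.u Γ.w (k+1) ≤ (G K Γ.u Γ.w k).comap (adm K (X.ι ((c l).x j))) := by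
    nth_rw 1 [G]
    rw [Submodule.span_le]
    rintro _ ⟨L, h, rfl⟩
    exact G_mono _ _ (by omega) (Γ.T_pr l j L)
  exact this ha

lemma Gens.T_mem' (Γ : Gens X c) (l : Fin r) (j : Fin n) {k : ℕ} {a : A}
    (ha : a ∈ G K Γ.u Γ.w k) : adm K (X.ι ((c l).x j)) a ∈ G K Γ.u Γ.w k := by
  cases k with
  | zero =>
    rw [G_zero, Submodule.mem_bot] at ha ⊢
    rw [ha, map_zero]
  | succ k => exact G_mono _ _ (by omega) (Γ.T_mem l j ha)

lemma Gens.T_pow (Γ : Gens X c) (l : Fin r) (j : Fin n) (k m : ℕ) {a : A}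
    (ha : a ∈ G K Γ.u Γ.w (k + m)) : ((adm K (X.ι ((c l).x j))) ^ m) a ∈ G K Γ.u Γ.w k := by
  induction m generalizing a with
  | zero => simpa using ha
  | succ m ih =>
    rw [pow_succ, Module.End.mul_apply]
    exact ih (Γ.T_mem l j ha)

lemma Gens.growth [CharZero K] [IsDomain B] (Γ : Gens X c) (l : Fin r)
    (φ : MvPolynomial (Fin n) K →ₐ[K] B) (hf : φ.Finite) :
    ∃ C, ∀ k, Module.finrank K (G K Γ.u Γ.w k) ≤ C * (k+1) ^ (2 * n) := by
  have := Γ.fin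
  obtain ⟨C, hC⟩ := growth_B φ hf Γ.Y
  refine ⟨C, fun k => ?_⟩
  have hfin := G_finite Γ.ac Γ.hw k
  let T : Fin n → A →ₗ[K] A := fun j => adm K (X.ι ((c l).x j))
  have Tcomm : ∀ i j a, T i (T j a) = T j (T i a) := fun i j a => adm_comm (X.ι_comm _ _) a
  let Z : ℕ → Submodule K A := fun m => G K Γ.u Γ.w k ⊓ ⨅ i : Fin n, ⨅ _ : i.1 < m,
    LinearMap.ker (T i)
  have memZ : ∀ m a, a ∈ Z m ↔ a ∈ G K Γ.u Γ.w k ∧ ∀ i : Fin n, i.1 < m → T i a = 0 := by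
    intro m a
    simp [Z, Submodule.mem_iInf]
  have step : ∀ m, m < n → Module.finrank K (Z m) ≤ k * Module.finrank K (Z (m+1)) := by
    intro m hm
    have h1 : Z (m+1) = Z m ⊓ LinearMap.ker (T ⟨m, hm⟩) := by
      ext a
      rw [memZ, Submodule.mem_inf, memZ, LinearMap.mem_ker]
      constructor
      · rintro ⟨h1, h2⟩
        exact ⟨⟨h1, fun i hi => h2 i (by omega)⟩, h2 _ (by simp)⟩
      · rintro ⟨⟨h1, h2⟩, h3⟩
        refine ⟨h1, fun i hi => ?_⟩
        rcases Nat.lt_succ_iff_lt_or_eq.1 hi with h | h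
        · exact h2 i h
        · have : i = ⟨m, hm⟩ := Fin.ext h
          rw [this]; exact h3
    rw [h1]
    refine finrank_le_mul_ker _ k (Z m) (Submodule.finiteDimensional_of_le inf_le_left) ?_ ?_
    · rintro _ ⟨a, ha, rfl⟩
      rw [SetLike.mem_coe, memZ] at ha
      rw [memZ]
      refine ⟨Γ.T_mem' l _ ha.1, fun i hi => ?_⟩
      rw [Tcomm, ha.2 i hi, map_zero]
    · rw [eq_bot_iff]
      rintro _ ⟨a, ha, rfl⟩
      rw [SetLike.mem_coe, memZ] at ha
      have := Γ.T_pow l ⟨m, hm⟩ 0 k (a := a) (by simpa using ha.1)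
      rwa [G_zero] at this
  have all : ∀ m, m ≤ n → Module.finrank K (Z 0) ≤ k ^ m * Module.finrank K (Z m) := by
    intro m
    induction m with
    | zero => simp
    | succ m ih =>
      intro hm
      refine (ih (by omega)).trans ?_
      rw [pow_succ, mul_assoc]
      exact Nat.mul_le_mul_left _ (step m (by omega))
  have h0 : Z 0 = G K Γ.u Γ.w k := by
    ext a; rw [memZ]; simp
  have hn : Z n ≤ (Γ.Y ^ k).map X.ι.toLinearMap := by
    intro a ha
    rw [memZ] at ha
    have h1 : a ∈ X.F 1 := X.commutant (c l) (fun j => sub_eq_zero.1 (ha.2 j j.2))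
    exact ⟨X.ρ a 1, Γ.ρY k a ha.1, (X.eq_ι h1).symm⟩
  have hYf := (hC k).1
  have h2 := all n le_rfl
  rw [h0] at h2
  calc _ ≤ _ := h2
    _ ≤ k ^ n * (C * (k+1) ^ n) := by
      refine Nat.mul_le_mul_left _ ?_
      exact (Submodule.finrank_mono hn).trans ((Submodule.finrank_map_le _ _).trans (hC k).2)
    _ ≤ (k+1) ^ n * (C * (k+1) ^ n) := Nat.mul_le_mul_right _ (Nat.pow_le_pow_left (by omega) n)
    _ = _ := by rw [two_mul, pow_add]; ring

end GrowthA
end KD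

namespace KD

section Bern
open MvPolynomial
variable {K B A : Type} [Field K] [CommRing B] [Algebra K B] [Ring A] [Algebra K A]

structure LA (X : Ctx K B A) {n : ℕ} (c : Chart K B n) (W : ℕ) (M : ℕ → Submodule K A) : Prop where
  mono : ∀ j, M (j+1) ≤ M j
  left : ∀ j z, ∀ a ∈ M j, z * a ∈ M j
  rx : ∀ i j, ∀ a ∈ M (j+1), a * X.ι (c.x i) ∈ M j
  rd : ∀ i j, ∀ a ∈ M (j+W), a * X.der (c.δ i) ∈ M j

variable {X : Ctx K B A} {n : ℕ} {c : Chart K B n} {W : ℕ} {M : ℕ → Submodule K A}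

lemma LA.anti (h : LA X c W M) : Antitone M := antitone_nat_of_succ_le h.mono

lemma LA.poly [CharZero K] (h : LA X c W M) (N : ℕ) : ∀ q : MvPolynomial (Fin n) K, q ≠ 0 →
    (∀ m, coeff m q ≠ 0 → m.degree < N + 1) → ∀ e j,
    X.ι (c.g ^ e * aeval c.x q) ∈ M (j + N * W) → ∃ e', X.ι (c.g ^ e') ∈ M j := by
  induction N with
  | zero =>
    intro q hq hN e j hm
    rcases pd_step q 0 hN with ⟨a, rfl⟩ | ⟨i, -, M', h1, -⟩
    · refine ⟨e, ?_⟩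
      have ha : a ≠ 0 := by rintro rfl; simp at hq
      have := (M _).smul_mem a⁻¹ hm
      rw [← map_smul, aeval_C, mul_comm (c.g ^ e), ← Algebra.smul_def, smul_smul, inv_mul_cancel₀ ha,
        one_smul] at this
      simpa using this
    · omega
  | succ N ih =>
    intro q hq hN e j hm
    rcases pd_step q (N+1) hN with ⟨a, rfl⟩ | ⟨i, hi, M', h1, h2⟩
    · refine ⟨e, ?_⟩
      have ha : a ≠ 0 := by rintro rfl; simp at hq
      have := (M _).smul_mem a⁻¹ hm
      rw [← map_smul, aeval_C, mul_comm (c.g ^ e), ← Algebra.smul_def, smul_smul, inv_mul_cancel₀ ha,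
        one_smul] at this
      exact h.anti (Nat.le_add_right _ _) this
    · obtain rfl : N = M' := by omega
      refine ih (pderiv i q) hi h2 (e+2) j ?_
      have e1 : j + (N+1) * W = (j + N * W) + W := by ring
      rw [e1] at hm
      have hm' := h.anti (Nat.le_add_right (j + N * W) W) hm
      have k1 := (M _).sub_mem (h.left _ (X.der (c.δ i)) _ hm') (h.rd i _ _ hm)
      rw [X.der_br] at k1
      have k2 := (M _).sub_mem (h.left _ (X.ι c.g) _ k1)
        (h.left _ (X.ι ((e : B) * c.δ i c.g)) _ hm')
      rw [← map_mul, ← map_mul, ← map_sub] at k2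
      convert k2 using 2
      rw [Derivation.leibniz, Derivation.leibniz_pow, c.der_aeval]
      simp only [smul_eq_mul, nsmul_eq_mul]
      rcases e with _ | e
      · simp; ring
      · simp only [Nat.add_sub_cancel]; push_cast; ring

lemma LA.adm (h : LA X c W M) (t : Fin n → K) (j : ℕ) (a : A) (ha : a ∈ M (j+1)) :
    adm K (X.ι (∑ i, t i • c.x i)) a ∈ M j := by
  rw [adm_apply]
  refine (M j).sub_mem ?_ (h.left _ _ _ (h.mono j ha))
  rw [map_sum, Finset.mul_sum]
  refine (M j).sum_mem fun i _ => ?_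
  rw [map_smul, mul_smul_comm]
  exact (M j).smul_mem _ (h.rx i j a ha)

lemma LA.adm_iter (h : LA X c W M) (t : Fin n → K) (k : ℕ) : ∀ (j : ℕ) (a : A), a ∈ M (j+k) →
    (KD.adm K (X.ι (∑ i, t i • c.x i)))^[k] a ∈ M j := by
  induction k with
  | zero => intro j a ha; simpa using ha
  | succ k ih =>
    intro j a ha
    rw [Function.iterate_succ_apply]
    exact ih j _ (h.adm t (j+k) a ha)

lemma adm_leib (y x b : A) (hx : adm K y (adm K y x) = 0) (m : ℕ) :
    (adm K y)^[m+1] (x * b) = x * (adm K y)^[m+1] b +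
      ((m+1 : ℕ) : K) • (adm K y x * (adm K y)^[m] b) := by
  induction m with
  | zero => simp only [Function.iterate_succ_apply', Function.iterate_zero, id, adm_mul]; simp; abel
  | succ m ih =>
    rw [Function.iterate_succ_apply', ih, map_add, map_smul, adm_mul, adm_mul, hx, zero_mul, zero_add,
      ← Function.iterate_succ_apply' (f := adm K y), ← Function.iterate_succ_apply' (f := adm K y)]
    have e1 : ((m + 1 + 1 : ℕ) : K) = ((m + 1 : ℕ) : K) + 1 := by push_cast; ring
    rw [e1, add_smul _ (1:K), one_smul]
    rw [add_assoc, add_comm (adm K y x * _), add_assoc]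

lemma adm_der (t : Fin n → K) (L : List (Fin n)) :
    (adm K (X.ι (∑ i, t i • c.x i)))^[L.length] (pr (fun j => X.der (c.δ j)) L) =
      X.ι (((L.length.factorial : K) * pr t L) • c.g ^ L.length) := by
  induction L with
  | nil => simp
  | cons i L ih =>
    have h1 : adm K (X.ι (∑ i, t i • c.x i)) (X.der (c.δ i)) = X.ι (t i • c.g) := by
      rw [adm_apply, X.der_br]
      simp [c.hδ]
    have h2 : ∀ b, adm K (X.ι (∑ i, t i • c.x i)) (X.ι b) = 0 := by
      intro b; rw [adm_apply, X.ι_comm, sub_self]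
    rw [pr_cons, List.length_cons, adm_leib _ _ _ (by rw [h1, h2]), h1,
      Function.iterate_succ_apply', ih, h2, mul_zero, zero_add, ← map_mul, ← map_smul]
    congr 1
    rw [smul_mul_smul_comm, smul_smul, pr_cons, Nat.factorial_succ, pow_succ' c.g]
    congr 1
    push_cast
    ring

lemma adm_der_zero (t : Fin n → K) (L : List (Fin n)) (k : ℕ) (hk : L.length < k) :
    (adm K (X.ι (∑ i, t i • c.x i)))^[k] (pr (fun j => X.der (c.δ j)) L) = 0 := by
  obtain ⟨m, rfl⟩ : ∃ m, k = m + (L.length + 1) := ⟨k - (L.length + 1), by omega⟩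
  rw [Function.iterate_add_apply, Function.iterate_succ_apply', adm_der]
  have : adm K (X.ι (∑ i, t i • c.x i)) (X.ι (((L.length.factorial : K) * pr t L) • c.g ^ L.length)) = 0 := by
    rw [adm_apply, X.ι_comm, sub_self]
  rw [this]
  exact Function.iterate_fixed (map_zero _) m

lemma adm_ι_mul (x b : B) (k : ℕ) (a : A) :
    (adm K (X.ι x))^[k] (X.ι b * a) = X.ι b * (adm K (X.ι x))^[k] a := by
  induction k with
  | zero => simp
  | succ k ih =>
    rw [Function.iterate_succ_apply', ih, adm_mul, Function.iterate_succ_apply']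
    have : adm K (X.ι x) (X.ι b) = 0 := by rw [adm_apply, X.ι_comm, sub_self]
    rw [this, zero_mul, zero_add]

lemma length_lst (a : Fin n → ℕ) : (lst a).length = ∑ i, a i := by
  simp [lst]

lemma pr_lst {R : Type} [CommRing R] (t : Fin n → R) (a : Fin n → ℕ) : pr t (lst a) = ∏ i, t i ^ a i := by
  rw [pr, Finset.prod_list_map_count]
  rw [Finset.prod_subset (Finset.subset_univ _)]
  · exact Finset.prod_congr rfl fun i _ => by rw [count_lst]
  · intro i _ hi
    rw [List.mem_toFinset] at hi
    rw [List.count_eq_zero_of_not_mem hi, pow_zero]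

lemma exists_t [CharZero K] {m : ℕ} (f : (Fin n → Fin m) → MvPolynomial (Fin n) K)
    (s : Finset (Fin n → Fin m)) (β₀) (h0 : β₀ ∈ s) (hf : f β₀ ≠ 0) :
    ∃ t : Fin n → K, ∑ β ∈ s, C (∏ i, t i ^ (β i : ℕ)) * f β ≠ 0 := by
  classical
  by_contra! hcon
  let emb : (Fin n → Fin m) → (Fin n →₀ ℕ) := fun β => Finsupp.equivFunOnFinite.symm fun i => (β i : ℕ)
  have hemb : Function.Injective emb := by
    intro a b hab
    funext i
    exact Fin.ext (DFunLike.congr_fun hab i)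
  let Q : MvPolynomial (Fin n) (MvPolynomial (Fin n) K) := ∑ β ∈ s, monomial (emb β) (f β)
  have hQ : Q = 0 := by
    refine funext_set (fun _ => Set.range (C : K → MvPolynomial (Fin n) K))
      (fun _ => Set.infinite_range_of_injective (C_injective _ _)) ?_
    intro y hy
    choose t ht using fun i => hy i (Set.mem_univ _)
    rw [map_zero, ← hcon t, map_sum]
    refine Finset.sum_congr rfl fun β _ => ?_
    rw [eval_monomial, mul_comm, Finsupp.prod_fintype _ _ (by simp)]
    congr 1
    rw [map_prod]
    refine Finset.prod_congr rfl fun i _ => ?_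
    rw [map_pow, ht]
    rfl
  have := congrArg (coeff (emb β₀)) hQ
  simp only [Q, coeff_sum, coeff_monomial, coeff_zero, hemb.eq_iff] at this
  rw [Finset.sum_ite_eq' s β₀ f, if_pos h0] at this
  exact hf this

lemma LA.box [CharZero K] (h : LA X c W M) {m N : ℕ} (f : (Fin n → Fin m) → MvPolynomial (Fin n) K)
    (hf : f ≠ 0) (hN : ∀ β a, coeff a (f β) ≠ 0 → a.degree < N + 1) (j : ℕ)
    (hmem : ∑ β, X.ι (aeval c.x (f β)) * mon (fun i => X.der (c.δ i)) (fun i => (β i : ℕ))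
      ∈ M (j + N * W + n * m)) : ∃ e, X.ι (c.g ^ e) ∈ M j := by
  classical
  let sup := Finset.univ.filter fun β => f β ≠ 0
  have hne : sup.Nonempty := by
    obtain ⟨β, hβ⟩ := Function.ne_iff.1 hf
    exact ⟨β, by simpa [sup] using hβ⟩
  obtain ⟨β₀, hβ₀, hmax⟩ := Finset.exists_max_image sup (fun β => ∑ i, (β i : ℕ)) hne
  set k := ∑ i, (β₀ i : ℕ) with hk
  have hkn : k ≤ n * m := by
    calc k ≤ ∑ i : Fin n, m := Finset.sum_le_sum fun i _ => (β₀ i).2.le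
      _ = n * m := by simp
  let s := Finset.univ.filter fun β : Fin n → Fin m => ∑ i, (β i : ℕ) = k
  obtain ⟨t, ht⟩ := exists_t f s β₀ (by simp [s, hk]) (by simpa [sup] using hβ₀)
  set q := ∑ β ∈ s, C (∏ i, t i ^ (β i : ℕ)) * f β with hq
  have key := h.adm_iter t k (j + N * W) _ (h.anti (Nat.add_le_add_left hkn _) hmem)
  have comp : (KD.adm K (X.ι (∑ i, t i • c.x i)))^[k]
      (∑ β, X.ι (aeval c.x (f β)) * mon (fun i => X.der (c.δ i)) (fun i => (β i : ℕ))) =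
      (k.factorial : K) • X.ι (c.g ^ k * aeval c.x q) := by
    rw [← Module.End.coe_pow, map_sum]
    simp only [Module.End.coe_pow, adm_ι_mul, mon]
    rw [← Finset.sum_filter_add_sum_filter_not Finset.univ
      (fun β : Fin n → Fin m => ∑ i, (β i : ℕ) = k)]
    rw [Finset.sum_eq_zero (s := Finset.univ.filter fun β : Fin n → Fin m => ¬ ∑ i, (β i : ℕ) = k),
      add_zero]
    · rw [hq, map_sum (aeval c.x), Finset.mul_sum, map_sum X.ι (fun β => c.g ^ k * aeval c.x (C (∏ i, t i ^ (β i : ℕ)) * f β)), Finset.smul_sum]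
      refine Finset.sum_congr rfl fun β hβ => ?_
      have hβ' : ∑ i, (β i : ℕ) = k := by simpa [s] using hβ
      have := adm_der (X := X) (c := c) t (lst fun i => (β i : ℕ))
      rw [length_lst, hβ', pr_lst] at this
      rw [this, ← map_mul, ← map_smul]
      congr 1
      rw [map_mul, aeval_C, ← Algebra.smul_def, mul_smul_comm, mul_smul_comm, smul_smul, mul_comm (aeval c.x (f β))]
    · intro β hβ
      have hβ' : ∑ i, (β i : ℕ) ≠ k := by simpa using hβ
      by_cases h0 : f β = 0
      · rw [h0, map_zero, map_zero, zero_mul]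
      · have := hmax β (by simpa [sup] using h0)
        rw [adm_der_zero, mul_zero]
        rw [length_lst]
        omega
  rw [comp] at key
  have hk0 : (k.factorial : K) ≠ 0 := by exact_mod_cast k.factorial_ne_zero
  have key2 := (M _).smul_mem (k.factorial : K)⁻¹ key
  rw [smul_smul, inv_mul_cancel₀ hk0, one_smul] at key2
  refine h.poly N q ht ?_ k j key2
  intro a ha
  rw [hq, coeff_sum] at ha
  obtain ⟨β, -, hβ⟩ := Finset.exists_ne_zero_of_sum_ne_zero ha
  rw [coeff_C_mul] at hβ
  exact hN β a (right_ne_zero_of_mul hβ)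

end Bern

end KD

namespace KD

section Bern2
open MvPolynomial
variable {K B A : Type} [Field K] [CommRing B] [Algebra K B] [Ring A] [Algebra K A]

def Phi (X : Ctx K B A) {n : ℕ} (c : Chart K B n) (m : ℕ) :
    ((Fin n → Fin m) × (Fin n → Fin m) → K) →ₗ[K] A :=
  Fintype.linearCombination K (fun p : (Fin n → Fin m) × (Fin n → Fin m) =>
    mon (fun i => X.ι (c.x i)) (fun i => (p.1 i : ℕ)) *
      mon (fun i => X.der (c.δ i)) (fun i => (p.2 i : ℕ)))

lemma mon_ι (X : Ctx K B A) {n : ℕ} (c : Chart K B n) (a : Fin n → ℕ) :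
    mon (fun i => X.ι (c.x i)) a =
      X.ι (aeval c.x (monomial (Finsupp.equivFunOnFinite.symm a) (1 : K))) := by
  rw [aeval_monomial, map_one, one_mul, Finsupp.prod_fintype _ _ (by simp)]
  have := pr_lst c.x a
  simp only [Finsupp.coe_equivFunOnFinite_symm]
  rw [← this, pr, map_list_prod, List.map_map]
  rfl

lemma LA.phi [CharZero K] {X : Ctx K B A} {n : ℕ} {c : Chart K B n} {W : ℕ}
    {M : ℕ → Submodule K A} (h : LA X c W M) (m : ℕ) (p) (hp : p ≠ 0) (j : ℕ)
    (hmem : Phi X c m p ∈ M (j + n * m * W + n * m)) : ∃ e, X.ι (c.g ^ e) ∈ M j := by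
  classical
  let emb : (Fin n → Fin m) → (Fin n →₀ ℕ) := fun β => Finsupp.equivFunOnFinite.symm fun i => (β i : ℕ)
  have hemb : Function.Injective emb := by
    intro a b hab
    funext i
    exact Fin.ext (DFunLike.congr_fun hab i)
  let f : (Fin n → Fin m) → MvPolynomial (Fin n) K := fun β => ∑ α, monomial (emb α) (p (α, β))
  have hco : ∀ β α, coeff (emb α) (f β) = p (α, β) := by
    intro β α
    simp only [f, coeff_sum, coeff_monomial, hemb.eq_iff]
    simp
  refine h.box (N := n * m) f ?_ ?_ j ?_
  · obtain ⟨⟨α, β⟩, hαβ⟩ := Function.ne_iff.1 hp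
    intro h0
    apply hαβ
    rw [← hco, h0]; simp
  · intro β a ha
    simp only [f, coeff_sum] at ha
    obtain ⟨α, -, hα⟩ := Finset.exists_ne_zero_of_sum_ne_zero ha
    rw [coeff_monomial] at hα
    have : emb α = a := by by_contra h'; exact hα (if_neg h')
    rw [← this, Finsupp.degree_eq_sum]
    calc ∑ i, emb α i ≤ ∑ i : Fin n, m := Finset.sum_le_sum fun i _ => (α i).2.le
      _ = n * m := by simp
      _ < _ := by omega
  · convert hmem using 1
    rw [Phi, Fintype.linearCombination_apply, Fintype.sum_prod_type_right]
    refine Finset.sum_congr rfl fun β _ => ?_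
    simp only [f, map_sum]
    rw [Finset.sum_mul]
    refine Finset.sum_congr rfl fun α _ => ?_
    rw [mon_ι, ← smul_mul_assoc, ← map_smul, ← map_smul, smul_monomial, smul_eq_mul, mul_one]

variable {X : Ctx K B A} {r n : ℕ} {c : Fin r → Chart K B n}

lemma pr_map {s t : ℕ} (u : Fin s → A) (f : Fin t → Fin s) (L : List (Fin t)) :
    pr (fun i => u (f i)) L = pr u (L.map f) := by
  rw [pr, pr, List.map_map]; rfl

lemma wtL_map_const {s t : ℕ} (w : Fin s → ℕ) (f : Fin t → Fin s) (W : ℕ) (h : ∀ i, w (f i) = W)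
    (L : List (Fin t)) : wtL w (L.map f) = L.length * W := by
  induction L with
  | nil => simp
  | cons i L ih => rw [List.map_cons, wtL_cons, ih, h, List.length_cons]; ring

lemma Gens.phi_mem (Γ : Gens X c) (l : Fin r) (m : ℕ) (p) :
    Phi X (c l) m p ∈ G K Γ.u Γ.w (1 + n * m * Γ.W + n * m) := by
  rw [Phi, Fintype.linearCombination_apply]
  refine Submodule.sum_mem _ fun q _ => Submodule.smul_mem _ _ ?_
  simp only [← Γ.hix, ← Γ.hid, mon]
  rw [pr_map Γ.u (Γ.ix l), pr_map Γ.u (Γ.id l), ← pr_append]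
  apply pr_mem_G
  rw [wtL_append, wtL_map_const _ _ 1 (Γ.wix l), wtL_map_const _ _ Γ.W (Γ.wid l), length_lst,
    length_lst]
  have hb : ∀ α : Fin n → Fin m, ∑ i, (α i : ℕ) ≤ n * m := fun α =>
    calc ∑ i, (α i : ℕ) ≤ ∑ i : Fin n, m := Finset.sum_le_sum fun i _ => (α i).2.le
      _ = n * m := by simp
  have h1 := hb q.1
  have h2 := Nat.mul_le_mul_right Γ.W (hb q.2)
  omega

/-- annihilator filtration -/
def Ann (Γ : Gens X c) (N' : Submodule A A) (u0 : A) (j : ℕ) : Submodule K A where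
  carrier := {a | ∀ y ∈ G K Γ.u Γ.w j, a * (y * u0) ∈ N'}
  add_mem' := fun {a b} ha hb y hy => by rw [add_mul]; exact N'.add_mem (ha y hy) (hb y hy)
  zero_mem' := fun y _ => by rw [zero_mul]; exact N'.zero_mem
  smul_mem' := fun k a ha y hy => by
    rw [smul_mul_assoc, Algebra.smul_def]
    exact N'.smul_mem (algebraMap K A k) (ha y hy)

lemma ann_LA (Γ : Gens X c) (N' : Submodule A A) (u0 : A) (l : Fin r) :
    LA X (c l) Γ.W (Ann Γ N' u0) where
  mono := fun j a ha y hy => ha y (G_mono _ _ (Nat.le_succ _) hy)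
  left := fun j z a ha y hy => by rw [mul_assoc]; exact N'.smul_mem z (ha y hy)
  rx := fun i j a ha y hy => by
    rw [mul_assoc, ← mul_assoc _ y]
    apply ha
    have := G_pr_mul Γ.u Γ.w [Γ.ix l i] hy
    simp only [pr_cons, pr_nil, mul_one, wtL_cons, wtL_nil, add_zero, Γ.hix, Γ.wix] at this
    rwa [add_comm]
  rd := fun i j a ha y hy => by
    rw [mul_assoc, ← mul_assoc _ y]
    apply ha
    have := G_pr_mul Γ.u Γ.w [Γ.id l i] hy
    simp only [pr_cons, pr_nil, mul_one, wtL_cons, wtL_nil, add_zero, Γ.hid, Γ.wid] at this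
    rwa [add_comm]

lemma cover_one (hc : Ideal.span (Set.range fun l => (c l).g) = ⊤) (M : Submodule K A)
    (hM : ∀ z, ∀ a ∈ M, z * a ∈ M) (h : ∀ l, ∃ e, X.ι ((c l).g ^ e) ∈ M) : (1 : A) ∈ M := by
  let I : Ideal B :=
    { carrier := {b | X.ι b ∈ M}
      add_mem' := fun {a b} ha hb => by
        change X.ι (a + b) ∈ M
        rw [map_add]; exact M.add_mem ha hb
      zero_mem' := by
        change X.ι 0 ∈ M
        rw [map_zero]; exact M.zero_mem
      smul_mem' := fun a b hb => by
        change X.ι (a * b) ∈ M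
        rw [map_mul]; exact hM _ _ hb }
  have h1 : I.radical = ⊤ := by
    rw [eq_top_iff, ← hc, Ideal.span_le]
    rintro _ ⟨l, rfl⟩
    obtain ⟨e, he⟩ := h l
    exact ⟨e, he⟩
  rw [Ideal.radical_eq_top] at h1
  have : (1 : B) ∈ I := by rw [h1]; trivial
  have h2 : X.ι 1 ∈ M := this
  rwa [map_one] at h2

lemma exists_lift {Q : Type} [AddCommGroup Q] [Module K Q] (π : A →ₗ[K] Q) (U : Submodule K A)
    [FiniteDimensional K (U.map π)] : ∃ d, d = Module.finrank K (U.map π) ∧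
      ∃ y : Fin d → A, (∀ i, y i ∈ U) ∧ ∀ a ∈ U, ∃ k : Fin d → K, π a = π (∑ i, k i • y i) := by
  let b := Module.finBasis K (U.map π)
  have hb : ∀ i, ∃ y ∈ U, π y = b i := fun i => (b i).2
  choose y hy hyb using hb
  refine ⟨_, rfl, y, hy, fun a ha => ?_⟩
  let z : U.map π := ⟨π a, a, ha, rfl⟩
  refine ⟨fun i => b.repr z i, ?_⟩
  have := congrArg Subtype.val (b.sum_repr z)
  simp only [map_sum, map_smul, hyb]
  change (z : Q) = _
  refine this.symm.trans ?_
  simp only [Submodule.coe_sum, Submodule.coe_smul]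

lemma Gens.inj_count (Γ : Gens X c) (N' : Submodule A A) (u0 : A) (l : Fin r) (m : ℕ)
    (J : ℕ) (hJ : J = 1 + n * m * Γ.W + n * m)
    (h : ∀ p, Phi X (c l) m p ∈ Ann Γ N' u0 J → p = 0) :
    m ^ n ≤ Module.finrank K (((G K Γ.u Γ.w (2 * J)).map (LinearMap.mulRight K u0)).map
      (N'.mkQ.restrictScalars K)) := by
  have hfin := G_finite Γ.ac Γ.hw
  have := hfin J
  have := hfin (2 * J)
  set π := N'.mkQ.restrictScalars K
  set U : ℕ → Submodule K A := fun j => (G K Γ.u Γ.w j).map (LinearMap.mulRight K u0)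
  obtain ⟨d, hd, y, hy, hyU⟩ := exists_lift π (U J)
  set D := Module.finrank K ((U (2*J)).map π)
  have hdD : d ≤ D := hd ▸ Submodule.finrank_mono (Submodule.map_mono (Submodule.map_mono
    (G_mono _ _ (by omega))))
  have hmem : ∀ p i, π (Phi X (c l) m p * y i) ∈ (U (2*J)).map π := by
    intro p i
    refine ⟨_, ?_, rfl⟩
    obtain ⟨z, hz, hzy⟩ := hy i
    refine ⟨Phi X (c l) m p * z, ?_, ?_⟩
    · have h1 := Γ.phi_mem l m p
      rw [← hJ] at h1
      have h2 : Phi X (c l) m p ∈ G K Γ.u Γ.w (J + 1) := G_mono _ _ (by omega) h1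
      rw [two_mul]
      exact G_mul _ _ h2 hz
    · rw [← hzy]; simp [mul_assoc]
  let Θ : ((Fin n → Fin m) × (Fin n → Fin m) → K) →ₗ[K] (Fin d → (U (2*J)).map π) :=
    LinearMap.pi fun i => LinearMap.codRestrict _
      (π ∘ₗ LinearMap.mulRight K (y i) ∘ₗ Phi X (c l) m) (fun p => hmem p i)
  have hΘ : Function.Injective Θ := by
    rw [← LinearMap.ker_eq_bot, LinearMap.ker_eq_bot']
    intro p hp
    apply h
    intro z hz
    have h1 : ∀ i, Phi X (c l) m p * y i ∈ N' := by
      intro i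
      have := congrArg Subtype.val (congrFun hp i)
      exact (Submodule.Quotient.mk_eq_zero N').1 this
    obtain ⟨k, hk⟩ := hyU (z * u0) ⟨z, hz, rfl⟩
    have h2 : z * u0 - ∑ i, k i • y i ∈ N' := (Submodule.Quotient.eq N').1 hk
    have h3 := N'.smul_mem (Phi X (c l) m p) h2
    rw [smul_eq_mul, mul_sub, Finset.mul_sum] at h3
    refine (Submodule.sub_mem_iff_left N' ?_).1 h3
    refine N'.sum_mem fun i _ => ?_
    rw [mul_smul_comm, Algebra.smul_def]
    exact N'.smul_mem _ (h1 i)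
  have h4 := LinearMap.finrank_le_finrank_of_injective hΘ
  rw [Module.finrank_fintype_fun_eq_card, Module.finrank_pi_fintype] at h4
  simp only [Fintype.card_prod, Fintype.card_fun, Fintype.card_fin, Finset.sum_const,
    Finset.card_univ, smul_eq_mul] at h4
  have h5 : m ^ n * m ^ n ≤ D * D := h4.trans (Nat.mul_le_mul_right _ hdD)
  exact Nat.mul_self_le_mul_self_iff.1 h5

lemma Gens.bern [CharZero K] (Γ : Gens X c) (hc : Ideal.span (Set.range fun l => (c l).g) = ⊤)
    (N' N : Submodule A A) (hN : N' ≤ N)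
    (hno : NoOrth n (E K Γ.u Γ.w N \ E K Γ.u Γ.w N')) : N' = N := by
  classical
  by_contra hne
  obtain ⟨u0, hu0, hu0'⟩ := SetLike.exists_of_lt (lt_of_le_of_ne hN hne)
  obtain ⟨c0, hc0⟩ := G_gen Γ.u Γ.w Γ.hgen u0
  obtain ⟨C, hC⟩ := count_bound (E_upper Γ.ac N) (E_upper Γ.ac N') hno
  set Q := 2 * (1 + n * (Γ.W + 1)) + c0 + 3 with hQ
  set m := C * Q ^ n + 1 with hm
  set J := 1 + n * m * Γ.W + n * m with hJ
  have hex : ∃ l, ∀ p, Phi X (c l) m p ∈ Ann Γ N' u0 J → p = 0 := by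
    by_contra! hcon
    have h1 : (1 : A) ∈ Ann Γ N' u0 1 := by
      refine cover_one (X := X) hc _ ?_ ?_
      · exact fun z a ha y hy => by rw [mul_assoc]; exact N'.smul_mem z (ha y hy)
      · intro l
        obtain ⟨p, hp, hp0⟩ := hcon l
        exact (ann_LA Γ N' u0 l).phi m p hp0 1 hp
    have := h1 1 (one_mem_G _ _ one_pos)
    rw [one_mul, one_mul] at this
    exact hu0' this
  obtain ⟨l, hl⟩ := hex
  have h1 := Γ.inj_count N' u0 l m J hJ hl
  set k := 2 * J + c0 + 1 + m with hk
  have h2 := image_finrank Γ.ac Γ.hw hN (k := k)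
    (X := (G K Γ.u Γ.w (2 * J)).map (LinearMap.mulRight K u0)) (by
      rintro _ ⟨z, -, rfl⟩
      exact N.smul_mem z hu0) (by
      rintro _ ⟨z, hz, rfl⟩
      have hz' : z ∈ G K Γ.u Γ.w (2 * J + 1) := G_mono _ _ (by omega) hz
      exact G_mono _ _ (by omega) (G_mul _ _ hz' hc0))
  have h3 := hC k
  have h4 : k + 1 ≤ Q * m := by
    have hm1 : 1 ≤ m := by omega
    have : k + 1 = 2 * n * (Γ.W + 1) * m + m + (c0 + 4) * 1 := by rw [hk, hJ]; ring
    have : Q * m = 2 * n * (Γ.W + 1) * m + m + (c0 + 4) * m := by rw [hQ]; ring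
    have := Nat.mul_le_mul_left (c0 + 4) hm1
    omega
  have h5 : (k + 1) * m ^ n ≤ (C * Q ^ n) * m ^ n := by
    calc (k+1) * m ^ n ≤ _ := Nat.mul_le_mul_left _ (h1.trans h2)
      _ ≤ _ := by convert h3
      _ ≤ C * (Q * m) ^ n := Nat.mul_le_mul_left _ (Nat.pow_le_pow_left h4 n)
      _ = _ := by rw [mul_pow]; ring
  have h6 := Nat.le_of_mul_le_mul_right h5 (by positivity)
  omega

end Bern2

end KD

namespace KD

section GK

lemma gammaDeg_eq (f : ℕ → ℕ) (d C Q : ℕ) (hu : ∀ i, 1 ≤ i → f i ≤ C * i ^ d)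
    (hQ : 1 ≤ Q) (hl : ∀ m, 1 ≤ m → m ^ d ≤ f (Q * m)) :
    gammaDeg (fun i => (f i : ℕ∞)) = (d : EReal) := by
  apply le_antisymm
  · refine EReal.le_of_forall_lt_iff_le.1 fun z hz => ?_
    have hz' : (d : ℝ) < z := by exact_mod_cast hz
    apply sInf_le
    refine ⟨z, rfl, ?_⟩
    have ht : Tendsto (fun i : ℕ => (i : ℝ) ^ (z - d)) atTop atTop :=
      (tendsto_rpow_atTop (by linarith)).comp tendsto_natCast_atTop_atTop
    filter_upwards [ht.eventually_ge_atTop (C : ℝ), eventually_ge_atTop 1] with i hi h1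
    have h0 : (0 : ℝ) < i := by exact_mod_cast h1
    have : (f i : ℝ) ≤ (i : ℝ) ^ z := by
      calc (f i : ℝ) ≤ C * (i : ℝ) ^ d := by exact_mod_cast hu i h1
        _ ≤ (i : ℝ) ^ (z - d) * (i : ℝ) ^ d := by gcongr
        _ = (i : ℝ) ^ z := by
          rw [← Real.rpow_natCast, ← Real.rpow_add h0]; congr 1; ring
    have := Nat.le_floor this
    exact_mod_cast this
  · apply le_sInf
    rintro _ ⟨z, rfl, hz⟩
    suffices (d : ℝ) ≤ z by exact_mod_cast this
    by_contra hlt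
    push Not at hlt
    have ht : Tendsto (fun i : ℕ => (i : ℝ) ^ ((d : ℝ) - z)) atTop atTop :=
      (tendsto_rpow_atTop (by linarith)).comp tendsto_natCast_atTop_atTop
    have hQm : Tendsto (fun m : ℕ => Q * m) atTop atTop :=
      tendsto_id.const_mul_atTop' (by omega)
    obtain ⟨m, h1, h2, h3⟩ := ((hQm.eventually hz).and
      ((ht.eventually_gt_atTop ((Q : ℝ) ^ z)).and (eventually_ge_atTop 1))).exists
    have h0 : (0 : ℝ) < m := by exact_mod_cast h3
    have hQ0 : (0 : ℝ) < Q := by exact_mod_cast hQ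
    have h4 : f (Q * m) ≤ ⌊((Q * m : ℕ) : ℝ) ^ z⌋₊ := by dsimp only at h1; exact_mod_cast h1
    have h5 : ((m : ℝ)) ^ d ≤ ((Q * m : ℕ) : ℝ) ^ z := by
      calc (m : ℝ) ^ d ≤ (f (Q * m) : ℝ) := by exact_mod_cast hl m h3
        _ ≤ (⌊((Q * m : ℕ) : ℝ) ^ z⌋₊ : ℝ) := by exact_mod_cast h4
        _ ≤ _ := Nat.floor_le (by positivity)
    push_cast at h5
    rw [Real.mul_rpow hQ0.le h0.le, ← Real.rpow_natCast] at h5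
    have h6 : (m : ℝ) ^ (d : ℝ) = (m : ℝ) ^ ((d : ℝ) - z) * (m : ℝ) ^ z := by
      rw [← Real.rpow_add h0]; congr 1; ring
    rw [h6] at h5
    have := le_of_mul_le_mul_right h5 (Real.rpow_pos_of_pos h0 z)
    linarith

variable {K B A : Type} [Field K] [CommRing B] [Algebra K B] [Ring A] [Algebra K A]

lemma pow_mono' {V : Submodule K A} (h1 : (1 : A) ∈ V) {i j : ℕ} (h : i ≤ j) : V ^ i ≤ V ^ j :=
  pow_le_pow_right₀ (Submodule.one_le.2 h1) h

lemma exists_pow {V : Submodule K A} (hV : IsStdFilt K A V) (x : A) : ∃ b, x ∈ V ^ b := by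
  have hx : x ∈ Algebra.adjoin K (V : Set A) := by rw [hV.gen]; trivial
  induction hx using Algebra.adjoin_induction with
  | mem x hx => exact ⟨1, by rwa [pow_one]⟩
  | algebraMap r => exact ⟨0, by rw [pow_zero]; exact Submodule.algebraMap_mem r⟩
  | add x y _ _ hx hy =>
    obtain ⟨a, ha⟩ := hx; obtain ⟨b, hb⟩ := hy
    exact ⟨max a b, add_mem (pow_mono' hV.one_mem (le_max_left _ _) ha)
      (pow_mono' hV.one_mem (le_max_right _ _) hb)⟩
  | mul x y _ _ hx hy =>
    obtain ⟨a, ha⟩ := hx; obtain ⟨b, hb⟩ := hy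
    exact ⟨a + b, by rw [pow_add]; exact Submodule.mul_mem_mul ha hb⟩

lemma pow_finite {V : Submodule K A} (hV : IsStdFilt K A V) (i : ℕ) :
    FiniteDimensional K (V ^ i : Submodule K A) := by
  have := hV.fin
  exact Module.Finite.iff_fg.2 ((Module.Finite.iff_fg.1 this).pow i)

variable {X : Ctx K B A} {r n : ℕ} {c : Fin r → Chart K B n}

lemma Gens.V_le (Γ : Gens X c) {V : Submodule K A} (hV : IsStdFilt K A V) :
    ∃ c0, ∀ i, V ^ i ≤ G K Γ.u Γ.w (c0 * i + 1) := by
  classical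
  obtain ⟨S, hS⟩ := Module.Finite.iff_fg.1 hV.fin
  choose k hk using G_gen (K := K) Γ.u Γ.w Γ.hgen
  refine ⟨S.sup k, fun i => ?_⟩
  have h1 : V ≤ G K Γ.u Γ.w (S.sup k + 1) := by
    rw [← hS, Submodule.span_le]
    intro x hx
    exact G_mono _ _ (Nat.succ_le_succ (Finset.le_sup hx)) (hk x)
  induction i with
  | zero =>
    rw [pow_zero, Submodule.one_le]; exact one_mem_G _ _ (by omega)
  | succ i ih =>
    rw [pow_succ', Submodule.mul_le]
    intro x hx y hy
    have := G_mul _ _ (h1 hx) (ih hy)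
    convert this using 2
    ring

lemma Gens.G_le (Γ : Gens X c) {V : Submodule K A} (hV : IsStdFilt K A V) :
    ∃ b, ∀ k, G K Γ.u Γ.w (k + 1) ≤ V ^ (b * k) := by
  choose b hb using exists_pow hV
  let b0 := Finset.univ.sup fun i => b (Γ.u i)
  refine ⟨b0, fun k => ?_⟩
  have h1 : ∀ L : List (Fin Γ.s), pr Γ.u L ∈ V ^ (b0 * L.length) := by
    intro L
    induction L with
    | nil => simp only [pr_nil, List.length_nil, mul_zero, pow_zero]; exact Submodule.one_le.1 le_rfl
    | cons i L ih =>
      rw [pr_cons, List.length_cons, mul_add, mul_one, add_comm, pow_add]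
      exact Submodule.mul_mem_mul (pow_mono' hV.one_mem
        (Finset.le_sup (f := fun i => b (Γ.u i)) (Finset.mem_univ i)) (hb _)) ih
  have h2 : ∀ L : List (Fin Γ.s), L.length ≤ wtL Γ.w L := by
    intro L
    induction L with
    | nil => simp
    | cons i L ih => rw [List.length_cons, wtL_cons]; have := Γ.hw i; omega
  rw [G, Submodule.span_le]
  rintro _ ⟨L, hL, rfl⟩
  exact pow_mono' hV.one_mem (Nat.mul_le_mul_left _ ((h2 L).trans (by omega))) (h1 L)

lemma phi_inj [CharZero K] [IsDomain B] (X : Ctx K B A) (c : Chart K B n) (m : ℕ) :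
    Function.Injective (Phi X c m) := by
  rw [← LinearMap.ker_eq_bot, LinearMap.ker_eq_bot']
  intro p hp
  by_contra h0
  have hLA : LA X c 0 (fun _ => (⊥ : Submodule K A)) :=
    { mono := fun _ => le_rfl
      left := fun _ z a ha => by rw [Submodule.mem_bot] at ha ⊢; rw [ha, mul_zero]
      rx := fun _ _ a ha => by rw [Submodule.mem_bot] at ha ⊢; rw [ha, zero_mul]
      rd := fun _ _ a ha => by rw [Submodule.mem_bot] at ha ⊢; rw [ha, zero_mul] }
  obtain ⟨e, he⟩ := hLA.phi m p h0 0 (by rw [hp]; exact Submodule.zero_mem _)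
  rw [Submodule.mem_bot, ← map_zero X.ι] at he
  exact pow_ne_zero e c.hg (X.ι_inj he)

lemma Gens.gk [CharZero K] [IsDomain B] (Γ : Gens X c) (l : Fin r)
    (φ : MvPolynomial (Fin n) K →ₐ[K] B) (hf : φ.Finite)
    {V : Submodule K A} (hV : IsStdFilt K A V) : gkAlg K A V = ((2 * n : ℕ) : EReal) := by
  obtain ⟨C, hC⟩ := Γ.growth l φ hf
  obtain ⟨c0, hc0⟩ := Γ.V_le hV
  obtain ⟨b, hb⟩ := Γ.G_le hV
  have hfin := G_finite Γ.ac Γ.hw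
  have hfV := pow_finite hV
  refine gammaDeg_eq (fun i => Module.finrank K (V ^ i : Submodule K A)) (2 * n)
    (C * (c0 + 2) ^ (2 * n)) (b * (n * Γ.W + n) + 1) ?_ (by omega) ?_
  · intro i hi
    have := hfin (c0 * i + 1)
    calc _ ≤ _ := Submodule.finrank_mono (hc0 i)
      _ ≤ _ := hC _
      _ ≤ C * ((c0 + 2) * i) ^ (2 * n) := by
        gcongr
        have : (c0 + 2) * i = c0 * i + 2 * i := by ring
        omega
      _ = _ := by rw [mul_pow]; ring
  · intro m hm
    have h1 : ∀ p, Phi X (c l) m p ∈ V ^ ((b * (n * Γ.W + n) + 1) * m) := by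
      intro p
      have h2 := Γ.phi_mem l m p
      have e : 1 + n * m * Γ.W + n * m = (n * m * Γ.W + n * m) + 1 := by ring
      rw [e] at h2
      refine pow_mono' hV.one_mem ?_ (hb _ h2)
      have : (b * (n * Γ.W + n) + 1) * m = b * (n * m * Γ.W + n * m) + m := by ring
      omega
    have h3 := LinearMap.finrank_le_finrank_of_injective
      (f := LinearMap.codRestrict _ (Phi X (c l) m) h1)
      (fun x y hxy => phi_inj X (c l) m (congrArg Subtype.val hxy))
    rw [Module.finrank_fintype_fun_eq_card] at h3
    simp only [Fintype.card_prod, Fintype.card_fun, Fintype.card_fin] at h3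
    rw [two_mul, pow_add]
    exact h3

end GK

section Final
variable {K B A : Type} [Field K] [CommRing B] [Algebra K B] [Ring A] [Algebra K A]

lemma kdimE_eq {R M : Type} [Ring R] [AddCommGroup M] [Module R M] [Nontrivial M] (n : ℕ)
    (h1 : DevLE n (Submodule R M)) (h2 : ∀ m, DevLE m (Submodule R M) → n ≤ m) :
    kdimE R M = (n : EReal) := by
  rw [kdimE, if_neg (not_subsingleton M)]
  apply le_antisymm
  · exact sInf_le ⟨n, rfl, h1⟩
  · apply le_sInf
    rintro _ ⟨m, rfl, hm⟩
    exact_mod_cast h2 m hm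

lemma main [CharZero K] [IsDomain B] [Algebra.Smooth K B] [Nontrivial A] (X : Ctx K B A)
    {V : Submodule K A} (hV : IsStdFilt K A V) :
    ∃ n : ℕ, kdimE A A = (n : EReal) ∧ gkAlg K A V = ((2 * n : ℕ) : EReal) ∧
      kdimE B B = (n : EReal) := by
  obtain ⟨n, ⟨φ, hφ, hf⟩, r, c, hc⟩ := exists_charts K B
  have hr : Nonempty (Fin r) := by
    by_contra h
    rw [not_nonempty_iff] at h
    rw [Set.range_eq_empty, Ideal.span_empty] at hc
    exact bot_ne_top hc
  obtain ⟨l⟩ := hr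
  obtain ⟨Γ⟩ := exists_gens X c hc
  obtain ⟨C, hC⟩ := Γ.growth l φ hf
  have hno := noOrth_top Γ.ac Γ.hw hC
  have hdev : DevLE n (Submodule A A) := by
    refine devLE_aux Γ.ac (fun N' N h h' => Γ.bern hc N' N h h') n (Submodule A A) id monotone_id
      strictMono_id ⊥ ⊤ (fun x => ⟨bot_le, le_top⟩) ?_
    have e : n + 1 + n = 2 * n + 1 := by ring
    rw [e]; exact hno
  have hpull : ∀ m, DevLE m (Submodule A A) → DevLE m (Ideal B) := fun m h =>
    DevLE.pull m _ _ X.DI X.DI_mono (X.DI_strictMono hc) h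
  refine ⟨n, kdimE_eq n hdev fun m hm => le_of_dev φ hφ hf (hpull m hm), Γ.gk l φ hf hV,
    kdimE_eq n (hpull n hdev) fun m hm => le_of_dev φ hφ hf hm⟩

end Final

end KD

set_option synthInstance.maxHeartbeats 1000000 in
/-- Let `K` be a field of characteristic zero and `B` a finitely generated regular
(= smooth) commutative `K`-algebra which is a domain of finite Krull dimension. Then
`K.dim D(B) = GK(D(B))/2 = K.dim B` (left Krull dimension à la Rentschler–Gabriel). -/
theorem kdim_diffOps_eq_half_gk
    (K B : Type) [Field K] [CharZero K] [CommRing B] [Algebra K B] [IsDomain B]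
    [Algebra.Smooth K B] (hdim : ringKrullDim B < ⊤)
    (V : Submodule K ↥(diffOps K B)) (hV : IsStdFilt K ↥(diffOps K B) V) :
    kdimE ↥(diffOps K B) ↥(diffOps K B) = gkAlg K ↥(diffOps K B) V / 2 ∧
    gkAlg K ↥(diffOps K B) V / 2 = kdimE B B := by
  have hn : Nontrivial ↥(diffOps K B) := inferInstance
  obtain ⟨n, h1, h2, h3⟩ := KD.main (KD.ctx K B) hV
  have h4 : gkAlg K ↥(diffOps K B) V / 2 = (n : EReal) := by
    have e2 : (2 : EReal) = ((2 : ℝ) : EReal) := rfl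
    rw [h2, EReal.div_eq_iff (by rw [e2]; exact EReal.coe_ne_bot _)
      (by rw [e2]; exact EReal.coe_ne_top _) two_ne_zero]
    push_cast
    exact mul_comm _ _
  rw [h4]
  exact ⟨h1, h3.symm⟩

end
end

section
/- (Bernstein's inequality) Let A_n be the n-th Weyl algebra over a field K of characteristic zero. Then GK(M) ≥ n for every nonzero finitely generated A_n-module M. -/
/- Common definitions: degree of a function, standard finite-dimensional filtrations,
Gelfand-Kirillov dimension, return functions and filter dimensions (V. Bavula,
"Filter dimension"), and the Rentschler–Gabriel (left) Krull dimension via deviation. -/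

open Filter

noncomputable section

/-- `A` is the `n`-th Weyl algebra over `K` with canonical generators `X i`, `D i`:
it is a nontrivial `K`-algebra generated by `X 0, …, X (n-1), D 0, …, D (n-1)` subject to
the defining relations `D i * X j - X j * D i = δ_{ij}`, `[X i, X j] = [D i, D j] = 0`
(over a field of characteristic zero any such algebra is a copy of the Weyl algebra,
since the latter is simple). -/
structure IsWeylAlgebra (K A : Type) [Field K] [Ring A] [Algebra K A] (n : ℕ)
    (X D : Fin n → A) : Prop where
  nontrivial : Nontrivial A
  comm_XX : ∀ i j, X i * X j = X j * X i
  comm_DD : ∀ i j, D i * D j = D j * D i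
  rel : ∀ i j, D i * X j - X j * D i = if i = j then 1 else 0
  gen : Algebra.adjoin K (Set.range X ∪ Set.range D) = ⊤

section Bern
open MvPolynomial

lemma exists_comm_hom {K A : Type} [Field K] [Ring A] [Algebra K A] {n : ℕ} (x : Fin n → A)
    (hx : ∀ i j, x i * x j = x j * x i) :
    ∃ ξ : MvPolynomial (Fin n) K →ₐ[K] A, ∀ i, ξ (MvPolynomial.X i) = x i := by
  have := Algebra.isMulCommutative_adjoin K (s := Set.range x)
    (by rintro _ ⟨i, rfl⟩ _ ⟨j, rfl⟩; exact hx i j)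
  let _ : CommRing (Algebra.adjoin K (Set.range x)) :=
    { (Algebra.adjoin K (Set.range x)).toRing with mul_comm := this.is_comm.comm }
  refine ⟨(Algebra.adjoin K (Set.range x)).val.comp
    (MvPolynomial.aeval fun i => (⟨x i, Algebra.subset_adjoin ⟨i, rfl⟩⟩ :
      Algebra.adjoin K (Set.range x))), fun i => by simp⟩

lemma hom_comm_deriv {K A : Type} [Field K] [Ring A] [Algebra K A] {n : ℕ}
    (ξ : MvPolynomial (Fin n) K →ₐ[K] A) (d : A) (j : Fin n)
    (hd : ∀ i, d * ξ (MvPolynomial.X i) - ξ (MvPolynomial.X i) * d = if i = j then 1 else 0)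
    (p : MvPolynomial (Fin n) K) : d * ξ p - ξ p * d = ξ (pderiv j p) := by
  induction p using MvPolynomial.induction_on with
  | C a =>
    have : ξ (C a) = algebraMap K A a := ξ.commutes a
    rw [pderiv_C, map_zero, this, Algebra.commutes, sub_self]
  | add p q hp hq => rw [map_add, map_add, map_add, ← hp, ← hq]; noncomm_ring
  | mul_X p i hp =>
    have h1 : ξ (pderiv j (MvPolynomial.X i : MvPolynomial (Fin n) K)) = if i = j then 1 else 0 := by
      by_cases hij : i = j
      · subst hij; simp
      · rw [pderiv_X_of_ne hij]; simp [hij]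
    rw [pderiv_mul, map_add, map_mul, map_mul, map_mul, h1, ← hp, ← hd i]
    noncomm_ring

lemma hom_commute {K A : Type} [Field K] [Ring A] [Algebra K A] {n : ℕ}
    (ξ : MvPolynomial (Fin n) K →ₐ[K] A) (d : A)
    (hd : ∀ i, d * ξ (MvPolynomial.X i) = ξ (MvPolynomial.X i) * d)
    (p : MvPolynomial (Fin n) K) : d * ξ p = ξ p * d := by
  induction p using MvPolynomial.induction_on with
  | C a =>
    have : ξ (C a) = algebraMap K A a := ξ.commutes a
    rw [this, Algebra.commutes]
  | add p q hp hq => rw [map_add, mul_add, add_mul, hp, hq]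
  | mul_X p i hp => rw [map_mul, ← mul_assoc, hp, mul_assoc, hd, mul_assoc]

lemma hom_mem_pow {K A : Type} [Field K] [Ring A] [Algebra K A] {n : ℕ}
    (ξ : MvPolynomial (Fin n) K →ₐ[K] A) (V : Submodule K A)
    (hV : ∀ i, ξ (MvPolynomial.X i) ∈ V) (s : Fin n →₀ ℕ) :
    ξ (monomial s 1) ∈ V ^ s.degree := by
  induction s using Finsupp.induction_linear with
  | zero =>
    have : ξ (monomial 0 1) = 1 := by
      rw [show (monomial (0 : Fin n →₀ ℕ)) (1 : K) = 1 from rfl, map_one]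
    rw [this]; simp [Submodule.one_le.mp le_rfl]
  | add f g hf hg =>
    rw [show (monomial (f + g) (1 : K)) = monomial f 1 * monomial g 1 by simp, map_mul, map_add,
      pow_add]
    exact Submodule.mul_mem_mul hf hg
  | single a b =>
    rw [Finsupp.degree_single, ← MvPolynomial.X_pow_eq_monomial, map_pow]
    exact Submodule.pow_mem_pow _ (hV a) b

lemma sub_pow_mono {K A : Type} [Field K] [Ring A] [Algebra K A] {V : Submodule K A}
    (h1 : (1 : A) ∈ V) {a b : ℕ} (hab : a ≤ b) : V ^ a ≤ V ^ b := by
  induction b, hab using Nat.le_induction with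
  | base => exact le_rfl
  | succ b _ ih =>
    intro x hx
    rw [pow_succ, ← mul_one x]
    exact Submodule.mul_mem_mul (ih hx) h1

lemma exists_phi {K A : Type} [Field K] [Ring A] [Algebra K A]
    {n : ℕ} {X D : Fin n → A} (h : IsWeylAlgebra K A n X D) (V : Submodule K A)
    (h1 : (1 : A) ∈ V) (hX : ∀ i, X i ∈ V) (hD : ∀ i, D i ∈ V) :
    ∃ φ : MvPolynomial (Fin n ⊕ Fin n) K →ₗ[K] A, φ 1 = 1 ∧
      (∀ j p, D j * φ p - φ p * D j = φ (pderiv (Sum.inl j) p)) ∧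
      (∀ j p, φ p * X j - X j * φ p = φ (pderiv (Sum.inr j) p)) ∧
      ∀ d p, (∀ s, coeff s p ≠ 0 → s.degree ≤ d) → φ p ∈ V ^ d := by
  obtain ⟨ξ, hξ⟩ := exists_comm_hom (K := K) X h.comm_XX
  obtain ⟨δ, hδ⟩ := exists_comm_hom (K := K) D h.comm_DD
  let cl : (Fin n ⊕ Fin n →₀ ℕ) → (Fin n →₀ ℕ) :=
    fun s => s.comapDomain Sum.inl Sum.inl_injective.injOn
  let cr : (Fin n ⊕ Fin n →₀ ℕ) → (Fin n →₀ ℕ) :=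
    fun s => s.comapDomain Sum.inr Sum.inr_injective.injOn
  let mo : (Fin n ⊕ Fin n →₀ ℕ) → A := fun s => ξ (monomial (cl s) 1) * δ (monomial (cr s) 1)
  let φ : MvPolynomial (Fin n ⊕ Fin n) K →ₗ[K] A := (basisMonomials (Fin n ⊕ Fin n) K).constr K mo
  have hφ1 : ∀ s, φ (monomial s 1) = mo s := fun s => by
    have := (basisMonomials (Fin n ⊕ Fin n) K).constr_basis K mo s
    rwa [coe_basisMonomials] at this
  have hφ : ∀ s a, φ (monomial s a) = a • mo s := fun s a => by
    rw [← hφ1, ← map_smul, smul_monomial, smul_eq_mul, mul_one]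
  have mono_smul : ∀ (ψ : MvPolynomial (Fin n) K →ₐ[K] A) s a,
      ψ (monomial s a) = a • ψ (monomial s 1) := fun ψ s a => by
    rw [← map_smul, smul_monomial, smul_eq_mul, mul_one]
  have hDD : ∀ j p, D j * δ p = δ p * D j := fun j p =>
    hom_commute δ (D j) (fun i => by rw [hδ, h.comm_DD]) p
  have hXX : ∀ j p, X j * ξ p = ξ p * X j := fun j p =>
    hom_commute ξ (X j) (fun i => by rw [hξ, h.comm_XX]) p
  have hDX : ∀ j p, D j * ξ p - ξ p * D j = ξ (pderiv j p) := fun j p =>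
    hom_comm_deriv ξ (D j) j (fun i => by rw [hξ, h.rel]; simp [eq_comm]) p
  have hXD : ∀ j p, δ p * X j - X j * δ p = δ (pderiv j p) := fun j p => by
    have := hom_comm_deriv δ (-X j) j (fun i => by
      rw [hδ, ← h.rel]; noncomm_ring) p
    rw [← this]; noncomm_ring
  refine ⟨φ, ?_, ?_, ?_, ?_⟩
  · rw [show (1 : MvPolynomial (Fin n ⊕ Fin n) K) = monomial 0 1 from rfl, hφ1]
    have e1 : cl 0 = 0 := by ext; simp [cl]
    have e2 : cr 0 = 0 := by ext; simp [cr]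
    simp only [mo, e1, e2]
    rw [show (monomial (0 : Fin n →₀ ℕ)) (1 : K) = 1 from rfl, map_one, map_one, one_mul]
  · intro j p
    induction p using MvPolynomial.induction_on' with
    | add p q hp hq => rw [map_add, map_add, map_add, ← hp, ← hq]; noncomm_ring
    | monomial s a =>
      have e1 : cl (s - Finsupp.single (Sum.inl j) 1) = cl s - Finsupp.single j 1 := by
        ext i; simp [cl, Finsupp.single_apply]
      have e2 : cr (s - Finsupp.single (Sum.inl j) 1) = cr s := by
        ext i; simp [cr]
      have e3 : s (Sum.inl j) = cl s j := rfl
      have := hDX j (monomial (cl s) 1)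
      rw [pderiv_monomial, one_mul, mono_smul _ (_ - _)] at this
      rw [pderiv_monomial, hφ, hφ]
      simp only [mo, e1, e2, e3]
      rw [mul_smul, ← smul_mul_assoc ((cl s j : ℕ) : K), ← this, mul_smul_comm, smul_mul_assoc,
        ← smul_sub, mul_assoc (ξ _) (δ _), ← hDD]
      noncomm_ring
  · intro j p
    induction p using MvPolynomial.induction_on' with
    | add p q hp hq => rw [map_add, map_add, map_add, ← hp, ← hq]; noncomm_ring
    | monomial s a =>
      have e1 : cr (s - Finsupp.single (Sum.inr j) 1) = cr s - Finsupp.single j 1 := by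
        ext i; simp [cr, Finsupp.single_apply]
      have e2 : cl (s - Finsupp.single (Sum.inr j) 1) = cl s := by
        ext i; simp [cl]
      have e3 : s (Sum.inr j) = cr s j := rfl
      have := hXD j (monomial (cr s) 1)
      rw [pderiv_monomial, one_mul, mono_smul _ (_ - _)] at this
      rw [pderiv_monomial, hφ, hφ]
      simp only [mo, e1, e2, e3]
      rw [mul_smul, ← mul_smul_comm ((cr s j : ℕ) : K), ← this, mul_smul_comm, smul_mul_assoc,
        ← smul_sub, ← mul_assoc (X j), hXX]
      noncomm_ring
  · intro d p hp
    rw [p.as_sum, map_sum]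
    refine Submodule.sum_mem _ fun s hs => ?_
    rw [hφ]
    refine Submodule.smul_mem _ _ ?_
    have hs' := hp s (mem_support_iff.mp hs)
    refine sub_pow_mono h1 hs' ?_
    have : s.degree = (cl s).degree + (cr s).degree := by
      simp [Finsupp.degree_eq_sum, cl, cr]
    rw [this, pow_add]
    exact Submodule.mul_mem_mul (hom_mem_pow ξ V (fun i => by rw [hξ]; exact hX i) _)
      (hom_mem_pow δ V (fun i => by rw [hδ]; exact hD i) _)

variable {K A M : Type} [Field K] [Ring A] [Algebra K A] [AddCommGroup M]
    [Module K M] [Module A M] [IsScalarTower K A M]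

lemma smulSub_mem {V : Submodule K A} {W : Submodule K M} {i j : ℕ} {a : A} {m : M}
    (ha : a ∈ V ^ j) (hm : m ∈ smulSub K (V ^ i) W) : a • m ∈ smulSub K (V ^ (j + i)) W := by
  unfold smulSub at hm
  induction hm using Submodule.span_induction with
  | mem x hx =>
    obtain ⟨b, hb, w, hw, rfl⟩ := hx
    refine Submodule.subset_span ⟨a * b, ?_, w, hw, by rw [mul_smul]⟩
    rw [pow_add]; exact Submodule.mul_mem_mul ha hb
  | zero => simp
  | add x y _ _ hx hy => rw [smul_add]; exact add_mem hx hy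
  | smul c x _ hx => rw [smul_algebra_smul_comm]; exact Submodule.smul_mem _ _ hx

lemma smulSub_mono {p q : Submodule K A} {W : Submodule K M} (hpq : p ≤ q) :
    smulSub K p W ≤ smulSub K q W := by
  refine Submodule.span_mono ?_
  rintro _ ⟨a, ha, w, hw, rfl⟩
  exact ⟨a, hpq ha, w, hw, rfl⟩

lemma smulSub_fin {p : Submodule K A} {W : Submodule K M} (hp : p.FG) (hW : W.FG) :
    FiniteDimensional K (smulSub K p W) := by
  have h := hp.map₂ (Algebra.lsmul K K M).toLinearMap hW
  have h2 : smulSub K p W ≤ Submodule.map₂ (Algebra.lsmul K K M).toLinearMap p W := by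
    refine Submodule.span_le.mpr ?_
    rintro _ ⟨a, ha, w, hw, rfl⟩
    exact Submodule.apply_mem_map₂ (Algebra.lsmul K K M).toLinearMap ha hw
  have : FiniteDimensional K (Submodule.map₂ (Algebra.lsmul K K M).toLinearMap p W) :=
    Module.Finite.iff_fg.mpr h
  exact Submodule.finiteDimensional_of_le h2

lemma const_of_pderiv [CharZero K] {σ : Type} (p : MvPolynomial σ K)
    (hp : ∀ j, pderiv j p = 0) : ∃ c, p = C c := by
  classical
  refine ⟨coeff 0 p, ?_⟩
  ext s
  rw [coeff_C]
  split_ifs with hs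
  · rw [hs]
  · obtain ⟨j, hj⟩ := Finsupp.ne_iff.mp (Ne.symm hs)
    have e := coeff_pderiv (i := j) p (s - Finsupp.single j 1)
    rw [hp, coeff_zero, Finsupp.sub_add_single_one_cancel (by simpa using hj)] at e
    rcases mul_eq_zero.mp e.symm with e | e
    · exact e
    · exact absurd e (by norm_cast)

lemma inj_key [CharZero K] {n : ℕ} {X D : Fin n → A} (V : Submodule K A)
    (h1 : (1 : A) ∈ V) (hX : ∀ i, X i ∈ V) (hD : ∀ i, D i ∈ V)
    (φ : MvPolynomial (Fin n ⊕ Fin n) K →ₗ[K] A) (hφ1 : φ 1 = 1)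
    (hφD : ∀ j p, D j * φ p - φ p * D j = φ (pderiv (Sum.inl j) p))
    (hφX : ∀ j p, φ p * X j - X j * φ p = φ (pderiv (Sum.inr j) p))
    (W : Submodule K M) (hW : W ≠ ⊥) (d : ℕ) :
    ∀ p, (∀ s, coeff s p ≠ 0 → s.degree ≤ d) →
      (∀ m ∈ smulSub K (V ^ d) W, φ p • m = 0) → p = 0 := by
  have hconst : ∀ d c, (∀ m ∈ smulSub K (V ^ d) W,
      φ (C c : MvPolynomial (Fin n ⊕ Fin n) K) • m = 0) → c = 0 := by
    intro d c hc
    obtain ⟨w, hw, hw0⟩ := Submodule.exists_mem_ne_zero_of_ne_bot hW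
    have hwm : w ∈ smulSub K (V ^ d) W :=
      Submodule.subset_span ⟨1, by simpa using Submodule.pow_mem_pow V h1 d, w, hw, by simp⟩
    have e := hc w hwm
    rw [← mul_one (C c), C_mul', map_smul, hφ1, smul_assoc, one_smul] at e
    exact (smul_eq_zero.mp e).resolve_right hw0
  induction d with
  | zero =>
    intro p hp hm
    have : p = C (coeff 0 p) := by
      ext s
      rw [coeff_C]
      split_ifs with hs
      · rw [hs]
      · by_contra hne
        exact hs ((Finsupp.degree_eq_zero_iff s).mp (Nat.le_zero.mp (hp s hne))).symm
    rw [this] at hm ⊢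
    rw [hconst 0 _ hm, C_0]
  | succ d ih =>
    intro p hp hm
    have hdeg : ∀ j, ∀ s, coeff s (pderiv j p) ≠ 0 → s.degree ≤ d := by
      intro j s hs
      rw [coeff_pderiv] at hs
      have := hp _ (left_ne_zero_of_mul hs)
      rw [map_add, Finsupp.degree_single] at this
      omega
    have hmono : smulSub K (V ^ d) W ≤ smulSub K (V ^ (d + 1)) W :=
      smulSub_mono (sub_pow_mono h1 (Nat.le_succ d))
    have hstep : ∀ a ∈ V, ∀ m ∈ smulSub K (V ^ d) W, a • m ∈ smulSub K (V ^ (d + 1)) W := by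
      intro a ha m hmm
      have := smulSub_mem (j := 1) (by simpa using ha) hmm
      rwa [add_comm] at this
    obtain ⟨c, rfl⟩ := const_of_pderiv p (by
      rintro (j | j)
      · refine ih _ (hdeg _) fun m hmm => ?_
        rw [← hφD, sub_smul, mul_smul, mul_smul, hm _ (hmono hmm), hm _ (hstep _ (hD j) _ hmm)]
        simp
      · refine ih _ (hdeg _) fun m hmm => ?_
        rw [← hφX, sub_smul, mul_smul, mul_smul, hm _ (hmono hmm), hm _ (hstep _ (hX j) _ hmm)]
        simp)
    rw [hconst _ _ hm, C_0]

lemma dim_bound [CharZero K] {n : ℕ} {X D : Fin n → A} (h : IsWeylAlgebra K A n X D)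
    (V : Submodule K A) (h1 : (1 : A) ∈ V) (hX : ∀ i, X i ∈ V) (hD : ∀ i, D i ∈ V)
    (hV : V.FG) (W : Submodule K M) (hW : W ≠ ⊥) (hWf : W.FG) (k d : ℕ) (hd : 2 * n * k ≤ d) :
    (k + 1) ^ (2 * n) ≤ Module.finrank K (smulSub K (V ^ d) W) *
      Module.finrank K (smulSub K (V ^ (2 * d)) W) := by
  obtain ⟨φ, hφ1, hφD, hφX, hφV⟩ := exists_phi h V h1 hX hD
  have f1 : FiniteDimensional K (smulSub K (V ^ d) W) := smulSub_fin (hV.pow d) hWf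
  have f2 : FiniteDimensional K (smulSub K (V ^ (2 * d)) W) := smulSub_fin (hV.pow _) hWf
  let P : Submodule K (MvPolynomial (Fin n ⊕ Fin n) K) :=
    { carrier := {p | ∀ s, coeff s p ≠ 0 → s.degree ≤ d}
      zero_mem' := by intro s hs; simp at hs
      add_mem' := by
        intro p q hp hq s hs
        rw [coeff_add] at hs
        by_cases h0 : coeff s p = 0
        · exact hq s (by simpa [h0] using hs)
        · exact hp s h0
      smul_mem' := by
        intro c p hp s hs
        rw [coeff_smul, smul_eq_mul] at hs
        exact hp s (right_ne_zero_of_mul hs) }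
  let Φ : P →ₗ[K] (smulSub K (V ^ d) W →ₗ[K] smulSub K (V ^ (2 * d)) W) :=
    { toFun := fun p => ((Algebra.lsmul K K M (φ p.1))).restrict (fun m hm => by
        rw [two_mul]; exact smulSub_mem (hφV d p.1 p.2) hm)
      map_add' := by intro p q; ext m; simp
      map_smul' := by intro c p; ext m; simp }
  have hΦ : LinearMap.ker Φ = ⊥ := by
    rw [LinearMap.ker_eq_bot']
    intro p hp
    refine Subtype.ext (inj_key V h1 hX hD φ hφ1 hφD hφX W hW d p.1 p.2 fun m hm => ?_)
    have := congrArg Subtype.val (LinearMap.congr_fun hp ⟨m, hm⟩)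
    simpa [Φ] using this
  let e : ((Fin n ⊕ Fin n) → Fin (k + 1)) → (Fin n ⊕ Fin n →₀ ℕ) :=
    fun f => Finsupp.equivFunOnFinite.symm fun i => (f i : ℕ)
  have he : Function.Injective e := by
    intro f g hfg
    ext i
    exact DFunLike.congr_fun hfg i
  have hmem : ∀ f, (monomial (e f) (1 : K)) ∈ P := by
    classical
    intro f s hs
    rw [coeff_monomial] at hs
    have hs : e f = s := by by_contra hne; simp [hne] at hs
    rw [← hs, Finsupp.degree_eq_sum]
    calc ∑ i, e f i ≤ ∑ i : Fin n ⊕ Fin n, k :=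
          Finset.sum_le_sum fun i _ => Nat.lt_succ_iff.mp (f i).2
      _ = 2 * n * k := by simp [two_mul]
      _ ≤ d := hd
  have li0 : LinearIndependent K fun f => (monomial (e f) (1 : K)) := by
    have := (basisMonomials (Fin n ⊕ Fin n) K).linearIndependent.comp e he
    rwa [coe_basisMonomials] at this
  have li1 : LinearIndependent K fun f => (⟨monomial (e f) (1 : K), hmem f⟩ : P) :=
    LinearIndependent.of_comp P.subtype li0
  have li2 := li1.map' Φ hΦ
  have := li2.fintype_card_le_finrank
  rw [Module.finrank_linearMap] at this
  refine le_trans (le_of_eq ?_) this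
  simp [two_mul]

lemma analytic_bound (n : ℕ) (r : ℝ) (f : ℕ → ℕ)
    (hf : ∀ k d, 2 * n * k ≤ d → (k + 1) ^ (2 * n) ≤ f d * f (2 * d))
    (hr : ∀ᶠ i in atTop, (f i : ℕ∞) ≤ (⌊(i : ℝ) ^ r⌋₊ : ℕ∞)) : (n : ℝ) ≤ r := by
  by_contra hlt
  push Not at hlt
  set c : ℕ := 2 * n + 1 with hc
  have t1 : Tendsto (fun k : ℕ => c * k) atTop atTop :=
    tendsto_id.const_mul_atTop' (by omega)
  have t2 : Tendsto (fun k : ℕ => 2 * (c * k)) atTop atTop :=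
    t1.const_mul_atTop' (by omega)
  have hr' : ∀ᶠ i : ℕ in atTop, (f i : ℝ) ≤ (i : ℝ) ^ r := by
    filter_upwards [hr] with i hi
    have : f i ≤ ⌊(i : ℝ) ^ r⌋₊ := by exact_mod_cast hi
    exact le_trans (by exact_mod_cast this) (Nat.floor_le (by positivity))
  have t3 : Tendsto (fun k : ℕ => (k : ℝ) ^ (2 * ((n : ℝ) - r))) atTop atTop :=
    (tendsto_rpow_atTop (by linarith)).comp tendsto_natCast_atTop_atTop
  obtain ⟨k, h1, h2, h3, hk⟩ := ((t1.eventually hr').and ((t2.eventually hr').and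
    ((t3.eventually_gt_atTop ((c : ℝ) ^ r * (2 * c : ℝ) ^ r)).and (eventually_gt_atTop 0)))).exists
  have hk' : (0 : ℝ) < k := by exact_mod_cast hk
  have hb : ((k : ℝ) + 1) ^ (2 * n) ≤ f (c * k) * f (2 * (c * k)) := by
    exact_mod_cast hf k (c * k) (Nat.mul_le_mul_right _ (by omega))
  have hb2 : (k : ℝ) ^ (2 * n) ≤ (c : ℝ) ^ r * (2 * c : ℝ) ^ r * (k : ℝ) ^ (2 * r) := by
    calc (k : ℝ) ^ (2 * n) ≤ ((k : ℝ) + 1) ^ (2 * n) := by gcongr; linarith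
      _ ≤ _ := hb
      _ ≤ ((c * k : ℕ) : ℝ) ^ r * ((2 * (c * k) : ℕ) : ℝ) ^ r := by gcongr
      _ = (c : ℝ) ^ r * (2 * c : ℝ) ^ r * (k : ℝ) ^ (2 * r) := by
        push_cast
        rw [← mul_assoc 2, Real.mul_rpow (by positivity) hk'.le,
          Real.mul_rpow (by positivity) hk'.le, two_mul r, Real.rpow_add hk']
        ring
  have : (k : ℝ) ^ (2 * n) = (k : ℝ) ^ (2 * ((n : ℝ) - r)) * (k : ℝ) ^ (2 * r) := by
    rw [← Real.rpow_add hk', ← Real.rpow_natCast]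
    congr 1; push_cast; ring
  rw [this] at hb2
  exact absurd (le_of_mul_le_mul_right hb2 (by positivity)) (not_le.mpr h3)

end Bern

/-- **Bernstein's inequality.** Let `A_n` be the `n`-th Weyl algebra over a field of
characteristic zero. Then `GK(M) ≥ n` for all nonzero finitely generated `A_n`-modules
`M` (GK dimension computed w.r.t. the standard filtration by total degree in the
canonical generators). -/
theorem bernstein_inequality
    (K A : Type) [Field K] [CharZero K] [Ring A] [Algebra K A]
    (n : ℕ) (X D : Fin n → A) (h : IsWeylAlgebra K A n X D)
    (M : Type) [AddCommGroup M] [Module K M] [Module A M] [IsScalarTower K A M]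
    [Nontrivial M] [Module.Finite A M]
    (W : Submodule K M) (hW : IsGenSub K A W) :
    (n : EReal) ≤
      gkModW K (Submodule.span K (insert (1 : A) (Set.range X ∪ Set.range D))) W := by
  set V := Submodule.span K (insert (1 : A) (Set.range X ∪ Set.range D)) with hVdef
  have h1 : (1 : A) ∈ V := Submodule.subset_span (Set.mem_insert _ _)
  have hX : ∀ i, X i ∈ V := fun i => Submodule.subset_span (Or.inr (Or.inl ⟨i, rfl⟩))
  have hD : ∀ i, D i ∈ V := fun i => Submodule.subset_span (Or.inr (Or.inr ⟨i, rfl⟩))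
  have hV : V.FG := Submodule.fg_span
    (((Set.finite_range X).union (Set.finite_range D)).insert 1)
  have hWf : W.FG := Module.Finite.iff_fg.mp hW.1
  have hW0 : W ≠ ⊥ := by
    intro h0
    have h2 := hW.2
    rw [h0] at h2
    simp at h2
  refine le_sInf ?_
  rintro _ ⟨r, rfl, hr⟩
  have := analytic_bound n r (fun i => Module.finrank K (smulSub K (V ^ i) W))
    (fun k d hd => dim_bound h V h1 hX hD hV W hW0 hWf k d hd) hr
  exact_mod_cast this

end
end
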